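/- Let ρ₁ and ρ₂ be quantum states of dimensions d₁ and d₂, let {S_d}_{d≥1} satisfy Assumption 1′, suppose S_{d₁} contains a state whose support contains supp(ρ₁) and S_{d₂} contains a state whose support contains supp(ρ₂), and suppose each S_d is invariant under permutations of tensor factors. Then the regularized minimized Umegaki relative entropy 𝔇^∞(ρ) := lim_{n→∞} (1/n) · min_{σ⁽ⁿ⁾ ∈ S_{d^n}} D(ρ^{⊗n}‖σ⁽ⁿ⁾) (for a state ρ of dimension d) is strongly additive: 𝔇^∞(ρ₁ ⊗ ρ₂) = 𝔇^∞(ρ₁) + 𝔇^∞(ρ₂). -/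

import Mathlib

open scoped BigOperators ComplexOrder Classical
open MeasureTheory Filter Set

noncomputable section

namespace QHT

variable {ι : Type*} [Fintype ι] [DecidableEq ι]

/-- Generalized matrix power `A ^ w` (complex exponent `w`) of a Hermitian matrix,
via functional calculus on the support: the eigenvalue `0` is mapped to `0`. -/
def mpow (A : Matrix ι ι ℂ) (w : ℂ) : Matrix ι ι ℂ :=
  if hA : A.IsHermitian then
    (hA.eigenvectorUnitary : Matrix ι ι ℂ) *
      Matrix.diagonal (fun i => if hA.eigenvalues i = 0 then 0 else (hA.eigenvalues i : ℂ) ^ w) *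
      star (hA.eigenvectorUnitary : Matrix ι ι ℂ)
  else 0

/-- Matrix logarithm of a Hermitian matrix, taken on its support
(`Real.log 0 = 0`, so the kernel is mapped to `0`). -/
def mlog (A : Matrix ι ι ℂ) : Matrix ι ι ℂ :=
  if hA : A.IsHermitian then
    (hA.eigenvectorUnitary : Matrix ι ι ℂ) *
      Matrix.diagonal (fun i => (Real.log (hA.eigenvalues i) : ℂ)) *
      star (hA.eigenvectorUnitary : Matrix ι ι ℂ)
  else 0

/-- The support of a matrix, i.e. its range as a linear map. -/
def msupp (A : Matrix ι ι ℂ) : Submodule ℂ (ι → ℂ) := LinearMap.range A.mulVecLin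

/-- A quantum state: a positive semidefinite matrix of trace one. -/
def IsState (A : Matrix ι ι ℂ) : Prop := A.PosSemidef ∧ A.trace = 1

/-- Real part of the trace. -/
def rtr (A : Matrix ι ι ℂ) : ℝ := A.trace.re

/-- The Umegaki relative entropy `D(ρ‖σ)`, with value `+∞` when `supp ρ ⊄ supp σ`. -/
def relEnt (ρ σ : Matrix ι ι ℂ) : EReal :=
  if msupp ρ ≤ msupp σ then ((rtr (ρ * (mlog ρ - mlog σ)) : ℝ) : EReal) else ⊤

/-- The polar of a set of matrices (intersected with the PSD cone). -/
def polar (S : Set (Matrix ι ι ℂ)) : Set (Matrix ι ι ℂ) :=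
  {X | X.PosSemidef ∧ ∀ Y ∈ S, rtr (X * Y) ≤ 1}

/-- Entrywise Bochner integral of a matrix-valued function over `ℝ`. -/
def mInt (f : ℝ → Matrix ι ι ℂ) : Matrix ι ι ℂ :=
  Matrix.of fun i j => ∫ t : ℝ, f t i j

/-- Entrywise Bochner integral of a matrix-valued function over a set `s ⊆ ℝ`. -/
def mIntOn (f : ℝ → Matrix ι ι ℂ) (s : Set ℝ) : Matrix ι ι ℂ :=
  Matrix.of fun i j => ∫ t in s, f t i j

/-- `sinc` function. -/
def sinc (s : ℝ) : ℝ := if s = 0 then 1 else Real.sin s / s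

/-- The probability density `β_θ` from the paper (`β₀` is the `θ → 0` limit). -/
def betaDist (θ t : ℝ) : ℝ :=
  if θ = 0 then Real.pi / (2 * (Real.cosh (Real.pi * t) + 1))
  else Real.sin (θ * Real.pi) / (2 * θ * (Real.cosh (Real.pi * t) + Real.cos (θ * Real.pi)))

/-- `Q_{α,z}(ρ‖σ) = Tr[(ρ^{α/2z} σ^{(1-α)/z} ρ^{α/2z})^z]`. -/
def Qaz (α z : ℝ) (ρ σ : Matrix ι ι ℂ) : ℝ :=
  rtr (mpow (mpow ρ ((α / (2 * z) : ℝ) : ℂ) * mpow σ (((1 - α) / z : ℝ) : ℂ) *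
      mpow ρ ((α / (2 * z) : ℝ) : ℂ)) ((z : ℝ) : ℂ))

/-- The `α`-`z` Rényi relative entropy. -/
def Daz (α z : ℝ) (ρ σ : Matrix ι ι ℂ) : EReal :=
  if (α < 1 ∧ (ρ * σ).trace ≠ 0) ∨ msupp ρ ≤ msupp σ then
    (((α - 1)⁻¹ * Real.log (Qaz α z ρ σ) : ℝ) : EReal)
  else ⊤

/-- `Q_α(ρ‖σ) = Tr[ρ^α σ^{1-α}]` (Petz). -/
def Qpetz (α : ℝ) (ρ σ : Matrix ι ι ℂ) : ℝ :=
  rtr (mpow ρ ((α : ℝ) : ℂ) * mpow σ (((1 - α) : ℝ) : ℂ))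

/-- The Petz Rényi divergence. -/
def Dpetz (α : ℝ) (ρ σ : Matrix ι ι ℂ) : EReal :=
  if (α < 1 ∧ (ρ * σ).trace ≠ 0) ∨ msupp ρ ≤ msupp σ then
    (((α - 1)⁻¹ * Real.log (Qpetz α ρ σ) : ℝ) : EReal)
  else ⊤

/-- `Q̃_α(ρ‖σ) = Tr[(σ^{(1-α)/2α} ρ σ^{(1-α)/2α})^α]` (sandwiched). -/
def Qsand (α : ℝ) (ρ σ : Matrix ι ι ℂ) : ℝ :=
  rtr (mpow (mpow σ (((1 - α) / (2 * α) : ℝ) : ℂ) * ρ * mpow σ (((1 - α) / (2 * α) : ℝ) : ℂ))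
    ((α : ℝ) : ℂ))

/-- The sandwiched Rényi divergence. -/
def Dsand (α : ℝ) (ρ σ : Matrix ι ι ℂ) : EReal :=
  if (α < 1 ∧ (ρ * σ).trace ≠ 0) ∨ msupp ρ ≤ msupp σ then
    (((α - 1)⁻¹ * Real.log (Qsand α ρ σ) : ℝ) : EReal)
  else ⊤

/-- `D̃_∞(ρ‖σ)`: the limit of `D̃_α(ρ‖σ)` as `α → +∞` (encoded as a `limsup`; the limit
exists by monotonicity in `α`). -/
def DsandInf (ρ σ : Matrix ι ι ℂ) : EReal :=
  Filter.limsup (fun α : ℝ => Dsand α ρ σ) Filter.atTop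

/-- `χ_{α,z}(ρ,σ) = ρ^{α/2z} (ρ^{α/2z} σ^{(1-α)/z} ρ^{α/2z})^{z-1} ρ^{α/2z}`. -/
def chi (α z : ℝ) (ρ σ : Matrix ι ι ℂ) : Matrix ι ι ℂ :=
  mpow ρ ((α / (2 * z) : ℝ) : ℂ) *
    mpow (mpow ρ ((α / (2 * z) : ℝ) : ℂ) * mpow σ (((1 - α) / z : ℝ) : ℂ) *
      mpow ρ ((α / (2 * z) : ℝ) : ℂ)) (((z - 1 : ℝ)) : ℂ) *
    mpow ρ ((α / (2 * z) : ℝ) : ℂ)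

/-- The data-processing region `𝒟` for `α`-`z` Rényi relative entropies. -/
def Dregion : Set (ℝ × ℝ) :=
  {p | (0 < p.1 ∧ p.1 < 1 ∧ max p.1 (1 - p.1) ≤ p.2) ∨
       (1 < p.1 ∧ max (p.1 / 2) (p.1 - 1) ≤ p.2 ∧ p.2 ≤ p.1) ∨
       (p.1 = 1 ∧ 0 < p.2)}

end QHT

namespace QHT

variable {ι : Type*} [Fintype ι] [DecidableEq ι]

/-! ### Tensor products and many copies -/

/-- Tensor product of a `d₁`- and a `d₂`-dimensional operator, as a `d₁d₂`-dimensional one. -/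
def dtens {a b : ℕ} (A : Matrix (Fin a) (Fin a) ℂ) (B : Matrix (Fin b) (Fin b) ℂ) :
    Matrix (Fin (a * b)) (Fin (a * b)) ℂ :=
  Matrix.of fun x y =>
    A (finProdFinEquiv.symm x).1 (finProdFinEquiv.symm y).1 *
      B (finProdFinEquiv.symm x).2 (finProdFinEquiv.symm y).2

/-- `ρ^{⊗n}` of a `d`-dimensional operator, as a `d^n`-dimensional operator. -/
def dpow {d : ℕ} (ρ : Matrix (Fin d) (Fin d) ℂ) (n : ℕ) :
    Matrix (Fin (d ^ n)) (Fin (d ^ n)) ℂ :=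
  Matrix.of fun x y => ∏ i, ρ (finFunctionFinEquiv.symm x i) (finFunctionFinEquiv.symm y i)

/-- The action of a permutation of the `k` tensor factors on an operator on `(ℂ^d)^{⊗k}`. -/
def permMat (d k : ℕ) (π : Equiv.Perm (Fin k)) (A : Matrix (Fin (d ^ k)) (Fin (d ^ k)) ℂ) :
    Matrix (Fin (d ^ k)) (Fin (d ^ k)) ℂ :=
  Matrix.of fun x y =>
    A (finFunctionFinEquiv ((finFunctionFinEquiv.symm x) ∘ π))
      (finFunctionFinEquiv ((finFunctionFinEquiv.symm y) ∘ π))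

/-- `ρ^{⊗n}` of a `d`-dimensional operator, as an operator on `H^{⊗n}` with `H = ℂ^d`,
indexed by tuples. -/
def tpow {d : ℕ} (ρ : Matrix (Fin d) (Fin d) ℂ) (n : ℕ) :
    Matrix (Fin n → Fin d) (Fin n → Fin d) ℂ :=
  Matrix.of fun x y => ∏ i, ρ (x i) (y i)

/-- Tensor product of an operator on `H^{⊗m}` and an operator on `H^{⊗n}`, as an
operator on `H^{⊗(m+n)}`. -/
def tensOp {d m n : ℕ} (A : Matrix (Fin m → Fin d) (Fin m → Fin d) ℂ)
    (B : Matrix (Fin n → Fin d) (Fin n → Fin d) ℂ) :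
    Matrix (Fin (m + n) → Fin d) (Fin (m + n) → Fin d) ℂ :=
  Matrix.of fun x y =>
    A (fun i => x (Fin.castAdd n i)) (fun i => y (Fin.castAdd n i)) *
      B (fun j => x (Fin.natAdd m j)) (fun j => y (Fin.natAdd m j))

/-- Permutation action on operators on `H^{⊗k}`. -/
def permOp {d k : ℕ} (π : Equiv.Perm (Fin k))
    (A : Matrix (Fin k → Fin d) (Fin k → Fin d) ℂ) :
    Matrix (Fin k → Fin d) (Fin k → Fin d) ℂ :=
  Matrix.of fun x y => A (x ∘ π) (y ∘ π)

/-! ### Hypothesis testing -/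

/-- A test: an operator `T` with `0 ≤ T ≤ I`. -/
def IsTest (T : Matrix ι ι ℂ) : Prop := T.PosSemidef ∧ (1 - T).PosSemidef

/-- Type I error `α_n(ρ|T) = Tr[(I - T) ρ^{⊗n}]`. -/
def typeI {d : ℕ} (ρ : Matrix (Fin d) (Fin d) ℂ) (n : ℕ)
    (T : Matrix (Fin n → Fin d) (Fin n → Fin d) ℂ) : ℝ :=
  rtr ((1 - T) * tpow ρ n)

/-- Type II error `β_n(S|T) = sup_{σ ∈ S} Tr[σ T]`. -/
def typeII {d n : ℕ} (S : Set (Matrix (Fin n → Fin d) (Fin n → Fin d) ℂ))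
    (T : Matrix (Fin n → Fin d) (Fin n → Fin d) ℂ) : ℝ :=
  sSup ((fun σ => rtr (σ * T)) '' S)

/-- `- log x`, valued in `EReal`, with `- log x = +∞` for `x ≤ 0`. -/
def negLog (x : ℝ) : EReal := if x ≤ 0 then ⊤ else ((- Real.log x : ℝ) : EReal)

/-- The exponential rate `-(1/n) log x`. -/
def rate (n : ℕ) (x : ℝ) : EReal := (((n : ℝ)⁻¹ : ℝ) : EReal) * negLog x

/-- The Stein exponent `s(ρ‖{S_n})`. -/
def steinExp {d : ℕ} (ρ : Matrix (Fin d) (Fin d) ℂ)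
    (S : (n : ℕ) → Set (Matrix (Fin n → Fin d) (Fin n → Fin d) ℂ)) : EReal :=
  sSup ((fun r : ℝ => (r : EReal)) ''
    {r : ℝ | 0 ≤ r ∧ ∃ T : (n : ℕ) → Matrix (Fin n → Fin d) (Fin n → Fin d) ℂ,
      (∀ n, IsTest (T n)) ∧
      (r : EReal) ≤ Filter.liminf (fun n => rate n (typeII (S n) (T n))) Filter.atTop ∧
      Filter.Tendsto (fun n => typeI ρ n (T n)) Filter.atTop (nhds 0)})

/-- The Chernoff exponent `c(ρ‖{S_n})`. -/
def chernoffExp {d : ℕ} (ρ : Matrix (Fin d) (Fin d) ℂ)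
    (S : (n : ℕ) → Set (Matrix (Fin n → Fin d) (Fin n → Fin d) ℂ)) : EReal :=
  Filter.liminf (fun n =>
    rate n (sInf ((fun T => typeI ρ n T + typeII (S n) T) '' {T | IsTest T}))) Filter.atTop

/-- The Hoeffding (direct) exponent `d_r(ρ‖{S_n})`. -/
def hoeffdingExp {d : ℕ} (r : ℝ) (ρ : Matrix (Fin d) (Fin d) ℂ)
    (S : (n : ℕ) → Set (Matrix (Fin n → Fin d) (Fin n → Fin d) ℂ)) : EReal :=
  ⨆ T : {T : (n : ℕ) → Matrix (Fin n → Fin d) (Fin n → Fin d) ℂ //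
      (∀ n, IsTest (T n)) ∧
      (r : EReal) ≤ Filter.liminf (fun n => rate n (typeII (S n) (T n))) Filter.atTop},
    Filter.liminf (fun n => rate n (typeI ρ n (T.1 n))) Filter.atTop

/-- The strong converse exponent `sc_r(ρ‖{S_n})`. -/
def scExp {d : ℕ} (r : ℝ) (ρ : Matrix (Fin d) (Fin d) ℂ)
    (S : (n : ℕ) → Set (Matrix (Fin n → Fin d) (Fin n → Fin d) ℂ)) : EReal :=
  ⨅ T : {T : (n : ℕ) → Matrix (Fin n → Fin d) (Fin n → Fin d) ℂ //
      (∀ n, IsTest (T n)) ∧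
      (r : EReal) ≤ Filter.liminf (fun n => rate n (typeII (S n) (T n))) Filter.atTop},
    Filter.limsup (fun n => rate n (1 - typeI ρ n (T.1 n))) Filter.atTop

/-- Assumption 1 of the paper for a family `{S_n}_{n ≥ 1}` of sets of operators
on `H^{⊗n}`, `H = ℂ^d`: each `S_n` is a convex compact set of positive semidefinite
operators, closed under tensor products, and with polar sets closed under tensor
products. -/
structure Assumption1 {d : ℕ}
    (S : (n : ℕ) → Set (Matrix (Fin n → Fin d) (Fin n → Fin d) ℂ)) : Prop where
  psd : ∀ n, 1 ≤ n → ∀ X ∈ S n, X.PosSemidef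
  convex : ∀ n, 1 ≤ n → Convex ℝ (S n)
  compact : ∀ n, 1 ≤ n → IsCompact (S n)
  tens : ∀ m n, 1 ≤ m → 1 ≤ n → ∀ A ∈ S m, ∀ B ∈ S n, tensOp A B ∈ S (m + n)
  polarTens : ∀ m n, 1 ≤ m → 1 ≤ n →
    ∀ A ∈ polar (S m), ∀ B ∈ polar (S n), tensOp A B ∈ polar (S (m + n))

/-- Assumption 1′ of the paper for a dimension-indexed family `{S_d}_{d ≥ 1}`. -/
structure Assumption1' (S : (d : ℕ) → Set (Matrix (Fin d) (Fin d) ℂ)) : Prop where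
  psd : ∀ d, 1 ≤ d → ∀ X ∈ S d, X.PosSemidef
  convex : ∀ d, 1 ≤ d → Convex ℝ (S d)
  compact : ∀ d, 1 ≤ d → IsCompact (S d)
  tens : ∀ d₁ d₂, 1 ≤ d₁ → 1 ≤ d₂ → ∀ A ∈ S d₁, ∀ B ∈ S d₂, dtens A B ∈ S (d₁ * d₂)
  polarTens : ∀ d₁ d₂, 1 ≤ d₁ → 1 ≤ d₂ →
    ∀ A ∈ polar (S d₁), ∀ B ∈ polar (S d₂), dtens A B ∈ polar (S (d₁ * d₂))

end QHT

set_option linter.unusedSectionVars false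

namespace QHT

variable {ι : Type*} [Fintype ι] [DecidableEq ι]

/-- The support function of `S` in direction `X`. -/
def supp (S : Set (Matrix ι ι ℂ)) (X : Matrix ι ι ℂ) : ℝ := sSup ((fun σ => rtr (X * σ)) '' S)

open scoped MatrixOrder Matrix.Norms.L2Operator in
theorem PosSemidef.exists_eq_conjTranspose_mul {A : Matrix ι ι ℂ} (hA : A.PosSemidef) :
    ∃ C : Matrix ι ι ℂ, A = C.conjTranspose * C := by
  obtain ⟨C, hC⟩ := CStarAlgebra.nonneg_iff_eq_star_mul_self.1 hA.nonneg
  exact ⟨C, hC⟩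

theorem trace_mul_nonneg {A B : Matrix ι ι ℂ} (hA : A.PosSemidef) (hB : B.PosSemidef) :
    0 ≤ (A * B).trace := by
  obtain ⟨C, rfl⟩ := PosSemidef.exists_eq_conjTranspose_mul hA
  rw [Matrix.mul_assoc, Matrix.trace_mul_comm]
  exact (hB.mul_mul_conjTranspose_same C).trace_nonneg

theorem rtr_mul_nonneg {A B : Matrix ι ι ℂ} (hA : A.PosSemidef) (hB : B.PosSemidef) :
    0 ≤ rtr (A * B) := (Complex.nonneg_iff.1 (trace_mul_nonneg hA hB)).1

theorem rtr_mul_comm (A B : Matrix ι ι ℂ) : rtr (A * B) = rtr (B * A) := by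
  rw [rtr, rtr, Matrix.trace_mul_comm]

theorem continuous_rtr : Continuous (rtr : Matrix ι ι ℂ → ℝ) :=
  Complex.continuous_re.comp (Continuous.matrix_trace continuous_id)

theorem bddAbove_supp {S : Set (Matrix ι ι ℂ)} (hc : IsCompact S) (X : Matrix ι ι ℂ) :
    BddAbove ((fun σ => rtr (X * σ)) '' S) :=
  (hc.image (continuous_rtr.comp (continuous_const.mul continuous_id))).bddAbove

theorem rtr_le_supp {S : Set (Matrix ι ι ℂ)} (hc : IsCompact S) (X : Matrix ι ι ℂ)
    {σ : Matrix ι ι ℂ} (hσ : σ ∈ S) : rtr (X * σ) ≤ supp S X :=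
  le_csSup (bddAbove_supp hc X) ⟨σ, hσ, rfl⟩

theorem exists_rtr_eq_supp {S : Set (Matrix ι ι ℂ)} (hc : IsCompact S) (hne : S.Nonempty)
    (X : Matrix ι ι ℂ) : ∃ σ ∈ S, rtr (X * σ) = supp S X :=
  (hc.image (continuous_rtr.comp (continuous_const.mul continuous_id))).sSup_mem (hne.image _)

theorem supp_nonneg {S : Set (Matrix ι ι ℂ)} (hp : ∀ σ ∈ S, σ.PosSemidef) {X : Matrix ι ι ℂ}
    (hX : X.PosSemidef) : 0 ≤ supp S X := by
  apply Real.sSup_nonneg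
  rintro _ ⟨σ, hσ, rfl⟩
  exact rtr_mul_nonneg hX (hp σ hσ)

theorem mem_polar_iff_supp {S : Set (Matrix ι ι ℂ)} (hc : IsCompact S) {X : Matrix ι ι ℂ} :
    X ∈ polar S ↔ X.PosSemidef ∧ supp S X ≤ 1 := by
  refine and_congr_right fun _ => ⟨fun h => Real.sSup_le ?_ zero_le_one,
    fun h Y hY => (rtr_le_supp hc X hY).trans h⟩
  rintro _ ⟨σ, hσ, rfl⟩
  exact h σ hσ

theorem rtr_smul (c : ℝ) (A : Matrix ι ι ℂ) : rtr (c • A) = c * rtr A := by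
  simp [rtr, Matrix.trace_smul]

theorem posSemidef_smul {c : ℝ} (hc : 0 ≤ c) {A : Matrix ι ι ℂ} (hA : A.PosSemidef) :
    (c • A).PosSemidef := by
  have := hA.smul (a := (c : ℂ)) (by exact_mod_cast hc)
  convert this using 1
  ext i j
  simp

theorem smul_mem_polar {S : Set (Matrix ι ι ℂ)} (hc : IsCompact S) {X : Matrix ι ι ℂ}
    (hX : X.PosSemidef) {c : ℝ} (h : supp S X ≤ c) (h0 : 0 < c) : c⁻¹ • X ∈ polar S := by
  refine ⟨posSemidef_smul (by positivity) hX, fun Y hY => ?_⟩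
  rw [smul_mul_assoc, rtr_smul]
  have := rtr_le_supp hc X hY
  rw [inv_mul_le_iff₀ h0]; linarith

section dtens

variable {a b : ℕ}

theorem dtens_eq (A : Matrix (Fin a) (Fin a) ℂ) (B : Matrix (Fin b) (Fin b) ℂ) :
    dtens A B = (Matrix.kronecker A B).submatrix finProdFinEquiv.symm finProdFinEquiv.symm := rfl

theorem dtens_mul (A A' : Matrix (Fin a) (Fin a) ℂ) (B B' : Matrix (Fin b) (Fin b) ℂ) :
    dtens A B * dtens A' B' = dtens (A * A') (B * B') := by
  rw [dtens_eq, dtens_eq, dtens_eq, Matrix.submatrix_mul_equiv]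
  exact congrArg (fun M => Matrix.submatrix M _ _) (Matrix.mul_kronecker_mul A A' B B').symm

theorem trace_dtens (A : Matrix (Fin a) (Fin a) ℂ) (B : Matrix (Fin b) (Fin b) ℂ) :
    (dtens A B).trace = A.trace * B.trace := by
  rw [dtens_eq, ← Matrix.trace_kronecker A B]
  exact finProdFinEquiv.symm.sum_comp fun x => Matrix.kronecker A B x x

theorem posSemidef_dtens {A : Matrix (Fin a) (Fin a) ℂ} {B : Matrix (Fin b) (Fin b) ℂ}
    (hA : A.PosSemidef) (hB : B.PosSemidef) : (dtens A B).PosSemidef :=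
  (hA.kronecker hB).submatrix _

theorem dtens_smul_smul (c c' : ℝ) (A : Matrix (Fin a) (Fin a) ℂ) (B : Matrix (Fin b) (Fin b) ℂ) :
    dtens (c • A) (c' • B) = (c * c') • dtens A B := by
  ext i j
  simp [dtens]
  ring

theorem rtr_dtens_of_im {A : Matrix (Fin a) (Fin a) ℂ} (hA : A.trace.im = 0)
    (B : Matrix (Fin b) (Fin b) ℂ) : rtr (dtens A B) = rtr A * rtr B := by
  simp [rtr, trace_dtens, hA]

theorem trace_mul_im {A B : Matrix ι ι ℂ} (hA : A.PosSemidef) (hB : B.PosSemidef) :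
    (A * B).trace.im = 0 := (Complex.nonneg_iff.1 (trace_mul_nonneg hA hB)).2.symm

variable {S : (d : ℕ) → Set (Matrix (Fin d) (Fin d) ℂ)} (hS : Assumption1' S)
include hS

theorem supp_dtens (ha : 1 ≤ a) (hb : 1 ≤ b) {X : Matrix (Fin a) (Fin a) ℂ}
    {Y : Matrix (Fin b) (Fin b) ℂ} (hX : X.PosSemidef) (hY : Y.PosSemidef) :
    supp (S (a * b)) (dtens X Y) = supp (S a) X * supp (S b) Y := by
  have hab : 1 ≤ a * b := Nat.mul_pos ha hb
  have hXn := supp_nonneg (hS.psd a ha) hX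
  have hYn := supp_nonneg (hS.psd b hb) hY
  have hXY := supp_nonneg (hS.psd _ hab) (posSemidef_dtens hX hY)
  apply le_antisymm
  · have key : ∀ ε > 0, supp (S (a * b)) (dtens X Y) ≤
        (supp (S a) X + ε) * (supp (S b) Y + ε) := by
      intro ε hε
      have h1 := smul_mem_polar (hS.compact a ha) hX (c := supp (S a) X + ε) (by linarith)
        (by linarith)
      have h2 := smul_mem_polar (hS.compact b hb) hY (c := supp (S b) Y + ε) (by linarith)
        (by linarith)
      have h3 := hS.polarTens a b ha hb _ h1 _ h2
      rw [dtens_smul_smul] at h3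
      apply Real.sSup_le
      · rintro _ ⟨σ, hσ, rfl⟩
        have := h3.2 σ hσ
        rw [smul_mul_assoc, rtr_smul, ← mul_inv, inv_mul_le_iff₀ (by positivity)] at this
        simpa using this
      · positivity
    have ht : Tendsto (fun ε : ℝ => (supp (S a) X + ε) * (supp (S b) Y + ε))
        (nhdsWithin 0 (Ioi 0)) (nhds ((supp (S a) X + 0) * (supp (S b) Y + 0))) :=
      Tendsto.mono_left (Continuous.tendsto (by fun_prop) 0) nhdsWithin_le_nhds
    rw [add_zero, add_zero] at ht
    exact ge_of_tendsto ht (eventually_nhdsWithin_of_forall key)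
  · rcases (S a).eq_empty_or_nonempty with h | hna
    · have : supp (S a) X = 0 := by simp [supp, h]
      rw [this, zero_mul]; exact hXY
    rcases (S b).eq_empty_or_nonempty with h | hnb
    · have : supp (S b) Y = 0 := by simp [supp, h]
      rw [this, mul_zero]; exact hXY
    obtain ⟨σ, hσ, h1⟩ := exists_rtr_eq_supp (hS.compact a ha) hna X
    obtain ⟨τ, hτ, h2⟩ := exists_rtr_eq_supp (hS.compact b hb) hnb Y
    rw [← h1, ← h2, ← rtr_dtens_of_im (trace_mul_im hX (hS.psd a ha σ hσ)), ← dtens_mul]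
    exact rtr_le_supp (hS.compact _ hab) _ (hS.tens a b ha hb σ hσ τ hτ)

end dtens

end QHT

namespace QHT

section emb

variable {κ : Type*} [Fintype κ]

/-- The isometry-like matrix sending the basis vector `i` to the basis vector `x i`. -/
def embV (D : ℕ) (x : κ → ℕ) : Matrix (Fin D) κ ℂ := Matrix.of fun z i => if x i = z then 1 else 0

/-- Push-forward of the operator `Y` along the map of basis vectors `x`. -/
def emb (D : ℕ) (x : κ → ℕ) (Y : Matrix κ κ ℂ) : Matrix (Fin D) (Fin D) ℂ :=
  embV D x * Y * (embV D x).conjTranspose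

theorem posSemidef_emb (D : ℕ) (x : κ → ℕ) {Y : Matrix κ κ ℂ} (hY : Y.PosSemidef) :
    (emb D x Y).PosSemidef := hY.mul_mul_conjTranspose_same _

theorem emb_apply (D : ℕ) (x : κ → ℕ) (Y : Matrix κ κ ℂ) (z w : Fin D) :
    emb D x Y z w = ∑ i, ∑ j, if x i = z ∧ x j = w then Y i j else 0 := by
  simp only [emb, embV, Matrix.mul_apply, Matrix.conjTranspose_apply, Matrix.of_apply,
    Finset.sum_mul]
  rw [Finset.sum_comm]
  refine Finset.sum_congr rfl fun i _ => Finset.sum_congr rfl fun j _ => ?_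
  by_cases h1 : x i = z <;> by_cases h2 : x j = w <;> simp [h1, h2]

theorem emb_val (D : ℕ) (Y : Matrix (Fin D) (Fin D) ℂ) : emb D (fun i : Fin D => (i : ℕ)) Y = Y := by
  have : embV D (fun i : Fin D => (i : ℕ)) = 1 := by
    ext z i
    simp [embV, Matrix.one_apply, Fin.ext_iff, eq_comm]
  rw [emb, this]
  simp

theorem rtr_emb_mul {D : ℕ} (x : κ → Fin D) (Y : Matrix κ κ ℂ) (σ : Matrix (Fin D) (Fin D) ℂ) :
    rtr (emb D (fun i => (x i : ℕ)) Y * σ) = rtr (Y * σ.submatrix x x) := by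
  have : (embV D (fun i => (x i : ℕ))).conjTranspose * σ * embV D (fun i => (x i : ℕ)) =
      σ.submatrix x x := by
    ext i j
    simp [Matrix.mul_apply, embV, ← Fin.ext_iff]
  rw [← this, emb, rtr, rtr, Matrix.mul_assoc, Matrix.mul_assoc, Matrix.trace_mul_comm,
    Matrix.mul_assoc]

theorem dtens_emb {a b : ℕ} (α : ℕ) {x : κ → ℕ} (hx : ∀ i, x i < b) (Y : Matrix κ κ ℂ) :
    dtens (emb a (fun _ : Unit => α) 1) (emb b x Y) = emb (a * b) (fun i => α * b + x i) Y := by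
  ext z w
  obtain ⟨z, rfl⟩ := finProdFinEquiv.surjective z
  obtain ⟨w, rfl⟩ := finProdFinEquiv.surjective w
  have key : ∀ (i : κ) (z : Fin a × Fin b), α * b + x i = (finProdFinEquiv z : Fin (a * b)) ↔
      (α = z.1 ∧ x i = z.2) := by
    intro i z
    have hb : 0 < b := (Nat.zero_le _).trans_lt (hx i)
    rw [finProdFinEquiv_apply_val]
    constructor
    · intro h
      have h1 : (α * b + x i) / b = (z.2 + b * z.1) / b := by rw [h]
      have h2 : (α * b + x i) % b = (z.2 + b * z.1) % b := by rw [h]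
      rw [Nat.add_mul_div_left _ _ hb, add_comm, Nat.add_mul_div_right _ _ hb,
        Nat.div_eq_of_lt (hx i), Nat.div_eq_of_lt z.2.2] at h1
      rw [Nat.add_mul_mod_self_left, add_comm, Nat.add_mul_mod_self_right,
        Nat.mod_eq_of_lt (hx i), Nat.mod_eq_of_lt z.2.2] at h2
      omega
    · rintro ⟨h1, h2⟩
      rw [h1, h2]; ring
  simp only [dtens, Matrix.of_apply, Equiv.symm_apply_apply, emb_apply, key, Finset.univ_unique,
    Finset.sum_singleton, Finset.mul_sum]
  refine Finset.sum_congr rfl fun i _ => Finset.sum_congr rfl fun j _ => ?_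
  by_cases h1 : α = z.1 <;> by_cases h2 : α = w.1 <;> by_cases h3 : x i = z.2 <;>
    by_cases h4 : x j = w.2 <;> simp [h1, h2, h3, h4]

end emb

section pushforward

variable {κ : Type*} [Fintype κ] [DecidableEq κ]

/-- The support function of `S D` at the push-forward of `Y` along `x`. -/
def cfg (S : (d : ℕ) → Set (Matrix (Fin d) (Fin d) ℂ)) (D : ℕ) (x : κ → ℕ) (Y : Matrix κ κ ℂ) :
    ℝ := supp (S D) (emb D x Y)

/-- The largest `i`-th diagonal entry of a member of `S D`. -/
def wt (S : (d : ℕ) → Set (Matrix (Fin d) (Fin d) ℂ)) (D i : ℕ) : ℝ :=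
  cfg S D (fun _ : Unit => i) 1

theorem exists_perm_extending {α β : Type*} [Fintype β] [DecidableEq β] {f g : α → β}
    (hf : f.Injective) (hg : g.Injective) : ∃ π : Equiv.Perm β, ∀ a, π (f a) = g a := by
  let e : {x // x ∈ Set.range f} ≃ {x // x ∈ Set.range g} :=
    (Equiv.ofInjective f hf).symm.trans (Equiv.ofInjective g hg)
  refine ⟨e.extendSubtype, fun a => ?_⟩
  rw [Equiv.extendSubtype_apply_of_mem e (f a) ⟨a, rfl⟩]
  have : (⟨f a, ⟨a, rfl⟩⟩ : {x // x ∈ Set.range f}) = Equiv.ofInjective f hf a := rfl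
  rw [this]
  simp [e]

variable {S : (d : ℕ) → Set (Matrix (Fin d) (Fin d) ℂ)} (hS : Assumption1' S)

section tens
include hS

theorem cfg_nonneg {D : ℕ} (hD : 1 ≤ D) (x : κ → ℕ) {Y : Matrix κ κ ℂ} (hY : Y.PosSemidef) :
    0 ≤ cfg S D x Y := supp_nonneg (hS.psd D hD) (posSemidef_emb D x hY)

theorem wt_nonneg {D : ℕ} (hD : 1 ≤ D) (i : ℕ) : 0 ≤ wt S D i :=
  cfg_nonneg hS hD _ Matrix.PosSemidef.one

theorem cfg_mul {a b : ℕ} (ha : 1 ≤ a) (hb : 1 ≤ b) (α : ℕ) {x : κ → ℕ} (hx : ∀ i, x i < b)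
    {Y : Matrix κ κ ℂ} (hY : Y.PosSemidef) :
    cfg S (a * b) (fun i => α * b + x i) Y = wt S a α * cfg S b x Y := by
  rw [cfg, ← dtens_emb α hx, supp_dtens hS ha hb (posSemidef_emb _ _ Matrix.PosSemidef.one)
    (posSemidef_emb _ _ hY)]
  rfl

theorem wt_mul {a b : ℕ} (ha : 1 ≤ a) (hb : 1 ≤ b) (α : ℕ) {i : ℕ} (hi : i < b) :
    wt S (a * b) (α * b + i) = wt S a α * wt S b i :=
  cfg_mul hS ha hb α (fun _ => hi) Matrix.PosSemidef.one

theorem diag_le_wt {D : ℕ} (hD : 1 ≤ D) {σ : Matrix (Fin D) (Fin D) ℂ} (hσ : σ ∈ S D) (i : Fin D) :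
    (σ i i).re ≤ wt S D i := by
  have := rtr_le_supp (hS.compact D hD) (emb D (fun _ : Unit => (i : ℕ)) 1) hσ
  rw [rtr_emb_mul (fun _ : Unit => i), one_mul, rtr, Matrix.trace] at this
  simpa [wt, cfg] using this

end tens

variable (hperm : ∀ d k : ℕ, ∀ π : Equiv.Perm (Fin k),
      ∀ A ∈ S (d ^ k), permMat d k π A ∈ S (d ^ k))
include hperm hS

theorem cfg_perm {b K : ℕ} (hb : 1 ≤ b) (π : Equiv.Perm (Fin K)) (f : κ → Fin K → Fin b)
    {Y : Matrix κ κ ℂ} (hY : Y.PosSemidef) :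
    cfg S (b ^ K) (fun i => (finFunctionFinEquiv (f i ∘ π) : Fin (b ^ K))) Y =
      cfg S (b ^ K) (fun i => (finFunctionFinEquiv (f i) : Fin (b ^ K))) Y := by
  have hD : 1 ≤ b ^ K := Nat.one_le_pow _ _ hb
  have key : ∀ (π : Equiv.Perm (Fin K)) (f : κ → Fin K → Fin b),
      cfg S (b ^ K) (fun i => (finFunctionFinEquiv (f i ∘ π) : Fin (b ^ K))) Y ≤
      cfg S (b ^ K) (fun i => (finFunctionFinEquiv (f i) : Fin (b ^ K))) Y := by
    intro π f
    refine Real.sSup_le ?_ (cfg_nonneg hS hD _ hY)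
    rintro _ ⟨σ, hσ, rfl⟩
    have h := rtr_le_supp (hS.compact _ hD)
      (emb (b ^ K) (fun i => (finFunctionFinEquiv (f i) : Fin (b ^ K))) Y) (hperm b K π σ hσ)
    rw [rtr_emb_mul fun i => (finFunctionFinEquiv (f i) : Fin (b ^ K))] at h
    dsimp only
    rw [rtr_emb_mul fun i => (finFunctionFinEquiv (f i ∘ π) : Fin (b ^ K))]
    refine le_trans (le_of_eq ?_) h
    congr 2
    ext i j
    simp [permMat]
  refine le_antisymm (key π f) ?_
  have := key π⁻¹ (fun i => f i ∘ π)
  have hf : ∀ i, (f i ∘ π) ∘ (π⁻¹ : Equiv.Perm (Fin K)) = f i := fun i => by ext s; simp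
  simpa only [hf] using this

theorem cfg_digits {τ : Type*} [Fintype τ] {b K : ℕ} {pos pos' : τ → ℕ}
    (hp : pos.Injective) (hp' : pos'.Injective) (hpK : ∀ t, pos t < K) (hpK' : ∀ t, pos' t < K)
    (c : κ → τ → ℕ) (hc : ∀ i t, c i t < b) (hb : 1 ≤ b) {Y : Matrix κ κ ℂ} (hY : Y.PosSemidef) :
    cfg S (b ^ K) (fun i => ∑ t, c i t * b ^ pos t) Y =
      cfg S (b ^ K) (fun i => ∑ t, c i t * b ^ pos' t) Y := by
  obtain ⟨π, hπ⟩ := exists_perm_extending (f := fun t => (⟨pos t, hpK t⟩ : Fin K))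
    (g := fun t => (⟨pos' t, hpK' t⟩ : Fin K))
    (fun s t h => hp (by simpa using h)) (fun s t h => hp' (by simpa using h))
  let G : κ → Fin K → ℕ := fun i s => ∑ t, if pos' t = s then c i t else 0
  have hG : ∀ i t, G i ⟨pos' t, hpK' t⟩ = c i t := by
    intro i t
    simp only [G]
    rw [Finset.sum_eq_single t] <;> simp
    intro u hu h; exact absurd (hp' h) hu
  have hGb : ∀ i s, G i s < b := by
    intro i s
    by_cases h : ∃ t, pos' t = s
    · obtain ⟨t, ht⟩ := h
      have : s = ⟨pos' t, hpK' t⟩ := Fin.ext ht.symm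
      rw [this, hG]; exact hc i t
    · have : G i s = 0 := Finset.sum_eq_zero fun t _ => if_neg fun h' => h ⟨t, h'⟩
      omega
  have h2 : ∀ i, (finFunctionFinEquiv (fun s => (⟨G i s, hGb i s⟩ : Fin b)) : Fin (b ^ K)).val =
      ∑ t, c i t * b ^ pos' t := by
    intro i
    simp only [finFunctionFinEquiv_apply, G, Finset.sum_mul]
    rw [Finset.sum_comm]
    refine Finset.sum_congr rfl fun t _ => ?_
    rw [Finset.sum_eq_single ⟨pos' t, hpK' t⟩] <;> simp [Fin.ext_iff]
    intro s hs h; exact absurd h.symm hs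
  have h1 : ∀ i, (finFunctionFinEquiv ((fun s => (⟨G i s, hGb i s⟩ : Fin b)) ∘ π) :
      Fin (b ^ K)).val = ∑ t, c i t * b ^ pos t := by
    intro i
    simp only [finFunctionFinEquiv_apply, Function.comp_apply, G, Finset.sum_mul]
    rw [Finset.sum_comm]
    refine Finset.sum_congr rfl fun t _ => ?_
    rw [Finset.sum_eq_single ⟨pos t, hpK t⟩]
    · simp [hπ]
    · intro s _ hs
      rw [if_neg, zero_mul]
      intro h
      apply hs
      apply π.injective
      rw [hπ]
      exact Fin.ext h.symm
    · simp
  have := cfg_perm hS hperm hb π (fun i s => (⟨G i s, hGb i s⟩ : Fin b)) hY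
  simpa only [h1, h2] using this

end pushforward

end QHT

namespace QHT

/-- Abstract properties of the diagonal weights of a family closed under tensor products
together with its polars. -/
structure IsWt (W : ℕ → ℕ → ℝ) : Prop where
  nonneg : ∀ D i, 1 ≤ D → 0 ≤ W D i
  mul : ∀ a b x y, 1 ≤ a → 1 ≤ b → y < b → W (a * b) (x * b + y) = W a x * W b y

/-- The support of the weights in dimension `D`. -/
def wset (W : ℕ → ℕ → ℝ) (D : ℕ) : Set ℕ := {i | i < D ∧ 0 < W D i}

/-- `z` and `z + g` are consecutive elements of `Z`. -/
def IsGap (Z : Set ℕ) (z g : ℕ) : Prop :=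
  z ∈ Z ∧ z + g ∈ Z ∧ 0 < g ∧ ∀ t, 0 < t → t < g → z + t ∉ Z

theorem IsGap.exists {Z : Set ℕ} {z h : ℕ} (hz : z ∈ Z) (hh : h ∈ Z) (hlt : z < h) :
    ∃ g, IsGap Z z g := by
  have hex : ∃ g, 0 < g ∧ z + g ∈ Z := ⟨h - z, by omega, by rwa [Nat.add_sub_cancel' hlt.le]⟩
  refine ⟨Nat.find hex, hz, (Nat.find_spec hex).2, (Nat.find_spec hex).1, fun t h0 ht hm => ?_⟩
  exact Nat.find_min hex ht ⟨h0, hm⟩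

theorem IsGap.unique {Z : Set ℕ} {z g g' : ℕ} (h : IsGap Z z g) (h' : IsGap Z z g') : g = g' := by
  rcases lt_trichotomy g g' with hl | hl | hl
  · exact absurd h.2.1 (h'.2.2.2 g h.2.2.1 hl)
  · exact hl
  · exact absurd h'.2.1 (h.2.2.2 g' h'.2.2.1 hl)

namespace IsWt

variable {W : ℕ → ℕ → ℝ} (hW : IsWt W)
include hW

theorem mem_mul {a b : ℕ} (ha : 1 ≤ a) (hb : 1 ≤ b) {x y : ℕ} (hy : y < b) :
    x * b + y ∈ wset W (a * b) ↔ x ∈ wset W a ∧ y ∈ wset W b := by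
  have h1 : x * b + y < a * b ↔ x < a := by
    constructor
    · intro h
      by_contra hx
      have := Nat.mul_le_mul_right b (not_lt.1 hx)
      omega
    · intro h
      have := Nat.mul_le_mul_right b (Nat.succ_le_of_lt h)
      rw [Nat.succ_mul] at this
      omega
  have hx := hW.nonneg a x ha
  have hy' := hW.nonneg b y hb
  simp only [wset, mem_ofPred_eq, h1, hW.mul a b x y ha hb hy]
  constructor
  · rintro ⟨h, h2⟩
    refine ⟨⟨h, ?_⟩, hy, ?_⟩
    · exact lt_of_le_of_ne hx fun h0 => by rw [← h0] at h2; simp at h2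
    · exact lt_of_le_of_ne hy' fun h0 => by rw [← h0] at h2; simp at h2
  · rintro ⟨⟨h, h2⟩, _, h3⟩
    exact ⟨h, mul_pos h2 h3⟩

theorem mem_div_mod {a b : ℕ} (ha : 1 ≤ a) (hb : 1 ≤ b) {z : ℕ} (hz : z ∈ wset W (a * b)) :
    z / b ∈ wset W a ∧ z % b ∈ wset W b := by
  rw [← hW.mem_mul ha hb (Nat.mod_lt _ hb), Nat.div_add_mod']
  exact hz

theorem nonempty_mul {a b : ℕ} (ha : 1 ≤ a) (hb : 1 ≤ b) :
    (wset W (a * b)).Nonempty ↔ (wset W a).Nonempty ∧ (wset W b).Nonempty := by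
  constructor
  · rintro ⟨z, hz⟩
    have := hW.mem_div_mod ha hb hz
    exact ⟨⟨_, this.1⟩, ⟨_, this.2⟩⟩
  · rintro ⟨⟨x, hx⟩, ⟨y, hy⟩⟩
    exact ⟨_, (hW.mem_mul ha hb hy.1).2 ⟨hx, hy⟩⟩

theorem nonempty_pow {a n : ℕ} (ha : 1 ≤ a) (hn : 1 ≤ n) :
    (wset W (a ^ n)).Nonempty ↔ (wset W a).Nonempty := by
  induction n, hn using Nat.le_induction with
  | base => simp
  | succ n hn ih => rw [pow_succ, hW.nonempty_mul (Nat.one_le_pow _ _ ha) ha, ih, and_self]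

theorem isLeast_mul {a b l l' : ℕ} (ha : 1 ≤ a) (hb : 1 ≤ b) (h : IsLeast (wset W a) l)
    (h' : IsLeast (wset W b) l') : IsLeast (wset W (a * b)) (l * b + l') := by
  refine ⟨(hW.mem_mul ha hb h'.1.1).2 ⟨h.1, h'.1⟩, fun z hz => ?_⟩
  have := hW.mem_div_mod ha hb hz
  rw [← Nat.div_add_mod' z b]
  exact Nat.add_le_add (Nat.mul_le_mul_right _ (h.2 this.1)) (h'.2 this.2)

theorem isGreatest_mul {a b l l' : ℕ} (ha : 1 ≤ a) (hb : 1 ≤ b) (h : IsGreatest (wset W a) l)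
    (h' : IsGreatest (wset W b) l') : IsGreatest (wset W (a * b)) (l * b + l') := by
  refine ⟨(hW.mem_mul ha hb h'.1.1).2 ⟨h.1, h'.1⟩, fun z hz => ?_⟩
  have := hW.mem_div_mod ha hb hz
  rw [← Nat.div_add_mod' z b]
  exact Nat.add_le_add (Nat.mul_le_mul_right _ (h.2 this.1)) (h'.2 this.2)

theorem isLeast_comm {a b l l' : ℕ} (ha : 1 ≤ a) (hb : 1 ≤ b) (h : IsLeast (wset W a) l)
    (h' : IsLeast (wset W b) l') : l * b + l' = l' * a + l := by
  have h1 := hW.isLeast_mul ha hb h h'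
  rw [mul_comm] at h1
  exact h1.unique (hW.isLeast_mul hb ha h' h)

theorem isGreatest_comm {a b l l' : ℕ} (ha : 1 ≤ a) (hb : 1 ≤ b) (h : IsGreatest (wset W a) l)
    (h' : IsGreatest (wset W b) l') : l * b + l' = l' * a + l := by
  have h1 := hW.isGreatest_mul ha hb h h'
  rw [mul_comm] at h1
  exact h1.unique (hW.isGreatest_mul hb ha h' h)

omit hW in
theorem exists_isLeast {D : ℕ} (h : (wset W D).Nonempty) : ∃ l, IsLeast (wset W D) l :=
  ⟨sInf (wset W D), Nat.sInf_mem h, fun _ hz => Nat.sInf_le hz⟩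

omit hW in
theorem exists_isGreatest {D : ℕ} (h : (wset W D).Nonempty) : ∃ l, IsGreatest (wset W D) l :=
  have hb : BddAbove (wset W D) := ⟨D, fun _ hz => hz.1.le⟩
  ⟨sSup (wset W D), Nat.sSup_mem h hb, fun _ hz => le_csSup hb hz⟩

theorem isGap_low {a b x y g : ℕ} (ha : 1 ≤ a) (hb : 1 ≤ b) (hx : x ∈ wset W a)
    (h : IsGap (wset W b) y g) : IsGap (wset W (a * b)) (x * b + y) g := by
  refine ⟨(hW.mem_mul ha hb h.1.1).2 ⟨hx, h.1⟩, ?_, h.2.2.1, fun t h0 ht hm => ?_⟩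
  · rw [add_assoc]
    exact (hW.mem_mul ha hb h.2.1.1).2 ⟨hx, h.2.1⟩
  · rw [add_assoc, hW.mem_mul ha hb (by have := h.2.1.1; omega)] at hm
    exact h.2.2.2 t h0 ht hm.2

theorem isGap_high {a b x g l u : ℕ} (ha : 1 ≤ a) (hb : 1 ≤ b) (hl : IsLeast (wset W b) l)
    (hu : IsGreatest (wset W b) u) (h : IsGap (wset W a) x g) :
    IsGap (wset W (a * b)) (x * b + u) (g * b + l - u) := by
  have hub := hu.1.1
  have hgb : 1 * b ≤ g * b := Nat.mul_le_mul_right b h.2.2.1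
  have e : x * b + u + (g * b + l - u) = (x + g) * b + l := by rw [add_mul]; omega
  refine ⟨(hW.mem_mul ha hb hub).2 ⟨h.1, hu.1⟩, ?_, by omega, fun t h0 ht hm => ?_⟩
  · rw [e]
    exact (hW.mem_mul ha hb hl.1.1).2 ⟨h.2.1, hl.1⟩
  · have hz := hW.mem_div_mod ha hb hm
    set z := x * b + u + t with hzdef
    have hdm := Nat.div_add_mod' z b
    have hml := hl.2 hz.2
    have hmu := hu.2 hz.2
    have hlt := Nat.mod_lt z hb
    have hx1 : x ≤ z / b := (Nat.le_div_iff_mul_le hb).2 (by omega)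
    have hx2 : z / b < x + g + 1 := by
      rw [Nat.div_lt_iff_lt_mul hb, add_mul (x + g)]
      have := hl.1.1
      omega
    rcases eq_or_ne (z / b) x with h1 | h1
    · rw [h1] at hdm; omega
    rcases eq_or_ne (z / b) (x + g) with h2 | h2
    · rw [h2] at hdm; omega
    · refine h.2.2.2 (z / b - x) (by omega) (by omega) ?_
      rw [Nat.add_sub_cancel' hx1]
      exact hz.1

theorem eq_one_of_isGap {a b M z l u : ℕ} (ha : 2 ≤ a) (hb : 1 ≤ b)
    (hl : IsLeast (wset W a) l) (hu : IsGreatest (wset W a) u)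
    (hM : ∀ z g, IsGap (wset W (a * b)) z g → g ≤ M) (h : IsGap (wset W b) z M) : M = 1 := by
  rw [mul_comm] at hM
  have := hM _ _ (hW.isGap_high hb (by omega) hl hu h)
  have hua := hu.1.1
  have hM0 := h.2.2.1
  by_contra hne
  have : 2 ≤ M := by omega
  have : M + a ≤ M * a := by nlinarith
  omega

omit hW in
theorem full_of_gap {a : ℕ} {l u : ℕ} (hl : IsLeast (wset W a) l)
    (hu : IsGreatest (wset W a) u) (hl0 : l = 0) (hu0 : u + 1 = a)
    (hg : ∀ z g, IsGap (wset W a) z g → g ≤ 1) {i : ℕ} (hi : i < a) : i ∈ wset W a := by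
  induction i with
  | zero => exact hl0 ▸ hl.1
  | succ i ih =>
    have hi' := ih (by omega)
    obtain ⟨g, hg'⟩ := IsGap.exists hi' hu.1 (by omega)
    have h1 := hg _ _ hg'
    have h2 := hg'.2.2.1
    obtain rfl : g = 1 := by omega
    exact hg'.2.1

theorem full {a b l u l' u' : ℕ} (ha : 2 ≤ a) (hb : 2 ≤ b) (hab : a.Coprime b)
    (hl : IsLeast (wset W a) l) (hu : IsGreatest (wset W a) u)
    (hl' : IsLeast (wset W b) l') (hu' : IsGreatest (wset W b) u')
    (hlu : l < u) (hlu' : l' < u') :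
    (∀ i < a, i ∈ wset W a) ∧ ∀ i < b, i ∈ wset W b := by
  have ha1 : 1 ≤ a := by omega
  have hb1 : 1 ≤ b := by omega
  obtain ⟨g₁, hg₁⟩ := IsGap.exists hl.1 hu.1 hlu
  obtain ⟨g₂, hg₂⟩ := IsGap.exists hl'.1 hu'.1 hlu'
  -- the largest gap
  have hbdd : BddAbove {g | ∃ z, IsGap (wset W (a * b)) z g} :=
    ⟨a * b, fun g ⟨z, hz⟩ => by have := hz.2.1.1; omega⟩
  have hne : {g | ∃ z, IsGap (wset W (a * b)) z g}.Nonempty :=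
    ⟨_, _, hW.isGap_low ha1 hb1 hl.1 hg₂⟩
  obtain ⟨z, hz⟩ := Nat.sSup_mem hne hbdd
  have hM : ∀ z g, IsGap (wset W (a * b)) z g → g ≤ sSup {g | ∃ z, IsGap (wset W (a * b)) z g} :=
    fun z g h => le_csSup hbdd ⟨z, h⟩
  set M := sSup {g | ∃ z, IsGap (wset W (a * b)) z g}
  have hM' : ∀ z g, IsGap (wset W (b * a)) z g → g ≤ M := by rwa [mul_comm b a]
  have hM1 : M = 1 := by
    have hz1 := hW.mem_div_mod ha1 hb1 hz.1
    have hz2 := hW.mem_div_mod (a := b) (b := a) hb1 ha1 (by rw [mul_comm]; exact hz.1)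
    rcases eq_or_ne (z % b) u' with h1 | h1
    · rcases eq_or_ne (z % a) u with h2 | h2
      · exfalso
        have hmax := hW.isGreatest_mul ha1 hb1 hu hu'
        have hlt := hmax.2 hz.2.1
        have hpos := hz.2.2.1
        have hc := hW.isGreatest_comm ha1 hb1 hu hu'
        have e1 := Nat.div_add_mod' z b
        have e2 := Nat.div_add_mod' z a
        rw [h1] at e1
        rw [h2] at e2
        have h3 : z / b ≤ u := hu.2 hz1.1
        have h4 : z / a ≤ u' := hu'.2 hz2.1
        have h5 : (u - z / b) * b = (u' - z / a) * a := by
          rw [Nat.sub_mul, Nat.sub_mul]; omega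
        have h6 : a ∣ (u - z / b) :=
          hab.dvd_of_dvd_mul_right ⟨u' - z / a, by rw [h5, mul_comm]⟩
        have h7 : u - z / b = 0 := Nat.eq_zero_of_dvd_of_lt h6 ((Nat.sub_le _ _).trans_lt hu.1.1)
        have h8 : z / b = u := by omega
        rw [h8] at e1
        omega
      · obtain ⟨g, hg⟩ := IsGap.exists hz2.2 hu.1 (lt_of_le_of_ne (hu.2 hz2.2) h2)
        have h3 := hW.isGap_low hb1 ha1 hz2.1 hg
        rw [Nat.div_add_mod', mul_comm] at h3
        rw [h3.unique hz] at hg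
        exact hW.eq_one_of_isGap hb ha1 hl' hu' hM' hg
    · obtain ⟨g, hg⟩ := IsGap.exists hz1.2 hu'.1 (lt_of_le_of_ne (hu'.2 hz1.2) h1)
      have h3 := hW.isGap_low ha1 hb1 hz1.1 hg
      rw [Nat.div_add_mod'] at h3
      rw [h3.unique hz] at hg
      exact hW.eq_one_of_isGap ha hb1 hl hu hM hg
  have k1 := hM _ _ (hW.isGap_high ha1 hb1 hl' hu' hg₁)
  have k2 := hM' _ _ (hW.isGap_high hb1 ha1 hl hu hg₂)
  have m1 : 1 * b ≤ g₁ * b := Nat.mul_le_mul_right _ hg₁.2.2.1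
  have m2 : 1 * a ≤ g₂ * a := Nat.mul_le_mul_right _ hg₂.2.2.1
  have b1 := hu.1.1
  have b2 := hu'.1.1
  constructor
  · intro i hi
    refine full_of_gap hl hu (by omega) (by omega) (fun z g hg => ?_) hi
    have := hM' _ _ (hW.isGap_low hb1 ha1 hl'.1 hg)
    omega
  · intro i hi
    refine full_of_gap hl' hu' (by omega) (by omega) (fun z g hg => ?_) hi
    have := hM _ _ (hW.isGap_low ha1 hb1 hl.1 hg)
    omega

theorem const_of_lt {a b : ℕ} (ha : 2 ≤ a) (hlt : a < b) (hab : a.Coprime b)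
    (hfa : ∀ i < a, i ∈ wset W a) (hfb : ∀ i < b, i ∈ wset W b) :
    (∀ i < a, W a i = W a 0) ∧ ∀ i < b, W b i = W b 0 := by
  have ha1 : 1 ≤ a := by omega
  have hb1 : 1 ≤ b := by omega
  have hdec : ∀ z, W a (z / b) * W b (z % b) = W b (z / a) * W a (z % a) := by
    intro z
    rw [← hW.mul a b _ _ ha1 hb1 (Nat.mod_lt _ hb1), ← hW.mul b a _ _ hb1 ha1 (Nat.mod_lt _ ha1),
      Nat.div_add_mod', Nat.div_add_mod', mul_comm]
  have hpa : ∀ i < a, 0 < W a i := fun i hi => (hfa i hi).2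
  have hpb : ∀ i < b, 0 < W b i := fun i hi => (hfb i hi).2
  have hstep : ∀ x y, x + 1 < a → y + 1 < b → W a (x + 1) * W b y = W a x * W b (y + 1) := by
    intro x y hx hy
    let z := Nat.chineseRemainder hab x y
    have hzlt := Nat.chineseRemainder_lt_mul hab x y (by omega) (by omega)
    have hza : (z : ℕ) % a = x := by
      have := z.2.1; rw [Nat.ModEq, Nat.mod_eq_of_lt (show x < a by omega)] at this; exact this
    have hzb : (z : ℕ) % b = y := by
      have := z.2.2; rw [Nat.ModEq, Nat.mod_eq_of_lt (show y < b by omega)] at this; exact this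
    have e1 := Nat.div_add_mod' (z : ℕ) a
    have e2 := Nat.div_add_mod' (z : ℕ) b
    have d1 : ((z : ℕ) + 1) / a = z / a ∧ ((z : ℕ) + 1) % a = x + 1 := by
      rw [Nat.div_mod_unique (by omega)]
      constructor
      · rw [mul_comm]; omega
      · omega
    have d2 : ((z : ℕ) + 1) / b = z / b ∧ ((z : ℕ) + 1) % b = y + 1 := by
      rw [Nat.div_mod_unique (by omega)]
      constructor
      · rw [mul_comm]; omega
      · omega
    have h1 := hdec z
    have h2 := hdec (z + 1)
    rw [d1.1, d1.2, d2.1, d2.2] at h2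
    rw [hza, hzb] at h1
    have pa := hpa (z / b) ((Nat.div_lt_iff_lt_mul (by omega)).2 hzlt)
    have pb := hpb (z / a) ((Nat.div_lt_iff_lt_mul (by omega)).2 (by rw [mul_comm]; exact hzlt))
    have p1 := hpa x (by omega)
    have p2 := hpb y (by omega)
    have h3 : (W a (z / b) * W b (z / a)) * (W a (x + 1) * W b y) =
        (W a (z / b) * W b (z / a)) * (W a x * W b (y + 1)) := by
      calc _ = (W b (z / a) * W a (x + 1)) * (W a (z / b) * W b y) := by ring
        _ = _ := by rw [← h2, h1]; ring
    exact mul_left_cancel₀ (by positivity) h3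
  set r := W a 1 / W a 0 with hr
  have ha0 := hpa 0 (by omega)
  have hb0 := hpb 0 (by omega)
  have hr0 : 0 < r := div_pos (hpa 1 (by omega)) ha0
  have hra : W a 1 = r * W a 0 := by rw [hr]; field_simp
  have hb' : ∀ i < b, W b i = r ^ i * W b 0 := by
    intro i hi
    induction i with
    | zero => simp
    | succ i ih =>
      have h1 := hstep 0 i (by omega) hi
      rw [ih (by omega)] at h1
      rw [zero_add, hra] at h1
      rw [pow_succ]
      exact mul_left_cancel₀ ha0.ne' (by linarith)
  have ha' : ∀ i < a, W a i = r ^ i * W a 0 := by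
    intro i hi
    induction i with
    | zero => simp
    | succ i ih =>
      have h1 := hstep i 0 hi (by omega)
      rw [ih (by omega), zero_add, hb' 1 (by omega)] at h1
      rw [pow_succ]
      have : W b 0 * W a (i + 1) = W b 0 * (r ^ i * r * W a 0) := by rw [pow_one] at h1; linarith
      exact mul_left_cancel₀ hb0.ne' this
  have hr1 : r = 1 := by
    have h1 := hdec a
    rw [Nat.div_eq_of_lt hlt, Nat.mod_eq_of_lt hlt, Nat.div_self (by omega), Nat.mod_self,
      hb' a hlt, hb' 1 (by omega)] at h1
    have h2 : (W a 0 * W b 0) * (r * r ^ (a - 1)) = (W a 0 * W b 0) * (r * 1) := by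
      rw [← pow_succ', Nat.sub_add_cancel (by omega)]
      linarith
    have h3 := mul_left_cancel₀ hr0.ne' (mul_left_cancel₀ (by positivity) h2)
    exact (pow_eq_one_iff_of_nonneg hr0.le (by omega)).1 h3
  exact ⟨fun i hi => by rw [ha' i hi, hr1]; simp, fun i hi => by rw [hb' i hi, hr1]; simp⟩

theorem const {a b l u l' u' : ℕ} (ha : 2 ≤ a) (hb : 2 ≤ b) (hab : a.Coprime b)
    (hl : IsLeast (wset W a) l) (hu : IsGreatest (wset W a) u)
    (hl' : IsLeast (wset W b) l') (hu' : IsGreatest (wset W b) u')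
    (hlu : l < u) (hlu' : l' < u') :
    (∀ i < a, 0 < W a 0 ∧ W a i = W a 0) ∧ ∀ i < b, 0 < W b 0 ∧ W b i = W b 0 := by
  obtain ⟨h1, h2⟩ := hW.full ha hb hab hl hu hl' hu' hlu hlu'
  have p1 := (h1 0 (by omega)).2
  have p2 := (h2 0 (by omega)).2
  rcases lt_trichotomy a b with h | h | h
  · have := hW.const_of_lt ha h hab h1 h2
    exact ⟨fun i hi => ⟨p1, this.1 i hi⟩, fun i hi => ⟨p2, this.2 i hi⟩⟩
  · subst h; simp at hab; omega
  · have := hW.const_of_lt hb h hab.symm h2 h1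
    exact ⟨fun i hi => ⟨p1, this.2 i hi⟩, fun i hi => ⟨p2, this.1 i hi⟩⟩

end IsWt

end QHT

namespace QHT

/-- The relation `R` on families of natural numbers is preserved by moving base-`b` digits around. -/
def DigitMoves {κ : Type} (R : (κ → ℕ) → (κ → ℕ) → Prop) (b : ℕ) : Prop :=
  ∀ (τ : Type) [Fintype τ] (pos pos' : τ → ℕ), pos.Injective → pos'.Injective →
    ∀ c : κ → τ → ℕ, (∀ i t, c i t < b) →
      R (fun i => ∑ t, c i t * b ^ pos t) (fun i => ∑ t, c i t * b ^ pos' t)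

theorem exists_digits {b n x : ℕ} (hx : x < b ^ n) :
    ∃ f : Fin n → ℕ, (∀ s, f s < b) ∧ x = ∑ s, f s * b ^ (s : ℕ) := by
  refine ⟨fun s => (finFunctionFinEquiv.symm (⟨x, hx⟩ : Fin (b ^ n)) s : Fin b),
    fun s => Fin.is_lt _, ?_⟩
  have := finFunctionFinEquiv_apply (finFunctionFinEquiv.symm (⟨x, hx⟩ : Fin (b ^ n)))
  rw [Equiv.apply_symm_apply] at this
  exact this

section moves

variable {κ : Type} [Fintype κ] {R : (κ → ℕ) → (κ → ℕ) → Prop}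

theorem DigitMoves.blocks {b : ℕ} (hP : DigitMoves R b) {u v x : κ → ℕ} {n p₀ p₁ q p₀' p₁' q' : ℕ}
    (hu : ∀ i, u i < b) (hv : ∀ i, v i < b) (hx : ∀ i, x i < b ^ n) (h01 : p₀ ≠ p₁)
    (h0 : p₀ < q ∨ q + n ≤ p₀) (h1 : p₁ < q ∨ q + n ≤ p₁) (h01' : p₀' ≠ p₁')
    (h0' : p₀' < q' ∨ q' + n ≤ p₀') (h1' : p₁' < q' ∨ q' + n ≤ p₁') :
    R (fun i => u i * b ^ p₀ + v i * b ^ p₁ + x i * b ^ q)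
      (fun i => u i * b ^ p₀' + v i * b ^ p₁' + x i * b ^ q') := by
  choose f hf hxf using fun i => exists_digits (hx i)
  have key : ∀ p₀ p₁ q : ℕ, p₀ ≠ p₁ → (p₀ < q ∨ q + n ≤ p₀) → (p₁ < q ∨ q + n ≤ p₁) →
      Function.Injective (Sum.elim (fun c : Bool => bif c then p₀ else p₁)
        (fun s : Fin n => q + (s : ℕ))) := by
    intro p₀ p₁ q h01 h0 h1
    refine Function.Injective.sumElim ?_ ?_ ?_
    · intro c c' h
      cases c <;> cases c' <;> simp_all
    · intro s t h
      exact Fin.ext (by simpa using h)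
    · intro c s
      have := s.2
      cases c <;> simp <;> omega
  have hsum : ∀ (p₀ p₁ q : ℕ) (i : κ), ∑ t : Bool ⊕ Fin n,
      (Sum.elim (fun c : Bool => bif c then u i else v i) (f i)) t *
        b ^ (Sum.elim (fun c : Bool => bif c then p₀ else p₁) (fun s : Fin n => q + (s : ℕ))) t =
      u i * b ^ p₀ + v i * b ^ p₁ + x i * b ^ q := by
    intro p₀ p₁ q i
    rw [Fintype.sum_sum_type, hxf i, Finset.sum_mul]
    simp only [Sum.elim_inl, Sum.elim_inr, Fintype.sum_bool, cond_true, cond_false]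
    congr 1
    refine Finset.sum_congr rfl fun s _ => ?_
    rw [pow_add]; ring
  have := hP (Bool ⊕ Fin n) _ _ (key p₀ p₁ q h01 h0 h1) (key p₀' p₁' q' h01' h0' h1')
    (fun i => Sum.elim (fun c : Bool => bif c then u i else v i) (f i)) (by
      rintro i (c | s)
      · cases c
        · exact hv i
        · exact hu i
      · exact hf i s)
  simpa only [hsum] using this

theorem exists_bound_pow {b : ℕ} (hb : 2 ≤ b) (x : κ → ℕ) : ∃ n, 1 ≤ n ∧ ∀ i, x i < b ^ n := by
  refine ⟨∑ i, x i + 1, by omega, fun i => ?_⟩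
  calc x i ≤ ∑ i, x i := Finset.single_le_sum (fun _ _ => Nat.zero_le _) (Finset.mem_univ i)
    _ < _ := (Nat.lt_pow_self (by omega)).trans (Nat.pow_lt_pow_right (by omega) (by omega))

variable (hR : Equivalence R) (hT : ∀ (x : κ → ℕ) (t : ℕ), R x (fun i => x i + t))
include hR hT

theorem DigitMoves.expand {b : ℕ} (hP : DigitMoves R b) (hb : 2 ≤ b) (E : κ → Prop) {x : κ → ℕ}
    (hE : ∀ i j, ¬ E i → E j → x i < x j) :
    R x (fun i => (if E i then b else 1) + b ^ 2 * x i) := by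
  obtain ⟨n, hn, hx⟩ := exists_bound_pow hb x
  obtain ⟨s, hs, hsE⟩ : ∃ s, s ≤ b ^ n ∧ ∀ i, E i ↔ s ≤ x i := by
    by_cases h : ∃ j, E j
    · obtain ⟨j, hj, hmin⟩ := Finset.exists_min_image (Finset.univ.filter E) x
        (by obtain ⟨j, hj⟩ := h; exact ⟨j, by simpa using hj⟩)
      simp only [Finset.mem_filter, Finset.mem_univ, true_and] at hj hmin
      refine ⟨x j, (hx j).le, fun i => ⟨hmin i, fun hi => ?_⟩⟩
      by_contra hni
      exact absurd (hE i j hni hj) (not_lt.2 hi)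
    · push Not at h
      exact ⟨b ^ n, le_rfl, fun i => ⟨fun hi => absurd hi (h i), fun hi => absurd (hx i) (not_lt.2 hi)⟩⟩
  let x' : κ → ℕ := fun i => if E i then x i - s else x i + b ^ n - s
  have hx' : ∀ i, x' i < b ^ n := by
    intro i
    have := hx i
    simp only [x']
    split_ifs with h
    · omega
    · rw [hsE] at h; omega
  have h1 : R x (fun i => x' i + (if E i then 1 else 0) * b ^ n) := by
    convert hT x (b ^ n - s) using 2 with i
    simp only [x']
    split_ifs with h
    · rw [hsE] at h; omega
    · omega
  have h2 : R (fun i => x' i + (if E i then 1 else 0) * b ^ n)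
      (fun i => x' i + (if E i then 1 else 0) * b ^ (n + 1)) := by
    have := hP.blocks (u := fun i => if E i then 1 else 0) (v := fun _ => 0) (x := x') (n := n)
      (p₀ := n) (p₁ := n + 2) (q := 0) (p₀' := n + 1) (p₁' := n + 2) (q' := 0)
      (fun i => by split_ifs <;> omega) (fun i => by omega) hx'
      (by omega) (by omega) (by omega) (by omega) (by omega) (by omega)
    convert this using 2 with i i
    · ring
    · ring
  have h3 := hT (fun i => x' i + (if E i then 1 else 0) * b ^ (n + 1)) s
  have h4 := hP.blocks (u := fun i => if E i then 0 else 1) (v := fun i => if E i then 1 else 0)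
      (x := x) (n := n)
      (p₀ := n) (p₁ := n + 1) (q := 0) (p₀' := 0) (p₁' := 1) (q' := 2)
      (fun i => by split_ifs <;> omega) (fun i => by split_ifs <;> omega) hx
      (by omega) (by omega) (by omega) (by omega) (by omega) (by omega)
  refine hR.trans (hR.trans h1 (hR.trans h2 h3)) ?_
  convert h4 using 2 with i i
  · simp only [x']
    split_ifs with h
    · rw [hsE] at h; simp; omega
    · simp; omega
  · split_ifs <;> ring

theorem DigitMoves.spread {b : ℕ} (hP : DigitMoves R b) (hb : 2 ≤ b) {u : κ → ℕ}
    (hu : ∀ i, u i < b) (v : κ → ℕ) :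
    R (fun i => u i + b * v i) (fun i => u i + b ^ 2 * v i) := by
  obtain ⟨n, hn, hv⟩ := exists_bound_pow hb v
  have := hP.blocks (u := u) (v := fun _ => 0) (x := v) (n := n)
      (p₀ := 0) (p₁ := n + 2) (q := 1) (p₀' := 0) (p₁' := n + 2) (q' := 2)
      hu (fun i => by omega) hv
      (by omega) (by omega) (by omega) (by omega) (by omega) (by omega)
  convert this using 2 with i i <;> ring

theorem DigitMoves.swap {b : ℕ} (hP : DigitMoves R b) (hb : 2 ≤ b) {u w : κ → ℕ}
    (hu : ∀ i, u i < b) (hw : ∀ i, w i < b) (v : κ → ℕ) :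
    R (fun i => u i + b * w i + b ^ 2 * v i) (fun i => w i + b * u i + b ^ 2 * v i) := by
  obtain ⟨n, hn, hv⟩ := exists_bound_pow hb v
  have := hP.blocks (u := u) (v := w) (x := v) (n := n)
      (p₀ := 0) (p₁ := 1) (q := 2) (p₀' := 1) (p₁' := 0) (q' := 2)
      hu hw hv
      (by omega) (by omega) (by omega) (by omega) (by omega) (by omega)
  convert this using 2 with i i <;> ring

theorem DigitMoves.threshold_step {b : ℕ} (hP : DigitMoves R b) (hb : 2 ≤ b) (E : κ → Prop)
    {v : κ → ℕ} (hE : ∀ i j, ¬ E i → E j → v i < v j) {k c : ℕ} (hk : 1 ≤ k) (hkc : k + c + 1 = b) :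
    R (fun i => (if E i then 0 else k) + b * v i)
      (fun i => (if E i then 0 else k + 1) + b * (v i + if E i then 1 else 0)) := by
  refine hR.trans (hP.spread hR hT hb (fun i => by split_ifs <;> omega) v) ?_
  refine hR.trans (hT _ (b - k)) ?_
  have h1 := hP.swap hR hT hb (u := fun i => if E i then c + 1 else 0)
    (w := fun i => if E i then 0 else 1) (fun i => by split_ifs <;> omega)
    (fun i => by split_ifs <;> omega) v
  have h2 := hP.spread hR hT hb (u := fun i => if E i then b - 1 else 0)
    (fun i => by split_ifs <;> omega) (fun i => (if E i then c else 0) + b * v i)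
  have h3 := hP.expand hR hT hb E (x := fun i => (if E i then c else 0) + b * v i) (by
    intro i j hi hj
    simp only [hi, hj, if_true, if_false]
    have := Nat.mul_lt_mul_of_pos_left (hE i j hi hj) (show 0 < b by omega)
    omega)
  have h4 := hT (fun i => (if E i then c else 0) + b * v i) (k + 1)
  refine hR.trans (?_ : R _ (fun i => (if E i then c + 1 else 0) + b * (if E i then 0 else 1) +
    b ^ 2 * v i)) (hR.trans h1 ?_)
  · convert hR.refl _ using 2 with i
    split_ifs <;> omega
  have e1 : (fun i => (if E i then 0 else 1) + b * (if E i then c + 1 else 0) + b ^ 2 * v i) =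
      fun i => ((if E i then b - 1 else 0) + b * ((if E i then c else 0) + b * v i)) + 1 := by
    funext i
    split_ifs
    · have : b * (c + 1) + b ^ 2 * v i = b + b * (c + b * v i) := by ring
      omega
    · ring
  have e2 : (fun i => (if E i then b else 1) + b ^ 2 * ((if E i then c else 0) + b * v i)) =
      fun i => ((if E i then b - 1 else 0) + b ^ 2 * ((if E i then c else 0) + b * v i)) + 1 := by
    funext i
    split_ifs <;> omega
  have e3 : (fun i => (if E i then 0 else k + 1) + b * (v i + if E i then 1 else 0)) =
      fun i => (if E i then c else 0) + b * v i + (k + 1) := by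
    funext i
    split_ifs
    · rw [mul_add]; omega
    · ring
  rw [e1, e3]
  rw [e2] at h3
  exact hR.trans (hR.symm (hT _ 1)) (hR.trans h2 (hR.trans (hT _ 1) (hR.trans (hR.symm h3) h4)))

theorem DigitMoves.threshold {b : ℕ} (hP : DigitMoves R b) (hb : 2 ≤ b) (E : κ → Prop)
    {x : κ → ℕ} (hE : ∀ i j, ¬ E i → E j → x i < x j) :
    R x (fun i => x i + (b - 1) * if E i then 1 else 0) := by
  have hstart : R x (fun i => (if E i then 0 else 1) + b * (x i + if E i then 1 else 0)) := by
    have h1 := hP.expand hR hT hb E hE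
    have h2 := hP.spread hR hT hb (u := fun i => if E i then b - 1 else 0)
      (fun i => by split_ifs <;> omega) x
    have e1 : (fun i => (if E i then b else 1) + b ^ 2 * x i) =
        fun i => ((if E i then b - 1 else 0) + b ^ 2 * x i) + 1 := by
      funext i
      split_ifs <;> omega
    have e2 : (fun i => (if E i then 0 else 1) + b * (x i + if E i then 1 else 0)) =
        fun i => ((if E i then b - 1 else 0) + b * x i) + 1 := by
      funext i
      split_ifs
      · rw [mul_add]; omega
      · ring
    rw [e1] at h1
    rw [e2]
    exact hR.trans h1 (hR.trans (hR.symm (hT _ 1)) (hR.trans (hR.symm h2) (hT _ 1)))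
  have hind : ∀ k, 1 ≤ k → k ≤ b →
      R x (fun i => (if E i then 0 else k) + b * (x i + k * if E i then 1 else 0)) := by
    intro k hk
    induction k, hk using Nat.le_induction with
    | base => intro _; simpa using hstart
    | succ k hk ih =>
      intro hkb
      refine hR.trans (ih (by omega)) ?_
      have := hP.threshold_step hR hT hb E (v := fun i => x i + k * if E i then 1 else 0)
        (k := k) (c := b - k - 1) (by
          intro i j hi hj
          have := hE i j hi hj
          simp only [hi, hj, if_true, if_false]
          omega) hk (by omega)
      convert this using 4 with i
      ring
  refine hR.trans (hind b (by omega) le_rfl) ?_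
  have e1 : (fun i => (if E i then 0 else b) + b * (x i + b * if E i then 1 else 0)) =
      fun i => 0 + b * (x i + (b - 1) * if E i then 1 else 0) + b := by
    funext i
    obtain ⟨b, rfl⟩ : ∃ c, b = c + 1 := ⟨b - 1, by omega⟩
    rw [Nat.add_sub_cancel]
    split_ifs <;> ring
  rw [e1]
  refine hR.trans (hR.symm (hT _ b)) ?_
  obtain ⟨n, hn, hv⟩ := exists_bound_pow hb (fun i => x i + (b - 1) * if E i then 1 else 0)
  have := hP.blocks (u := fun _ => 0) (v := fun _ => 0)
      (x := fun i => x i + (b - 1) * if E i then 1 else 0) (n := n)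
      (p₀ := n + 1) (p₁ := n + 2) (q := 1) (p₀' := n + 1) (p₁' := n + 2) (q' := 0)
      (fun i => by omega) (fun i => by omega) hv
      (by omega) (by omega) (by omega) (by omega) (by omega) (by omega)
  convert this using 2 with i i <;> ring

theorem DigitMoves.add_mul {b : ℕ} (hP : DigitMoves R b) (hb : 1 ≤ b) {x m : κ → ℕ}
    (hm : ∀ i j, x i ≤ x j → m i ≤ m j) : R x (fun i => x i + (b - 1) * m i) := by
  rcases hb.eq_or_lt with rfl | hb
  · simpa using hR.refl x
  have hind : ∀ J : ℕ, R x (fun i => x i + (b - 1) * min (m i) J) := by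
    intro J
    induction J with
    | zero => simpa using hR.refl x
    | succ J ih =>
      refine hR.trans ih ?_
      have := hP.threshold hR hT hb (fun i => J < m i)
        (x := fun i => x i + (b - 1) * min (m i) J) (by
          intro i j hi hj
          have h1 : x i < x j := by
            by_contra h
            have := hm j i (not_lt.1 h)
            omega
          have h2 := Nat.mul_le_mul_left (b - 1) (show min (m i) J ≤ min (m j) J by omega)
          omega)
      convert this using 2 with i
      rw [add_assoc, ← mul_add]
      congr 2
      split_ifs <;> omega
  convert hind (∑ i, m i) using 4 with i
  exact (min_eq_left (Finset.single_le_sum (fun _ _ => Nat.zero_le _) (Finset.mem_univ i))).symm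

theorem DigitMoves.of_same_order {b₁ b₂ : ℕ} (hP₁ : DigitMoves R b₁) (hP₂ : DigitMoves R b₂)
    (hb₁ : 1 ≤ b₁) (hb₂ : 1 ≤ b₂) (hg : 0 < (b₁ - 1).gcd (b₂ - 1)) {x y : κ → ℕ}
    (hxy : ∀ i j, x i ≤ x j ↔ y i ≤ y j)
    (hmod : ∀ i, x i % (b₁ - 1).gcd (b₂ - 1) = y i % (b₁ - 1).gcd (b₂ - 1)) : R x y := by
  set g := (b₁ - 1).gcd (b₂ - 1) with hgdef
  have htwo : ∀ (x m n : κ → ℕ), (∀ i j, x i ≤ x j → m i ≤ m j) →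
      (∀ i j, x i ≤ x j → n i ≤ n j) →
      R x (fun i => x i + (b₁ - 1) * m i + (b₂ - 1) * n i) := by
    intro x m n hm hn
    refine hR.trans (hP₁.add_mul hR hT hb₁ hm) (hP₂.add_mul hR hT hb₂ fun i j h => hn i j ?_)
    by_contra hlt
    have := Nat.mul_le_mul_left (b₁ - 1) (hm j i (not_le.1 hlt).le)
    omega
  have hδ : ∀ i, ∃ δ : ℤ, (y i : ℤ) = x i + g * δ := by
    intro i
    obtain ⟨δ, h⟩ := (Nat.modEq_iff_dvd.1 (hmod i) : (g : ℤ) ∣ y i - x i)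
    exact ⟨δ, by linarith⟩
  choose δ hδ using hδ
  have hbez := Nat.gcd_eq_gcd_ab (b₁ - 1) (b₂ - 1)
  set A := (b₁ - 1).gcdA (b₂ - 1)
  set B := (b₁ - 1).gcdB (b₂ - 1)
  rw [← hgdef] at hbez
  obtain ⟨M, hM1, hM2⟩ : ∃ M : ℕ, (∀ i, |A * δ i| ≤ M) ∧ ∀ i, |B * δ i| ≤ M := by
    refine ⟨∑ i, ((A * δ i).natAbs + (B * δ i).natAbs), fun i => ?_, fun i => ?_⟩
    all_goals
      have := Finset.single_le_sum (f := fun i => (A * δ i).natAbs + (B * δ i).natAbs)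
        (fun _ _ => Nat.zero_le _) (Finset.mem_univ i)
      rw [Int.abs_eq_natAbs]
      omega
  have hshift : ∀ Q : ℤ, (∀ i, |Q * δ i| ≤ M) → ∃ m : κ → ℕ,
      (∀ i, (m i : ℤ) = Q * δ i + 2 * M * x i + M) ∧ ∀ i j, x i ≤ x j → m i ≤ m j := by
    intro Q hQ
    have hQ' := fun i => abs_le.1 (hQ i)
    have hnn : ∀ i, 0 ≤ Q * δ i + 2 * M * x i + M := by
      intro i
      have h1 := (hQ' i).1
      have h2 : (0 : ℤ) ≤ 2 * M * x i := by positivity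
      linarith
    refine ⟨fun i => (Q * δ i + 2 * M * x i + M).toNat, fun i => Int.toNat_of_nonneg (hnn i),
      fun i j hij => Int.toNat_le_toNat ?_⟩
    rcases hij.eq_or_lt with h | h
    · have hy : y i = y j := le_antisymm ((hxy i j).1 h.le) ((hxy j i).1 h.ge)
      have hd : δ i = δ j := by
        have h1 := hδ i
        rw [hy, hδ j, h] at h1
        have : (g : ℤ) * δ j = g * δ i := by linarith
        exact (mul_left_cancel₀ (by exact_mod_cast hg.ne') this).symm
      rw [h, hd]
    · have h1 := (hQ' i).2
      have h2 := (hQ' j).1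
      have h3 : (2 * M * (x i + 1) : ℤ) ≤ 2 * M * x j :=
        mul_le_mul_of_nonneg_left (by exact_mod_cast h) (by positivity)
      linarith
  obtain ⟨m, hm, hm'⟩ := hshift A hM1
  obtain ⟨n, hn, hn'⟩ := hshift B hM2
  have h1 := htwo x m n hm' hn'
  have h2 := htwo y (fun i => 2 * M * x i + M) (fun i => 2 * M * x i + M)
    (fun i j h => by have := Nat.mul_le_mul_left (2 * M) ((hxy i j).2 h); omega)
    (fun i j h => by have := Nat.mul_le_mul_left (2 * M) ((hxy i j).2 h); omega)
  refine hR.trans h1 (hR.trans ?_ (hR.symm h2))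
  convert hR.refl _ using 2 with i
  zify
  rw [hm, hn, hδ, hbez]
  ring

theorem DigitMoves.of_modEq {b₁ b₂ b : ℕ} (hP₁ : DigitMoves R b₁) (hP₂ : DigitMoves R b₂)
    (hP : DigitMoves R b) (hb₁ : 1 ≤ b₁) (hb₂ : 1 ≤ b₂) (hb : 2 ≤ b)
    (hg : 0 < (b₁ - 1).gcd (b₂ - 1)) (hbg : b ≡ 1 [MOD (b₁ - 1).gcd (b₂ - 1)])
    {x y : κ → ℕ} (hx : x.Injective) (hy : y.Injective)
    (hmod : ∀ i, x i % (b₁ - 1).gcd (b₂ - 1) = y i % (b₁ - 1).gcd (b₂ - 1)) : R x y := by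
  have hsame := fun x y => DigitMoves.of_same_order hR hT hP₁ hP₂ hb₁ hb₂ hg (x := x) (y := y)
  set g := (b₁ - 1).gcd (b₂ - 1)
  let U : (κ → ℕ) → κ → ℕ := fun x i =>
    ∑ t : Fin (2 * g), (if (t : ℕ) < x i % g + g then 1 else 0) * b ^ (2 * g * x i + t)
  have hs : ∀ n : ℕ, n % g + g < 2 * g := fun n => by have := Nat.mod_lt n hg; omega
  have hU : ∀ x : κ → ℕ, R x (U x) := by
    intro x
    have hlow : ∀ i, b ^ (2 * g * x i) ≤ U x i := by
      intro i
      have := Finset.single_le_sum (f := fun t : Fin (2 * g) =>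
        (if (t : ℕ) < x i % g + g then 1 else 0) * b ^ (2 * g * x i + t))
        (fun _ _ => Nat.zero_le _) (Finset.mem_univ ⟨0, by omega⟩)
      simpa [U, hg] using this
    have hupp : ∀ i, U x i < b ^ (2 * g * x i + 2 * g) := by
      intro i
      calc U x i ≤ ∑ t : Fin (2 * g), b ^ (2 * g * x i) * b ^ (t : ℕ) := by
            refine Finset.sum_le_sum fun t _ => ?_
            rw [pow_add]
            split_ifs <;> simp
        _ = b ^ (2 * g * x i) * ∑ t ∈ Finset.range (2 * g), b ^ t := by
            rw [← Finset.mul_sum, Finset.sum_range]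
        _ < _ := by
            rw [pow_add]
            exact Nat.mul_lt_mul_of_pos_left
              (Nat.geomSum_lt hb fun k hk => Finset.mem_range.1 hk) (by positivity)
    have hlt : ∀ i j, x i < x j → U x i < U x j := by
      intro i j h
      refine (hupp i).trans_le (le_trans ?_ (hlow j))
      refine Nat.pow_le_pow_right (by omega) ?_
      have := Nat.mul_le_mul_left (2 * g) (Nat.succ_le_of_lt h)
      rw [Nat.mul_succ] at this
      exact this
    refine hsame x (U x) (fun i j => ⟨fun h => ?_, fun h => ?_⟩) fun i => ?_
    · rcases h.eq_or_lt with h | h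
      · simp only [U, h, le_refl]
      · exact (hlt i j h).le
    · by_contra h'
      exact absurd (hlt j i (not_le.1 h')) (not_lt.2 h)
    · have h1 : U x i ≡ ∑ t : Fin (2 * g), (if (t : ℕ) < x i % g + g then 1 else 0) [MOD g] := by
        refine Nat.ModEq.sum fun t _ => ?_
        have := (hbg.pow (2 * g * x i + t)).mul_left (if (t : ℕ) < x i % g + g then 1 else 0)
        simpa using this
      have h2 : ∑ t : Fin (2 * g), (if (t : ℕ) < x i % g + g then 1 else 0) = x i % g + g := by
        rw [Fin.sum_univ_eq_sum_range (fun t => if t < x i % g + g then 1 else 0),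
          ← Finset.sum_filter, Finset.sum_const, smul_eq_mul, mul_one]
        have : (Finset.range (2 * g)).filter (fun t => t < x i % g + g) =
            Finset.range (x i % g + g) := by
          ext t
          simp only [Finset.mem_filter, Finset.mem_range]
          have := hs (x i)
          omega
        rw [this, Finset.card_range]
      rw [h2] at h1
      have h3 : U x i % g = (x i % g + g) % g := h1
      rw [h3]
      simp
  refine hR.trans (hU x) (hR.trans ?_ (hR.symm (hU y)))
  have hpos : ∀ x : κ → ℕ, x.Injective →
      Function.Injective (fun p : κ × Fin (2 * g) => 2 * g * x p.1 + p.2) := by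
    rintro x hx ⟨i, s⟩ ⟨j, t⟩ h
    have hst : ∀ (i : κ) (s : Fin (2 * g)), (2 * g * x i + s) / (2 * g) = x i ∧
        (2 * g * x i + s) % (2 * g) = s := fun i s => by
      rw [Nat.div_mod_unique (by omega)]
      exact ⟨by ring, s.2⟩
    have h' : 2 * g * x i + s = 2 * g * x j + t := h
    have h1 := hst i s
    rw [h', (hst j t).1, (hst j t).2] at h1
    exact Prod.ext (hx h1.1.symm) (Fin.ext h1.2.symm)
  have hsum : ∀ z : κ → ℕ, (∀ i, x i % g = z i % g) → (fun i => ∑ p : κ × Fin (2 * g),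
      (if p.1 = i ∧ (p.2 : ℕ) < x i % g + g then 1 else 0) * b ^ (2 * g * z p.1 + p.2)) = U z := by
    intro z hz
    funext i
    rw [Fintype.sum_prod_type, Finset.sum_eq_single i]
    · simp only [U, true_and, hz]
    · intro j _ hj
      simp [hj]
    · simp
  have := hP (κ × Fin (2 * g)) _ _ (hpos x hx) (hpos y hy)
    (fun i p => if p.1 = i ∧ (p.2 : ℕ) < x i % g + g then 1 else 0)
    (fun i p => by split_ifs <;> omega)
  rwa [hsum x fun _ => rfl, hsum y hmod] at this

end moves

end QHT

namespace QHT

section flat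

variable {S : (d : ℕ) → Set (Matrix (Fin d) (Fin d) ℂ)} (hS : Assumption1' S)

include hS in
theorem isWt_wt : IsWt (wt S) :=
  ⟨fun _ i hD => wt_nonneg hS hD i, fun _ _ x _ ha hb hy => wt_mul hS ha hb x hy⟩

/-- Two families of basis vectors are equivalent when the support functions of `S` agree on them
up to the dimension-dependent normalization. -/
def Sim (S : (d : ℕ) → Set (Matrix (Fin d) (Fin d) ℂ)) {κ : Type} [Fintype κ] (x y : κ → ℕ) :
    Prop :=
  ∀ Y : Matrix κ κ ℂ, Y.PosSemidef → ∀ D D', 1 ≤ D → 1 ≤ D' → (wset (wt S) D).Nonempty →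
    (wset (wt S) D').Nonempty → (∀ i, x i < D) → (∀ i, y i < D') →
    cfg S D x Y * wt S D' 0 = cfg S D' y Y * wt S D 0

variable {κ : Type} [Fintype κ]

include hS in
theorem Sim.refl (x : κ → ℕ) : Sim S x x := by
  intro Y hY D D' hD hD' _ _ hx hx'
  have h1 := cfg_mul hS hD' hD 0 hx hY
  have h2 := cfg_mul hS hD hD' 0 hx' hY
  rw [mul_comm D'] at h1
  simp only [zero_mul, zero_add] at h1 h2
  linarith

theorem Sim.symm {x y : κ → ℕ} (h : Sim S x y) : Sim S y x :=
  fun Y hY D D' hD hD' hg hg' hx hx' => (h Y hY D' D hD' hD hg' hg hx' hx).symm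

variable (hpos : ∀ D, 1 ≤ D → (wset (wt S) D).Nonempty → 0 < wt S D 0)
include hpos

theorem Sim.trans {p : ℕ} (hp : 2 ≤ p) (hpg : (wset (wt S) p).Nonempty) (hS : Assumption1' S)
    {x y z : κ → ℕ} (h : Sim S x y) (h' : Sim S y z) : Sim S x z := by
  intro Y hY D D' hD hD' hg hg' hx hz
  obtain ⟨n, hn, hy⟩ := exists_bound_pow hp y
  have hpn : 1 ≤ p ^ n := Nat.one_le_pow _ _ (by omega)
  have hgn := ((isWt_wt hS).nonempty_pow (by omega) hn).2 hpg
  have h1 := h Y hY D (p ^ n) hD hpn hg hgn hx hy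
  have h2 := h' Y hY (p ^ n) D' hpn hD' hgn hg' hy hz
  have h0 := hpos _ hpn hgn
  have : wt S (p ^ n) 0 * (cfg S D x Y * wt S D' 0) = wt S (p ^ n) 0 * (cfg S D' z Y * wt S D 0) := by
    linear_combination wt S D' 0 * h1 + wt S D 0 * h2
  exact mul_left_cancel₀ h0.ne' this

include hS in
theorem Sim.of_eq {x y : κ → ℕ} {D D' : ℕ} (hD : 1 ≤ D) (hD' : 1 ≤ D')
    (hg : (wset (wt S) D).Nonempty) (hg' : (wset (wt S) D').Nonempty) (hx : ∀ i, x i < D)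
    (hy : ∀ i, y i < D')
    (h : ∀ Y : Matrix κ κ ℂ, Y.PosSemidef → cfg S D x Y * wt S D' 0 = cfg S D' y Y * wt S D 0) :
    Sim S x y := by
  intro Y hY E E' hE hE' hgE hgE' hxE hyE
  have h1 := Sim.refl hS x Y hY D E hD hE hg hgE hx hxE
  have h2 := Sim.refl hS y Y hY D' E' hD' hE' hg' hgE' hy hyE
  have h0 := hpos _ hD hg
  have h0' := hpos _ hD' hg'
  have : (wt S D 0 * wt S D' 0) * (cfg S E x Y * wt S E' 0) =
      (wt S D 0 * wt S D' 0) * (cfg S E' y Y * wt S E 0) := by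
    linear_combination (-wt S D' 0 * wt S E' 0) * h1 + wt S E 0 * wt S E' 0 * h Y hY +
      wt S D 0 * wt S E 0 * h2
  exact mul_left_cancel₀ (by positivity) this

include hS in
theorem Sim.translate {p q : ℕ} (hp : 2 ≤ p) (hq : 2 ≤ q) (hpq : p.Coprime q)
    (hpg : (wset (wt S) p).Nonempty) (hqg : (wset (wt S) q).Nonempty)
    (hpc : ∀ n, 1 ≤ n → ∀ i < p ^ n, wt S (p ^ n) i = wt S (p ^ n) 0)
    (hqc : ∀ n, 1 ≤ n → ∀ i < q ^ n, wt S (q ^ n) i = wt S (q ^ n) 0)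
    (x : κ → ℕ) (t : ℕ) : Sim S x (fun i => x i + t) := by
  obtain ⟨n, hn, hx⟩ := exists_bound_pow hp x
  obtain ⟨m, hm, hxt⟩ := exists_bound_pow hq (fun o : Option κ => o.elim t fun i => x i + t)
  have ht : t < q ^ m := hxt none
  have hy : ∀ i, x i + t < q ^ m := fun i => hxt (some i)
  have hpn : 1 ≤ p ^ n := Nat.one_le_pow _ _ (by omega)
  have hqm : 1 ≤ q ^ m := Nat.one_le_pow _ _ (by omega)
  have hW := isWt_wt hS
  have hgn := (hW.nonempty_pow (by omega) hn).2 hpg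
  have hgm := (hW.nonempty_pow (by omega) hm).2 hqg
  refine Sim.of_eq hS hpos hpn hqm hgn hgm hx hy fun Y hY => ?_
  let z := Nat.chineseRemainder (hpq.pow n m) 0 t
  have hz := Nat.chineseRemainder_lt_mul (hpq.pow n m) 0 t (by omega) (by omega)
  have h1 : (z : ℕ) % p ^ n = 0 := by have := z.2.1; rwa [Nat.ModEq, Nat.zero_mod] at this
  have h2 : (z : ℕ) % q ^ m = t := by
    have := z.2.2; rwa [Nat.ModEq, Nat.mod_eq_of_lt ht] at this
  have e1 := Nat.div_add_mod' (z : ℕ) (p ^ n)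
  have e2 := Nat.div_add_mod' (z : ℕ) (q ^ m)
  have c1 := cfg_mul hS hqm hpn (z / p ^ n) hx hY
  have c2 := cfg_mul hS hpn hqm (z / q ^ m) hy hY
  rw [hqc m hm _ ((Nat.div_lt_iff_lt_mul (by omega)).2 (by rw [mul_comm]; exact hz))] at c1
  rw [hpc n hn _ ((Nat.div_lt_iff_lt_mul (by omega)).2 hz)] at c2
  have e3 : (fun i => (z : ℕ) / p ^ n * p ^ n + x i) =
      fun i => (z : ℕ) / q ^ m * q ^ m + (x i + t) := by
    funext i; omega
  rw [mul_comm (q ^ m), e3, c2] at c1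
  linarith

include hS in
theorem Sim.digitMoves (hperm : ∀ d k : ℕ, ∀ π : Equiv.Perm (Fin k),
      ∀ A ∈ S (d ^ k), permMat d k π A ∈ S (d ^ k)) {b : ℕ} (hb : 1 ≤ b)
    (hg : (wset (wt S) b).Nonempty) : DigitMoves (Sim S : (κ → ℕ) → (κ → ℕ) → Prop) b := by
  intro τ _ pos pos' hp hp' c hc
  rcases hb.eq_or_lt with rfl | hb2
  · have : ∀ i t, c i t = 0 := fun i t => by have := hc i t; omega
    simpa [this] using Sim.refl hS (fun _ : κ => 0)
  obtain ⟨n₁, h₁, hx⟩ := exists_bound_pow hb2 (fun i => ∑ t, c i t * b ^ pos t)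
  obtain ⟨n₂, h₂, hy⟩ := exists_bound_pow hb2 (fun i => ∑ t, c i t * b ^ pos' t)
  obtain ⟨K, hK⟩ : ∃ K, n₁ ≤ K ∧ n₂ ≤ K ∧ (∀ t, pos t < K) ∧ ∀ t, pos' t < K := by
    refine ⟨n₁ + n₂ + ∑ t, (pos t + pos' t) + 1, by omega, by omega, fun t => ?_, fun t => ?_⟩
    all_goals
      have := Finset.single_le_sum (f := fun t => pos t + pos' t)
        (fun _ _ => Nat.zero_le _) (Finset.mem_univ t)
      omega
  have hD : 1 ≤ b ^ K := Nat.one_le_pow _ _ hb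
  have hgK : (wset (wt S) (b ^ K)).Nonempty :=
    ((isWt_wt hS).nonempty_pow hb (by omega)).2 hg
  refine Sim.of_eq hS hpos hD hD hgK hgK (fun i => ?_) (fun i => ?_) fun Y hY => ?_
  · exact (hx i).trans_le (Nat.pow_le_pow_right hb hK.1)
  · exact (hy i).trans_le (Nat.pow_le_pow_right hb hK.2.1)
  · rw [cfg_digits hS hperm hp hp' hK.2.2.1 hK.2.2.2 c hc hb hY]

end flat

theorem IsWt.lt_of_lt {W : ℕ → ℕ → ℝ} (hW : IsWt W) {a b l u l' u' : ℕ} (ha : 1 ≤ a) (hb : 2 ≤ b)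
    (hl : IsLeast (wset W a) l) (hu : IsGreatest (wset W a) u)
    (hl' : IsLeast (wset W b) l') (hu' : IsGreatest (wset W b) u') (hlu : l < u) : l' < u' := by
  have h1 := hW.isLeast_comm ha (by omega) hl hl'
  have h2 := hW.isGreatest_comm ha (by omega) hu hu'
  have h3 : l' ≤ u' := hl'.2 hu'.1
  rcases h3.eq_or_lt with rfl | h
  · nlinarith
  · exact h

theorem IsWt.prod {W : ℕ → ℕ → ℝ} (hW : IsWt W) {b n : ℕ} (hb : 1 ≤ b) (hn : 1 ≤ n)
    (f : Fin n → Fin b) : W (b ^ n) (∑ s, (f s : ℕ) * b ^ (s : ℕ)) = ∏ s, W b (f s) := by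
  induction n, hn using Nat.le_induction with
  | base => simp
  | succ n hn ih =>
    rw [Fin.sum_univ_castSucc, Fin.prod_univ_castSucc, pow_succ', add_comm]
    have hlt : ∑ s : Fin n, ((f s.castSucc : Fin b) : ℕ) * b ^ (s : ℕ) < b ^ n := by
      have := (finFunctionFinEquiv fun s : Fin n => f s.castSucc).2
      rwa [finFunctionFinEquiv_apply] at this
    have := hW.mul b (b ^ n) (f (Fin.last n)) _ hb (Nat.one_le_pow _ _ hb) hlt
    simp only [Fin.val_castSucc, Fin.val_last]
    rw [this, ih fun s => f s.castSucc, mul_comm]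

end QHT

namespace QHT

variable {ι : Type*} [Fintype ι] [DecidableEq ι]

theorem PosSemidef.apply_eq_zero {A : Matrix ι ι ℂ} (hA : A.PosSemidef) {i : ι}
    (hi : (A i i).re ≤ 0) (j : ι) : A i j = 0 ∧ A j i = 0 := by
  obtain ⟨C, rfl⟩ := PosSemidef.exists_eq_conjTranspose_mul hA
  have h0 : ∀ k, C k i = 0 := by
    have : ∑ k, Complex.normSq (C k i) ≤ 0 := by
      simpa [Matrix.mul_apply, Complex.normSq_apply] using hi
    have h := (Finset.sum_eq_zero_iff_of_nonneg fun k _ => Complex.normSq_nonneg _).1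
      (le_antisymm this (Finset.sum_nonneg fun k _ => Complex.normSq_nonneg _))
    intro k
    simpa using h k (Finset.mem_univ k)
  simp [Matrix.mul_apply, h0]

/-- The reordering of tensor factors `(ℂ^{d₁} ⊗ ℂ^{d₂})^{⊗n} ≃ (ℂ^{d₁})^{⊗n} ⊗ (ℂ^{d₂})^{⊗n}` on
basis vectors. -/
def reord (d₁ d₂ n : ℕ) : Fin ((d₁ * d₂) ^ n) ≃ Fin (d₁ ^ n * d₂ ^ n) :=
  finFunctionFinEquiv.symm.trans <|
    ((Equiv.piCongrRight fun _ => finProdFinEquiv.symm).trans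
      (Equiv.arrowProdEquivProdArrow (Fin n) (fun _ => Fin d₁) fun _ => Fin d₂)).trans <|
        (Equiv.prodCongr finFunctionFinEquiv finFunctionFinEquiv).trans finProdFinEquiv

section reord

variable {d₁ d₂ n : ℕ}

/-- The first component of the `s`-th tensor factor. -/
def fstDigit (z : Fin ((d₁ * d₂) ^ n)) (s : Fin n) : Fin d₁ :=
  (finProdFinEquiv.symm (finFunctionFinEquiv.symm z s)).1

/-- The second component of the `s`-th tensor factor. -/
def sndDigit (z : Fin ((d₁ * d₂) ^ n)) (s : Fin n) : Fin d₂ :=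
  (finProdFinEquiv.symm (finFunctionFinEquiv.symm z s)).2

theorem reord_apply (z : Fin ((d₁ * d₂) ^ n)) :
    reord d₁ d₂ n z =
      finProdFinEquiv (finFunctionFinEquiv (fstDigit z), finFunctionFinEquiv (sndDigit z)) := rfl

theorem val_reord (z : Fin ((d₁ * d₂) ^ n)) : (reord d₁ d₂ n z : ℕ) =
    (∑ s, (fstDigit z s : ℕ) * d₁ ^ (s : ℕ)) * d₂ ^ n + ∑ s, (sndDigit z s : ℕ) * d₂ ^ (s : ℕ) := by
  rw [reord_apply, finProdFinEquiv_apply_val, finFunctionFinEquiv_apply, finFunctionFinEquiv_apply]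
  ring

theorem val_eq_sum_digits (z : Fin ((d₁ * d₂) ^ n)) : (z : ℕ) =
    ∑ s, ((fstDigit z s : ℕ) * d₂ + sndDigit z s) * (d₁ * d₂) ^ (s : ℕ) := by
  conv_lhs => rw [← finFunctionFinEquiv.apply_symm_apply z, finFunctionFinEquiv_apply]
  refine Finset.sum_congr rfl fun s _ => ?_
  congr 1
  conv_lhs => rw [← finProdFinEquiv.apply_symm_apply (finFunctionFinEquiv.symm z s),
    finProdFinEquiv_apply_val]
  rw [fstDigit, sndDigit]
  ring

theorem IsWt.reord {W : ℕ → ℕ → ℝ} (hW : IsWt W) (h₁ : 1 ≤ d₁) (h₂ : 1 ≤ d₂) (hn : 1 ≤ n)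
    (z : Fin ((d₁ * d₂) ^ n)) :
    W ((d₁ * d₂) ^ n) z = W ((d₁ * d₂) ^ n) (QHT.reord d₁ d₂ n z) := by
  have h12 : 1 ≤ d₁ * d₂ := Nat.mul_pos h₁ h₂
  have hl : ∀ s, (fstDigit z s : ℕ) * d₂ + sndDigit z s < d₁ * d₂ := fun s => by
    have h1 := (fstDigit z s).2
    have h2 := (sndDigit z s).2
    nlinarith
  have hlt : ∑ s, (sndDigit z s : ℕ) * d₂ ^ (s : ℕ) < d₂ ^ n := by
    have := (finFunctionFinEquiv (sndDigit z)).2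
    rwa [finFunctionFinEquiv_apply] at this
  rw [val_reord]
  conv_rhs => rw [mul_pow, hW.mul _ _ _ _ (Nat.one_le_pow _ _ h₁) (Nat.one_le_pow _ _ h₂) hlt,
    hW.prod h₁ hn, hW.prod h₂ hn, ← Finset.prod_mul_distrib]
  have := hW.prod h12 hn fun s => ⟨_, hl s⟩
  rw [← val_eq_sum_digits] at this
  rw [this]
  exact Finset.prod_congr rfl fun s _ => hW.mul _ _ _ _ h₁ h₂ (sndDigit z s).2

variable {S : (d : ℕ) → Set (Matrix (Fin d) (Fin d) ℂ)} (hS : Assumption1' S)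
  (hperm : ∀ d k : ℕ, ∀ π : Equiv.Perm (Fin k), ∀ A ∈ S (d ^ k), permMat d k π A ∈ S (d ^ k))
include hS

include hperm in
theorem cfg_reord_of_prime_pow {p a b : ℕ} (hp : 1 ≤ p) (h₁ : d₁ = p ^ a) (h₂ : d₂ = p ^ b)
    {Y : Matrix (Fin ((d₁ * d₂) ^ n)) (Fin ((d₁ * d₂) ^ n)) ℂ} (hY : Y.PosSemidef) :
    cfg S ((d₁ * d₂) ^ n) (fun z : Fin ((d₁ * d₂) ^ n) => (z : ℕ)) Y =
      cfg S ((d₁ * d₂) ^ n) (fun z => (reord d₁ d₂ n z : ℕ)) Y := by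
  have hF : ∀ z : Fin ((d₁ * d₂) ^ n), ∀ s, ∃ f : Fin a → ℕ, (∀ t, f t < p) ∧
      (fstDigit z s : ℕ) = ∑ t, f t * p ^ (t : ℕ) := fun z s =>
    exists_digits (by rw [← h₁]; exact (fstDigit z s).2)
  have hG : ∀ z : Fin ((d₁ * d₂) ^ n), ∀ s, ∃ f : Fin b → ℕ, (∀ t, f t < p) ∧
      (sndDigit z s : ℕ) = ∑ t, f t * p ^ (t : ℕ) := fun z s =>
    exists_digits (by rw [← h₂]; exact (sndDigit z s).2)
  choose F hFp hF using hF
  choose G hGp hG using hG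
  have key : ∀ {c m s t s' t' : ℕ}, t < c → t' < c → t + c * s = t' + c * s' → t = t' ∧ s = s' := by
    intro c m s t s' t' h h' he
    have h1 : (t + c * s) % c = (t' + c * s') % c := by rw [he]
    rw [Nat.add_mul_mod_self_left, Nat.add_mul_mod_self_left, Nat.mod_eq_of_lt h,
      Nat.mod_eq_of_lt h'] at h1
    subst h1
    exact ⟨rfl, Nat.eq_of_mul_eq_mul_left (by omega) (Nat.add_left_cancel he)⟩
  have bnd : ∀ {c m s t : ℕ}, t < c → s < m → t + c * s < c * m := by
    intro c m s t h h'
    calc t + c * s < c * (s + 1) := by rw [mul_add]; omega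
      _ ≤ c * m := Nat.mul_le_mul_left c h'
  have := cfg_digits (τ := (Fin n × Fin b) ⊕ (Fin n × Fin a)) (b := p) (K := (a + b) * n)
    (pos := fun r => r.elim (fun st => st.2 + (a + b) * st.1) fun st => b + st.2 + (a + b) * st.1)
    (pos' := fun r => r.elim (fun st => st.2 + b * st.1) fun st => b * n + (st.2 + a * st.1))
    hS hperm ?_ ?_ ?_ ?_
    (fun (z : Fin ((d₁ * d₂) ^ n)) r => r.elim (fun st => G z st.1 st.2) fun st => F z st.1 st.2)
    ?_ hp hY
  · have hD : (d₁ * d₂) ^ n = p ^ ((a + b) * n) := by rw [h₁, h₂, ← pow_add, ← pow_mul]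
    have hx : (fun z : Fin ((d₁ * d₂) ^ n) => (z : ℕ)) = fun z =>
        ∑ t : (Fin n × Fin b) ⊕ (Fin n × Fin a),
          t.elim (fun st => G z st.1 st.2) (fun st => F z st.1 st.2) *
          p ^ (t.elim (fun st => st.2 + (a + b) * st.1) fun st => b + st.2 + (a + b) * st.1 : ℕ) := by
      funext z
      rw [val_eq_sum_digits, Fintype.sum_sum_type, Fintype.sum_prod_type, Fintype.sum_prod_type,
        ← Finset.sum_add_distrib]
      refine Finset.sum_congr rfl fun s _ => ?_
      rw [hF, hG, h₁, h₂, add_comm, add_mul, Finset.sum_mul, Finset.sum_mul, Finset.sum_mul]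
      congr 1 <;> refine Finset.sum_congr rfl fun t _ => ?_ <;> simp only [Sum.elim_inl, Sum.elim_inr]
        <;> ring
    have hy : (fun z : Fin ((d₁ * d₂) ^ n) => (reord d₁ d₂ n z : ℕ)) = fun z =>
        ∑ t : (Fin n × Fin b) ⊕ (Fin n × Fin a),
          t.elim (fun st => G z st.1 st.2) (fun st => F z st.1 st.2) *
          p ^ (t.elim (fun st => st.2 + b * st.1) fun st => b * n + (st.2 + a * st.1) : ℕ) := by
      funext z
      rw [val_reord, Fintype.sum_sum_type, Fintype.sum_prod_type, Fintype.sum_prod_type, add_comm,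
        Finset.sum_mul]
      congr 1 <;> refine Finset.sum_congr rfl fun s _ => ?_
      · rw [hG, h₂, Finset.sum_mul]
        refine Finset.sum_congr rfl fun t _ => ?_
        simp only [Sum.elim_inl]
        ring
      · rw [hF, h₁, h₂, Finset.sum_mul, Finset.sum_mul]
        refine Finset.sum_congr rfl fun t _ => ?_
        simp only [Sum.elim_inr]
        ring
    rw [← hD] at this
    rw [hx, hy]
    exact this
  · rintro (⟨s, t⟩ | ⟨s, t⟩) (⟨s', t'⟩ | ⟨s', t'⟩) h <;> simp only [Sum.elim_inl, Sum.elim_inr] at h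
      <;> have := key (m := 0) (by omega) (by omega) h <;> simp [Fin.ext_iff] <;> omega
  · rintro (⟨s, t⟩ | ⟨s, t⟩) (⟨s', t'⟩ | ⟨s', t'⟩) h <;> simp only [Sum.elim_inl, Sum.elim_inr] at h
    · have := key (m := 0) t.2 t'.2 h
      simp [Fin.ext_iff]; omega
    · have := bnd t.2 s.2
      omega
    · have := bnd t'.2 s'.2
      omega
    · have := key (m := 0) t.2 t'.2 (Nat.add_left_cancel h)
      simp [Fin.ext_iff]; omega
  · rintro (⟨s, t⟩ | ⟨s, t⟩) <;> simp only [Sum.elim_inl, Sum.elim_inr] <;>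
      exact bnd (by omega) s.2
  · rintro (⟨s, t⟩ | ⟨s, t⟩) <;> simp only [Sum.elim_inl, Sum.elim_inr] <;> rw [add_mul]
    · have := bnd t.2 s.2
      omega
    · have := bnd t.2 s.2
      omega
  · rintro z (⟨s, t⟩ | ⟨s, t⟩)
    · exact hGp z s t
    · exact hFp z s t

theorem cfg_eq_of_subsingleton {D : ℕ} (hD : 1 ≤ D) (hsub : (wset (wt S) D).Subsingleton)
    {κ : Type} [Fintype κ] {x y : κ → Fin D} (h : ∀ i, wt S D (x i) = wt S D (y i))
    (Y : Matrix κ κ ℂ) : cfg S D (fun i => x i) Y = cfg S D (fun i => y i) Y := by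
  rw [cfg, cfg, supp, supp]
  congr 1
  refine Set.image_congr fun σ hσ => ?_
  rw [rtr_emb_mul, rtr_emb_mul]
  congr 2
  have hz : ∀ z : Fin D, (z : ℕ) ∉ wset (wt S) D → ∀ w, σ z w = 0 ∧ σ w z = 0 := fun z hz =>
    PosSemidef.apply_eq_zero (hS.psd D hD σ hσ)
      ((diag_le_wt hS hD hσ z).trans (not_lt.1 fun h => hz ⟨z.2, h⟩))
  have hxy : ∀ i, ((x i : ℕ) ∈ wset (wt S) D ↔ (y i : ℕ) ∈ wset (wt S) D) := fun i => by
    simp only [wset, Set.mem_ofPred_eq, h i, (x i).2, (y i).2]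
  have he : ∀ i, (x i : ℕ) ∈ wset (wt S) D → x i = y i := fun i hi =>
    Fin.ext (hsub hi ((hxy i).1 hi))
  ext i j
  simp only [Matrix.submatrix_apply]
  by_cases hi : (x i : ℕ) ∈ wset (wt S) D
  · by_cases hj : (x j : ℕ) ∈ wset (wt S) D
    · rw [he i hi, he j hj]
    · rw [(hz _ hj _).2, (hz _ (fun h => hj ((hxy j).2 h)) _).2]
  · rw [(hz _ hi _).1, (hz _ (fun h => hi ((hxy i).2 h)) _).1]

include hperm in
theorem cfg_reord (h₁ : 1 ≤ d₁) (h₂ : 1 ≤ d₂) (hn : 1 ≤ n) (hg₁ : (wset (wt S) d₁).Nonempty)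
    (hg₂ : (wset (wt S) d₂).Nonempty)
    {Y : Matrix (Fin ((d₁ * d₂) ^ n)) (Fin ((d₁ * d₂) ^ n)) ℂ} (hY : Y.PosSemidef) :
    cfg S ((d₁ * d₂) ^ n) (fun z : Fin ((d₁ * d₂) ^ n) => (z : ℕ)) Y =
      cfg S ((d₁ * d₂) ^ n) (fun z => (reord d₁ d₂ n z : ℕ)) Y := by
  have h12 : 1 ≤ d₁ * d₂ := Nat.mul_pos h₁ h₂
  by_cases hu : ∃ p, 1 ≤ p ∧ ∀ {q : ℕ}, q.Prime → q ∣ d₁ * d₂ → q = p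
  · obtain ⟨p, hp, hu⟩ := hu
    exact cfg_reord_of_prime_pow hS hperm hp
      (Nat.eq_prime_pow_of_unique_prime_dvd (by omega) fun hq h => hu hq (h.mul_right _))
      (Nat.eq_prime_pow_of_unique_prime_dvd (by omega) fun hq h => hu hq (h.mul_left _)) hY
  push Not at hu
  obtain ⟨p, hp, hpd, -⟩ := hu 1 le_rfl
  obtain ⟨q, hq, hqd, hqp⟩ := hu p hp.one_le
  have hW := isWt_wt hS
  have hg12 : (wset (wt S) (d₁ * d₂)).Nonempty := (hW.nonempty_mul h₁ h₂).2 ⟨hg₁, hg₂⟩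
  have hgood : ∀ p, p ∣ d₁ * d₂ → (wset (wt S) p).Nonempty := by
    rintro p ⟨k, hk⟩
    have h0 : 0 < p * k := by omega
    exact ((hW.nonempty_mul (Nat.pos_of_mul_pos_right h0) (Nat.pos_of_mul_pos_left h0)).1
      (hk ▸ hg12)).1
  have hpg := hgood p hpd
  have hqg := hgood q hqd
  have hcop : p.Coprime q := (Nat.coprime_primes hp hq).2 (Ne.symm hqp)
  obtain ⟨l, hl⟩ := IsWt.exists_isLeast hpg
  obtain ⟨u, hu⟩ := IsWt.exists_isGreatest hpg
  have hD : 1 ≤ (d₁ * d₂) ^ n := Nat.one_le_pow _ _ h12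
  have hDn : d₁ ^ n * d₂ ^ n = (d₁ * d₂) ^ n := (mul_pow _ _ _).symm
  have hgD := (hW.nonempty_pow h12 hn).2 hg12
  rcases (show l ≤ u from hl.2 hu.1).eq_or_lt with rfl | hlu
  · have hsub : (wset (wt S) ((d₁ * d₂) ^ n)).Subsingleton := by
      obtain ⟨l', hl'⟩ := IsWt.exists_isLeast hgD
      obtain ⟨u', hu'⟩ := IsWt.exists_isGreatest hgD
      have : ¬ l' < u' := fun h => lt_irrefl _ (hW.lt_of_lt hD hp.two_le hl' hu' hl hu h)
      intro z hz w hw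
      have h1 := hl'.2 hz
      have h2 := hl'.2 hw
      have h3 := hu'.2 hz
      have h4 := hu'.2 hw
      omega
    exact cfg_eq_of_subsingleton hS hD hsub (x := id) (y := fun z => Fin.cast hDn (reord d₁ d₂ n z))
      (hW.reord h₁ h₂ hn) Y
  have hspan : ∀ D, 2 ≤ D → (wset (wt S) D).Nonempty → ∃ l' u', IsLeast (wset (wt S) D) l' ∧
      IsGreatest (wset (wt S) D) u' ∧ l' < u' := by
    intro D hD hg
    obtain ⟨l', hl'⟩ := IsWt.exists_isLeast hg
    obtain ⟨u', hu'⟩ := IsWt.exists_isGreatest hg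
    exact ⟨l', u', hl', hu', hW.lt_of_lt hp.one_le hD hl hu hl' hu' hlu⟩
  have hflat : ∀ a b, 2 ≤ a → 2 ≤ b → a.Coprime b → (wset (wt S) a).Nonempty →
      (wset (wt S) b).Nonempty → ∀ i < a, 0 < wt S a 0 ∧ wt S a i = wt S a 0 := by
    intro a b ha hb hab hga hgb
    obtain ⟨l₁, u₁, hl₁, hu₁, h₁⟩ := hspan a ha hga
    obtain ⟨l₂, u₂, hl₂, hu₂, h₂⟩ := hspan b hb hgb
    exact (hW.const ha hb hab hl₁ hu₁ hl₂ hu₂ h₁ h₂).1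
  have hpow : ∀ p q : ℕ, p.Prime → q.Prime → p.Coprime q → (wset (wt S) p).Nonempty →
      (wset (wt S) q).Nonempty → ∀ n, 1 ≤ n → ∀ i < p ^ n, wt S (p ^ n) i = wt S (p ^ n) 0 :=
    fun p q hp hq hpq hpg hqg n hn i hi =>
      (hflat (p ^ n) q (hp.two_le.trans (Nat.le_self_pow (by omega) p)) hq.two_le (hpq.pow_left n)
        ((hW.nonempty_pow hp.one_le hn).2 hpg) hqg i hi).2
  have hpos : ∀ D, 1 ≤ D → (wset (wt S) D).Nonempty → 0 < wt S D 0 := by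
    intro D hD hg
    obtain ⟨l', hl'⟩ := IsWt.exists_isLeast hg
    have h0 : IsLeast (wset (wt S) p) 0 :=
      ⟨⟨hp.pos, (hflat p q hp.two_le hq.two_le hcop hpg hqg 0 hp.pos).1⟩, fun _ _ => Nat.zero_le _⟩
    have := hW.isLeast_comm hD hp.one_le hl' h0
    have h2 := hp.two_le
    have : l' = 0 := by nlinarith
    exact this ▸ hl'.1.2
  have hR : Equivalence (Sim S : (Fin ((d₁ * d₂) ^ n) → ℕ) → (Fin ((d₁ * d₂) ^ n) → ℕ) → Prop) :=
    ⟨Sim.refl hS, Sim.symm, Sim.trans hpos hp.two_le hpg hS⟩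
  have hT := Sim.translate hS hpos (κ := Fin ((d₁ * d₂) ^ n)) hp.two_le hq.two_le hcop hpg hqg
    (hpow p q hp hq hcop hpg hqg) (hpow q p hq hp hcop.symm hqg hpg)
  have h2 : 2 ≤ d₁ * d₂ := hp.two_le.trans (Nat.le_of_dvd h12 hpd)
  set g := (d₁ - 1).gcd (d₂ - 1) with hgdef
  have hg0 : 0 < g := by
    refine Nat.pos_of_ne_zero fun h => ?_
    have := Nat.gcd_eq_zero_iff.1 h
    have e1 : d₁ = 1 := by omega
    have e2 : d₂ = 1 := by omega
    simp [e1, e2] at h2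
  have c1 : (d₁ : ZMod g) = 1 := by
    have := (ZMod.natCast_eq_zero_iff (d₁ - 1) g).2 (Nat.gcd_dvd_left _ _)
    rwa [Nat.cast_sub h₁, Nat.cast_one, sub_eq_zero] at this
  have c2 : (d₂ : ZMod g) = 1 := by
    have := (ZMod.natCast_eq_zero_iff (d₂ - 1) g).2 (Nat.gcd_dvd_right _ _)
    rwa [Nat.cast_sub h₂, Nat.cast_one, sub_eq_zero] at this
  have hsim := DigitMoves.of_modEq hR hT (Sim.digitMoves hS hpos hperm h₁ hg₁)
    (Sim.digitMoves hS hpos hperm h₂ hg₂) (Sim.digitMoves hS hpos hperm h12 hg12) h₁ h₂ h2 hg0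
    (by rw [← ZMod.natCast_eq_natCast_iff, Nat.cast_mul, c1, c2]; simp)
    (x := fun z : Fin ((d₁ * d₂) ^ n) => (z : ℕ)) (y := fun z => (reord d₁ d₂ n z : ℕ)) Fin.val_injective
    (Fin.val_injective.comp (reord d₁ d₂ n).injective) (fun z => by
      change _ ≡ _ [MOD g]
      rw [← ZMod.natCast_eq_natCast_iff, val_reord]
      conv_lhs => rw [val_eq_sum_digits]
      push_cast
      simp only [c1, c2, one_pow, mul_one, Finset.sum_add_distrib])
  have := hsim Y hY _ _ hD hD hgD hgD (fun i => i.2) fun i => (reord d₁ d₂ n i).2.trans_eq hDn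
  exact mul_right_cancel₀ (hpos _ hD hgD).ne' this

include hperm in
theorem supp_reord (h₁ : 1 ≤ d₁) (h₂ : 1 ≤ d₂) (hn : 1 ≤ n) (hg₁ : (wset (wt S) d₁).Nonempty)
    (hg₂ : (wset (wt S) d₂).Nonempty)
    {Y : Matrix (Fin ((d₁ * d₂) ^ n)) (Fin ((d₁ * d₂) ^ n)) ℂ} (hY : Y.PosSemidef) :
    supp (S (d₁ ^ n * d₂ ^ n)) (Y.submatrix (reord d₁ d₂ n).symm (reord d₁ d₂ n).symm) =
      supp (S ((d₁ * d₂) ^ n)) Y := by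
  have h1 := cfg_reord hS hperm h₁ h₂ hn hg₁ hg₂ hY
  have h2 : emb (d₁ ^ n * d₂ ^ n) (fun z => (reord d₁ d₂ n z : ℕ)) Y =
      Y.submatrix (reord d₁ d₂ n).symm (reord d₁ d₂ n).symm := by
    ext z w
    rw [emb_apply, Finset.sum_eq_single ((reord d₁ d₂ n).symm z), Finset.sum_eq_single
      ((reord d₁ d₂ n).symm w)]
    · simp
    · intro j _ hj
      rw [if_neg]
      rintro ⟨-, h⟩
      exact hj ((Equiv.eq_symm_apply _).2 (Fin.ext h))
    · simp
    · intro i _ hi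
      refine Finset.sum_eq_zero fun j _ => if_neg ?_
      rintro ⟨h, -⟩
      exact hi ((Equiv.eq_symm_apply _).2 (Fin.ext h))
    · simp
  rw [← h2]
  rw [cfg, emb_val] at h1
  rw [h1, cfg]
  congr! 2 <;> rw [mul_pow]

end reord

end QHT

namespace QHT

variable {ι : Type*} [Fintype ι] [DecidableEq ι]

/-- The Hermitian matrix with orthonormal eigenbasis the columns of `U` and eigenvalues `a`. -/
def udiag (U : Matrix ι ι ℂ) (a : ι → ℝ) : Matrix ι ι ℂ :=
  U * Matrix.diagonal (fun i => (a i : ℂ)) * star U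

/-- The diagonal entries of `A` in the orthonormal basis of columns of `U`. -/
def wgt (U A : Matrix ι ι ℂ) (i : ι) : ℝ := ((star U * A * U) i i).re

theorem exists_eq_udiag {A : Matrix ι ι ℂ} (hA : A.IsHermitian) :
    ∃ U : Matrix ι ι ℂ, star U * U = 1 ∧ A = udiag U hA.eigenvalues ∧
      mlog A = udiag U fun i => Real.log (hA.eigenvalues i) := by
  refine ⟨hA.eigenvectorUnitary, Unitary.coe_star_mul_self _, ?_, by rw [mlog, dif_pos hA]; rfl⟩
  conv_lhs => rw [hA.spectral_theorem]
  rfl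

theorem isHermitian_udiag (U : Matrix ι ι ℂ) (a : ι → ℝ) : (udiag U a).IsHermitian := by
  rw [Matrix.IsHermitian, udiag]
  simp [Matrix.conjTranspose_mul, Matrix.mul_assoc, Matrix.star_eq_conjTranspose]
  congr 2
  ext i j
  simp [Matrix.diagonal_apply]

theorem posSemidef_udiag (U : Matrix ι ι ℂ) {a : ι → ℝ} (ha : ∀ i, 0 ≤ a i) :
    (udiag U a).PosSemidef := by
  have : (Matrix.diagonal fun i => (a i : ℂ)).PosSemidef :=
    Matrix.PosSemidef.diagonal fun i => by simpa using ha i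
  exact this.mul_mul_conjTranspose_same U

section unitary

variable {U : Matrix ι ι ℂ} (hU : star U * U = 1)
include hU

theorem mul_star_of_star_mul : U * star U = 1 := mul_eq_one_comm.1 hU

theorem udiag_mul (a b : ι → ℝ) : udiag U a * udiag U b = udiag U fun i => a i * b i := by
  have : udiag U a * udiag U b = U * Matrix.diagonal (fun i => (a i : ℂ)) * (star U * U) *
      Matrix.diagonal (fun i => (b i : ℂ)) * star U := by
    simp only [udiag, Matrix.mul_assoc]
  rw [this, hU, Matrix.mul_one, Matrix.mul_assoc U, Matrix.diagonal_mul_diagonal, udiag]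
  simp

omit hU in
theorem udiag_add (a b : ι → ℝ) : udiag U a + udiag U b = udiag U fun i => a i + b i := by
  rw [udiag, udiag, ← Matrix.add_mul, ← Matrix.mul_add, Matrix.diagonal_add, udiag]
  simp

omit hU in
theorem smul_udiag (c : ℝ) (a : ι → ℝ) : c • udiag U a = udiag U fun i => c * a i := by
  have : (Matrix.diagonal fun i => ((c * a i : ℝ) : ℂ)) = c • Matrix.diagonal fun i => (a i : ℂ) := by
    ext i j
    by_cases h : i = j <;> simp [h]
  rw [udiag, udiag, this, Matrix.mul_smul, Matrix.smul_mul]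

theorem udiag_one : udiag U (fun _ => 1) = 1 := by
  simp [udiag, mul_star_of_star_mul hU]

theorem udiag_const (c : ℝ) : udiag U (fun _ => c) = c • 1 := by
  rw [← udiag_one hU, smul_udiag]
  simp

omit hU in
theorem rtr_mul_udiag (A : Matrix ι ι ℂ) (a : ι → ℝ) :
    rtr (A * udiag U a) = ∑ i, wgt U A i * a i := by
  rw [rtr, udiag, ← Matrix.mul_assoc, ← Matrix.mul_assoc, Matrix.trace_mul_comm, ← Matrix.mul_assoc,
    ← Matrix.mul_assoc, Matrix.trace, Complex.re_sum]
  refine Finset.sum_congr rfl fun i _ => ?_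
  simp [Matrix.diag, Matrix.mul_diagonal, wgt]

theorem sum_wgt (A : Matrix ι ι ℂ) : ∑ i, wgt U A i = rtr A := by
  have := rtr_mul_udiag (U := U) A fun _ => 1
  rw [udiag_one hU] at this
  simpa using this.symm

omit hU in
theorem wgt_nonneg {A : Matrix ι ι ℂ} (hA : A.PosSemidef) (i : ι) : 0 ≤ wgt U A i :=
  (Complex.nonneg_iff.1 (hA.conjTranspose_mul_mul_same U).diag_nonneg).1

omit hU in
theorem wgt_udiag (V : Matrix ι ι ℂ) (b : ι → ℝ) (i : ι) :
    wgt U (udiag V b) i = ∑ j, Complex.normSq ((star U * V) i j) * b j := by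
  have : star U * udiag V b * U = star U * V * Matrix.diagonal (fun i => (b i : ℂ)) *
      star (star U * V) := by
    simp only [udiag, Matrix.mul_assoc, star_mul, star_star]
  rw [wgt, this, Matrix.mul_apply, Complex.re_sum]
  refine Finset.sum_congr rfl fun j _ => ?_
  rw [Matrix.mul_diagonal, Matrix.star_apply, mul_right_comm, Complex.star_def, Complex.mul_conj]
  norm_cast

theorem sum_normSq_left {V : Matrix ι ι ℂ} (hV : star V * V = 1) (i : ι) :
    ∑ j, Complex.normSq ((star U * V) i j) = 1 := by
  have := wgt_udiag (U := U) V (fun _ => 1) i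
  rw [udiag_one hV, wgt, Matrix.mul_one, hU] at this
  simpa using this.symm

omit hU in
theorem normSq_star_mul_comm (V : Matrix ι ι ℂ) (i j : ι) :
    Complex.normSq ((star U * V) i j) = Complex.normSq ((star V * U) j i) := by
  rw [← Complex.normSq_conj, ← Complex.star_def, ← Matrix.star_apply, star_mul, star_star]

/-- Spectral functions do not depend on the choice of the eigenbasis. -/
theorem udiag_comp_eq {V : Matrix ι ι ℂ} (hV : star V * V = 1) {a b : ι → ℝ}
    (h : udiag U a = udiag V b) (f : ℝ → ℝ) :
    udiag U (fun i => f (a i)) = udiag V fun i => f (b i) := by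
  have hU' := mul_star_of_star_mul hU
  have hV' := mul_star_of_star_mul hV
  have tr : ∀ a b : ι → ℝ, udiag U a = udiag V b ↔ ∀ i j, (star V * U) i j * a j =
      b i * (star V * U) i j := by
    intro a b
    have : udiag U a = udiag V b ↔ star V * udiag U a * U = star V * udiag V b * U := by
      refine ⟨fun h => by rw [h], fun h => ?_⟩
      have := congrArg (fun M => V * M * star U) h
      simp only [← Matrix.mul_assoc] at this
      rw [hV', Matrix.one_mul, Matrix.one_mul] at this
      rwa [Matrix.mul_assoc, hU', Matrix.mul_one, Matrix.mul_assoc, hU', Matrix.mul_one] at this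
    rw [this]
    have e1 : star V * udiag U a * U = star V * U * Matrix.diagonal fun i => (a i : ℂ) := by
      rw [udiag, Matrix.mul_assoc, Matrix.mul_assoc, hU, Matrix.mul_one, ← Matrix.mul_assoc]
    have e2 : star V * udiag V b * U = (Matrix.diagonal fun i => (b i : ℂ)) * (star V * U) := by
      rw [udiag, ← Matrix.mul_assoc, ← Matrix.mul_assoc, hV, Matrix.one_mul, Matrix.mul_assoc]
    rw [e1, e2, ← Matrix.ext_iff]
    simp only [Matrix.mul_diagonal, Matrix.diagonal_mul]
  rw [tr] at h ⊢
  intro i j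
  have := h i j
  by_cases h0 : (star V * U) i j = 0
  · simp [h0]
  · rw [mul_comm] at this
    have := mul_right_cancel₀ h0 this
    rw [Complex.ofReal_inj.1 this, mul_comm]

theorem mlog_udiag (a : ι → ℝ) : mlog (udiag U a) = udiag U fun i => Real.log (a i) := by
  obtain ⟨V, hV, h1, h2⟩ := exists_eq_udiag (isHermitian_udiag U a)
  rw [h2, udiag_comp_eq hU hV h1]

theorem posDef_udiag {a : ι → ℝ} (ha : ∀ i, 0 < a i) : (udiag U a).PosDef := by
  have : (Matrix.diagonal fun i => (a i : ℂ)).PosDef :=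
    Matrix.PosDef.diagonal fun i => by simpa using ha i
  refine this.mul_mul_conjTranspose_same ?_
  intro x y hxy
  have := congrArg (fun z => Matrix.vecMul z (star U)) hxy
  simpa [mul_star_of_star_mul hU] using this

end unitary

theorem exists_udiag_posSemidef {A : Matrix ι ι ℂ} (hA : A.PosSemidef) :
    ∃ U : Matrix ι ι ℂ, ∃ a : ι → ℝ, star U * U = 1 ∧ A = udiag U a ∧ ∀ i, 0 ≤ a i := by
  obtain ⟨U, hU, h, -⟩ := exists_eq_udiag hA.1
  exact ⟨U, _, hU, h, hA.eigenvalues_nonneg⟩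

theorem exists_udiag_posDef {A : Matrix ι ι ℂ} (hA : A.PosDef) :
    ∃ U : Matrix ι ι ℂ, ∃ a : ι → ℝ, star U * U = 1 ∧ A = udiag U a ∧ ∀ i, 0 < a i := by
  obtain ⟨U, hU, h, -⟩ := exists_eq_udiag hA.1
  exact ⟨U, _, hU, h, hA.eigenvalues_pos⟩

theorem rtr_add (A B : Matrix ι ι ℂ) : rtr (A + B) = rtr A + rtr B := by simp [rtr]
theorem rtr_sub (A B : Matrix ι ι ℂ) : rtr (A - B) = rtr A - rtr B := by simp [rtr]

/-- Klein's inequality. -/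
theorem rtr_mul_mlog_le {ρ Z : Matrix ι ι ℂ} (hρ : IsState ρ) (hZ : Z.PosDef) :
    rtr (ρ * mlog Z) ≤ rtr (ρ * mlog ρ) + rtr Z - 1 := by
  obtain ⟨U, r, hU, rfl, hr⟩ := exists_udiag_posSemidef hρ.1
  obtain ⟨V, z, hV, rfl, hz⟩ := exists_udiag_posDef hZ
  have h1 : ∑ i, r i = 1 := by
    have h2 := sum_wgt hU (udiag U r)
    rw [show rtr (udiag U r) = 1 by rw [rtr, hρ.2]; rfl] at h2
    rw [← h2]
    refine Finset.sum_congr rfl fun i _ => ?_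
    rw [wgt_udiag, hU, Finset.sum_eq_single i] <;> simp +contextual [eq_comm]
  have h2 : rtr (udiag U r * mlog (udiag U r)) = ∑ i, ∑ j,
      Complex.normSq ((star U * V) i j) * (r i * Real.log (r i)) := by
    rw [mlog_udiag hU, udiag_mul hU, rtr, udiag, Matrix.trace_mul_comm, ← Matrix.mul_assoc, hU,
      Matrix.one_mul, Matrix.trace_diagonal, Complex.re_sum]
    refine Finset.sum_congr rfl fun i _ => ?_
    rw [← Finset.sum_mul, sum_normSq_left hU hV, Complex.ofReal_re, one_mul]
  have h3 : rtr (udiag U r * mlog (udiag V z)) = ∑ i, ∑ j,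
      Complex.normSq ((star U * V) i j) * (r i * Real.log (z j)) := by
    rw [mlog_udiag hV, rtr_mul_udiag, Finset.sum_comm]
    refine Finset.sum_congr rfl fun j _ => ?_
    rw [wgt_udiag, Finset.sum_mul]
    refine Finset.sum_congr rfl fun i _ => ?_
    rw [normSq_star_mul_comm]
    ring
  have h4 : rtr (udiag V z) = ∑ i, ∑ j, Complex.normSq ((star U * V) i j) * z j := by
    rw [← sum_wgt hU]
    exact Finset.sum_congr rfl fun i _ => wgt_udiag _ _ _
  have h5 : ∑ i, ∑ j, Complex.normSq ((star U * V) i j) * r i = 1 := by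
    rw [← h1]
    refine Finset.sum_congr rfl fun i _ => ?_
    rw [← Finset.sum_mul, sum_normSq_left hU hV, one_mul]
  rw [h2, h3, h4, ← h5, ← Finset.sum_add_distrib, ← Finset.sum_sub_distrib]
  refine Finset.sum_le_sum fun i _ => ?_
  rw [← Finset.sum_add_distrib, ← Finset.sum_sub_distrib]
  refine Finset.sum_le_sum fun j _ => ?_
  rw [← mul_add, ← mul_sub]
  refine mul_le_mul_of_nonneg_left ?_ (Complex.normSq_nonneg _)
  rcases (hr i).eq_or_lt with h | h
  · rw [← h]; simp [(hz j).le]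
  · have := Real.log_le_sub_one_of_pos (div_pos (hz j) h)
    rw [Real.log_div (hz j).ne' h.ne'] at this
    have h6 : r i * (z j / r i) = z j := by field_simp
    nlinarith [mul_le_mul_of_nonneg_left this h.le]

theorem mlog_eq_log {A : Matrix ι ι ℂ} (hA : A.IsHermitian) :
    mlog A = cfc Real.log A := by
  rw [hA.cfc_eq, mlog, dif_pos hA]
  rfl

section order

open scoped MatrixOrder Matrix.Norms.L2Operator

theorem posSemidef_mlog_sub {A B : Matrix ι ι ℂ} (hA : A.PosDef) (h : (B - A).PosSemidef) :
    (mlog B - mlog A).PosSemidef := by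
  have hB : B.PosDef := by simpa using hA.add_posSemidef h
  rw [mlog_eq_log hA.1, mlog_eq_log hB.1]
  exact CFC.log_le_log (Matrix.le_iff.2 h) hA.isStrictlyPositive

theorem posSemidef_mlog_concave {A B : Matrix ι ι ℂ} (hA : A.PosDef) (hB : B.PosDef) {s t : ℝ}
    (hs : 0 ≤ s) (ht : 0 ≤ t) (hst : s + t = 1) :
    (mlog (s • A + t • B) - (s • mlog A + t • mlog B)).PosSemidef := by
  have := CFC.concaveOn_log.2 (x := A) hA.isStrictlyPositive (y := B) hB.isStrictlyPositive
    hs ht hst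
  have hAB : (s • A + t • B).PosDef := Matrix.isStrictlyPositive_iff_posDef.1
    (CFC.concaveOn_log.1 (x := A) hA.isStrictlyPositive (y := B) hB.isStrictlyPositive hs ht hst)
  rw [mlog_eq_log hA.1, mlog_eq_log hB.1, mlog_eq_log hAB.1]
  exact this

theorem posDef_mul_of_commute {A B : Matrix ι ι ℂ} (hA : A.PosDef) (hB : B.PosDef)
    (h : Commute A B) : (A * B).PosDef :=
  Matrix.isStrictlyPositive_iff_posDef.1
    ((IsStrictlyPositive.commute_iff hA.isStrictlyPositive hB.isStrictlyPositive).1 h)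

theorem mlog_mul_of_commute {A B : Matrix ι ι ℂ} (hA : A.PosDef) (hB : B.PosDef)
    (h : Commute A B) : mlog (A * B) = mlog A + mlog B := by
  rw [mlog_eq_log hA.1, mlog_eq_log hB.1, mlog_eq_log (posDef_mul_of_commute hA hB h).1]
  have hc : Commute (CFC.log A) (CFC.log B) :=
    ((h.cfc_real Real.log).symm.cfc_real Real.log).symm
  let _ : NormedAlgebra ℚ (Matrix ι ι ℂ) := NormedAlgebra.restrictScalars ℚ ℂ _
  have := NormedSpace.exp_add_of_commute hc
  rw [CFC.exp_log A hA.isStrictlyPositive, CFC.exp_log B hB.isStrictlyPositive] at this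
  change CFC.log (A * B) = CFC.log A + CFC.log B
  rw [← this, CFC.log_exp _ (IsSelfAdjoint.log.add IsSelfAdjoint.log)]

end order

theorem rtr_mul_le_of_posSemidef_sub {ρ A B : Matrix ι ι ℂ} (hρ : ρ.PosSemidef)
    (h : (B - A).PosSemidef) : rtr (ρ * A) ≤ rtr (ρ * B) := by
  have := rtr_mul_nonneg hρ h
  rw [Matrix.mul_sub, rtr_sub] at this
  linarith

theorem rtr_mlog_mono {ρ A B : Matrix ι ι ℂ} (hρ : ρ.PosSemidef) (hA : A.PosDef)
    (h : (B - A).PosSemidef) : rtr (ρ * mlog A) ≤ rtr (ρ * mlog B) :=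
  rtr_mul_le_of_posSemidef_sub hρ (posSemidef_mlog_sub hA h)

theorem mlog_smul {A : Matrix ι ι ℂ} (hA : A.PosDef) {c : ℝ} (hc : 0 < c) :
    mlog (c • A) = Real.log c • 1 + mlog A := by
  obtain ⟨U, a, hU, rfl, ha⟩ := exists_udiag_posDef hA
  rw [smul_udiag, mlog_udiag hU, mlog_udiag hU, ← udiag_const hU, udiag_add]
  simp only [Real.log_mul hc.ne' (ha _).ne']

theorem rtr_mlog_smul {ρ A : Matrix ι ι ℂ} (hρ : IsState ρ) (hA : A.PosDef) {c : ℝ} (hc : 0 < c) :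
    rtr (ρ * mlog (c • A)) = Real.log c + rtr (ρ * mlog A) := by
  have : rtr ρ = 1 := by rw [rtr, hρ.2]; rfl
  rw [mlog_smul hA hc, Matrix.mul_add, rtr_add, Matrix.mul_smul, rtr_smul, Matrix.mul_one, this,
    mul_one]

end QHT

namespace QHT

variable {ι : Type*} [Fintype ι] [DecidableEq ι]

open Matrix in
/-- Pinching with respect to the eigenspaces of a Hermitian matrix. -/
theorem exists_pinching {U : Matrix ι ι ℂ} (hU : star U * U = 1) (b : ι → ℝ) {A : Matrix ι ι ℂ}
    (hA : A.PosSemidef) : ∃ A' : Matrix ι ι ℂ, A'.PosSemidef ∧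
      ((((Finset.univ.image b).card : ℝ)) • A' - A).PosSemidef ∧
      (∀ f : ℝ → ℝ, Commute A' (udiag U fun i => f (b i))) ∧
      ∀ i, wgt U A' i = wgt U A i := by
  set K := Finset.univ.image b with hK
  have hU' := mul_star_of_star_mul hU
  let C : Matrix ι K ℂ := Matrix.of fun i k => if b i = k then 1 else 0
  let G : Matrix ι ι ℂ := Matrix.of fun i j => if b i = b j then 1 else 0
  let J : Matrix K K ℂ := Matrix.of fun _ _ => 1
  let M := star U * A * U
  have hM : M.PosSemidef := hA.conjTranspose_mul_mul_same U
  have hAM : A = U * M * star U := by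
    simp only [M, ← Matrix.mul_assoc]
    rw [hU', Matrix.one_mul, Matrix.mul_assoc, hU', Matrix.mul_one]
  have hG : G = C * Cᴴ := by
    ext i j
    simp only [G, C, Matrix.mul_apply, Matrix.conjTranspose_apply, Matrix.of_apply]
    rw [Finset.sum_eq_single ⟨b i, by simp [hK]⟩]
    · simp [eq_comm]
    · intro k _ hk
      have : b i ≠ k := fun h => hk (Subtype.ext h.symm)
      simp [this]
    · simp
  have hJ : (((K.card : ℝ)) • (1 : Matrix K K ℂ) - J).PosSemidef := by
    rcases Nat.eq_zero_or_pos K.card with h | h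
    · have : IsEmpty K := by simpa using Finset.card_eq_zero.1 h
      convert! Matrix.PosSemidef.zero (R := ℂ) (n := K)
      exact Subsingleton.elim _ _
    · have h0 : (K.card : ℂ) ≠ 0 := by exact_mod_cast h.ne'
      have hJJ : J * J = (K.card : ℂ) • J := by
        ext i j
        simp [J, Matrix.mul_apply]
      have hJh : Jᴴ = J := by ext i j; simp [J]
      have e : ((K.card : ℝ)) • (1 : Matrix K K ℂ) - J = ((K.card : ℝ)⁻¹) •
          ((((K.card : ℂ)) • (1 : Matrix K K ℂ) - J)ᴴ * (((K.card : ℂ)) • (1 : Matrix K K ℂ) - J)) := by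
        have e1 : ((K.card : ℝ)) • (1 : Matrix K K ℂ) = ((K.card : ℂ)) • 1 := by
          ext i j; simp
        have e2 : ∀ N : Matrix K K ℂ, ((K.card : ℝ)⁻¹) • N = ((K.card : ℂ)⁻¹) • N := by
          intro N; ext i j; simp
        rw [e1, e2, Matrix.conjTranspose_sub, Matrix.conjTranspose_smul, hJh,
          Matrix.conjTranspose_one, star_natCast, Matrix.sub_mul, Matrix.mul_sub, Matrix.mul_sub,
          hJJ, Matrix.smul_mul, Matrix.one_mul, Matrix.smul_mul, Matrix.one_mul, Matrix.mul_smul,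
          Matrix.mul_one, sub_self, sub_zero, smul_sub, smul_smul, smul_smul,
          inv_mul_cancel₀ h0, one_mul, smul_smul, inv_mul_cancel₀ h0, one_smul]
      rw [e]
      exact posSemidef_smul (inv_nonneg.2 (Nat.cast_nonneg _)) (Matrix.posSemidef_conjTranspose_mul_self _)
  have hGp : G.PosSemidef := hG ▸ Matrix.posSemidef_self_mul_conjTranspose C
  have hGJ : (((K.card : ℝ)) • G - Matrix.of fun _ _ => 1).PosSemidef := by
    have : ((K.card : ℝ)) • G - (Matrix.of fun _ _ => 1) =
        C * (((K.card : ℝ)) • (1 : Matrix K K ℂ) - J) * Cᴴ := by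
      rw [Matrix.mul_sub, Matrix.sub_mul, Matrix.mul_smul, Matrix.mul_one, Matrix.smul_mul, ← hG]
      congr 1
      ext i j
      have h1 : ∀ i, ∑ k : K, C i k = 1 := fun i => by
        rw [Finset.sum_eq_single ⟨b i, by simp [hK]⟩]
        · simp [C]
        · intro k _ hk
          have : b i ≠ k := fun h => hk (Subtype.ext h.symm)
          simp [C, this]
        · simp
      have h2 : ∀ k, Cᴴ k j = C j k := fun k => by simp [C, apply_ite]
      simp only [Matrix.mul_apply, J, Matrix.of_apply, mul_one, h1, one_mul, h2]
    rw [this]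
    exact hJ.mul_mul_conjTranspose_same C
  have hw : ∀ N : Matrix ι ι ℂ, star U * (U * N * star U) * U = N := fun N => by
    simp only [← Matrix.mul_assoc]
    rw [hU, Matrix.one_mul, Matrix.mul_assoc, hU, Matrix.mul_one]
  refine ⟨U * (M ⊙ G) * star U, (hM.hadamard hGp).mul_mul_conjTranspose_same U, ?_, ?_, ?_⟩
  · have : ((K.card : ℝ)) • (U * (M ⊙ G) * star U) - A =
        U * (M ⊙ (((K.card : ℝ)) • G - Matrix.of fun _ _ => 1)) * star U := by
      conv_lhs => rw [hAM]
      rw [← smul_mul_assoc, ← Matrix.mul_smul, ← Matrix.sub_mul, ← Matrix.mul_sub]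
      congr 2
      ext i j
      simp [Matrix.hadamard]
      ring
    rw [this]
    exact (hM.hadamard hGJ).mul_mul_conjTranspose_same U
  · intro f
    have : (M ⊙ G) * Matrix.diagonal (fun i => (f (b i) : ℂ)) =
        Matrix.diagonal (fun i => (f (b i) : ℂ)) * (M ⊙ G) := by
      ext i j
      simp only [Matrix.mul_diagonal, Matrix.diagonal_mul, Matrix.hadamard, G, Matrix.of_apply]
      split_ifs with h
      · rw [h]; ring
      · simp
    have e : ∀ N N' : Matrix ι ι ℂ, U * N * star U * (U * N' * star U) = U * (N * N') * star U := by
      intro N N'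
      rw [Matrix.mul_assoc, ← Matrix.mul_assoc (star U), ← Matrix.mul_assoc (star U), hU,
        Matrix.one_mul]
      simp only [Matrix.mul_assoc]
    rw [Commute, SemiconjBy, udiag, e, e, this]
  · intro i
    rw [wgt, hw, wgt]
    simp [Matrix.hadamard, G, M]

theorem rtr_mul_udiag_congr {U A A' : Matrix ι ι ℂ} (h : ∀ i, wgt U A' i = wgt U A i)
    (f : ι → ℝ) : rtr (A' * udiag U f) = rtr (A * udiag U f) := by
  rw [rtr_mul_udiag, rtr_mul_udiag]
  simp only [h]

theorem IsState.rtr_eq_one {ρ : Matrix ι ι ℂ} (hρ : IsState ρ) : rtr ρ = 1 := by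
  rw [rtr, hρ.2]; rfl

theorem IsState.nonempty {ρ : Matrix ι ι ℂ} (hρ : IsState ρ) : Nonempty ι := by
  by_contra h
  rw [not_nonempty_iff] at h
  simpa [Matrix.trace] using hρ.2

theorem card_image_pos [Nonempty ι] (b : ι → ℝ) : 0 < (Finset.univ.image b).card :=
  Finset.card_pos.2 (Finset.univ_nonempty.image b)

theorem posDef_smul {c : ℝ} (hc : 0 < c) {A : Matrix ι ι ℂ} (hA : A.PosDef) :
    (c • A).PosDef := by
  have := hA.smul (a := (c : ℂ)) (by exact_mod_cast hc)
  convert! this using 1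

theorem PosSemidef.add_smul_one {A : Matrix ι ι ℂ} (hA : A.PosSemidef) {δ : ℝ} (hδ : 0 < δ) :
    (A + δ • (1 : Matrix ι ι ℂ)).PosDef :=
  (posDef_smul hδ Matrix.PosDef.one).posSemidef_add hA

/-- A lower bound on the relative entropy from a positive definite matrix with few eigenvalues. -/
theorem rtr_mlog_le_of_posDef {ρ σ U : Matrix ι ι ℂ} {y : ι → ℝ} {η : ℝ} (hρ : IsState ρ)
    (hσ : σ.PosDef) (hU : star U * U = 1) (hy : ∀ i, 0 < y i)
    (h : rtr (σ * udiag U y) ≤ 1 + η) :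
    rtr (ρ * mlog (udiag U y)) ≤ rtr (ρ * mlog ρ) - rtr (ρ * mlog σ) +
      Real.log (Finset.univ.image y).card + η := by
  have := hρ.nonempty
  obtain ⟨σ', h1, h2, h3, h4⟩ := exists_pinching hU y hσ.posSemidef
  set v : ℝ := ((Finset.univ.image y).card : ℝ) with hv
  have hv0 : 0 < v := Nat.cast_pos.2 (card_image_pos y)
  have hY := posDef_udiag hU hy
  have hT : (v • σ').PosDef := by simpa using hσ.add_posSemidef h2
  have hc : Commute (v • σ') (udiag U y) := (h3 fun x => x).smul_left v
  have k1 := rtr_mlog_mono hρ.1 hσ h2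
  have k2 := rtr_mul_mlog_le hρ (Z := v⁻¹ • (v • σ' * udiag U y)) (by
    rw [smul_mul_assoc, smul_smul, inv_mul_cancel₀ hv0.ne', one_smul]
    have : σ' = v⁻¹ • (v • σ') := by rw [smul_smul, inv_mul_cancel₀ hv0.ne', one_smul]
    refine posDef_mul_of_commute ?_ hY (h3 fun x => x)
    rw [this]
    exact posDef_smul (inv_pos.2 hv0) hT)
  rw [rtr_mlog_smul hρ (posDef_mul_of_commute hT hY hc) (inv_pos.2 hv0), mlog_mul_of_commute hT hY hc,
    Matrix.mul_add, rtr_add, smul_mul_assoc, smul_smul, inv_mul_cancel₀ hv0.ne', one_smul,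
    rtr_mul_udiag_congr h4, Real.log_inv] at k2
  linarith

end QHT

namespace QHT

variable {ι : Type*} [Fintype ι] [DecidableEq ι]

theorem msupp_le_iff_exists {A B : Matrix ι ι ℂ} : msupp A ≤ msupp B ↔ ∃ M, A = B * M := by
  constructor
  · intro h
    have : ∀ j, ∃ x, B.mulVec x = fun i => A i j := by
      intro j
      have := h (show (fun i => A i j) ∈ msupp A from ⟨Pi.single j 1, by
        ext i; simp [Matrix.col]⟩)
      simpa [msupp] using this
    choose x hx using this
    refine ⟨Matrix.of fun i j => x j i, ?_⟩
    ext i j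
    have := congrFun (hx j) i
    rw [← this]
    simp [Matrix.mul_apply, Matrix.mulVec, dotProduct]
  · rintro ⟨M, rfl⟩ _ ⟨x, rfl⟩
    exact ⟨M.mulVec x, by simp⟩

theorem star_mul_udiag_mul {U : Matrix ι ι ℂ} (hU : star U * U = 1) (s : ι → ℝ)
    (M : Matrix ι ι ℂ) : star U * (udiag U s * M) =
      Matrix.diagonal (fun i => (s i : ℂ)) * (star U * M) := by
  rw [udiag]
  simp only [← Matrix.mul_assoc]
  rw [hU, Matrix.one_mul]

theorem udiag_ind_mul {U ρ : Matrix ι ι ℂ} {s : ι → ℝ} (hU : star U * U = 1) (hρ : ρ.PosSemidef)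
    (h : ∀ i, s i = 0 → wgt U ρ i = 0) : udiag U (fun i => s i * (s i)⁻¹) * ρ = ρ := by
  have hU' := mul_star_of_star_mul hU
  have hP : (star U * ρ * U).PosSemidef := hρ.conjTranspose_mul_mul_same U
  have e : star U * (udiag U (fun i => s i * (s i)⁻¹) * ρ) * U = star U * ρ * U := by
    rw [star_mul_udiag_mul hU, Matrix.mul_assoc]
    ext i j
    rw [Matrix.diagonal_mul]
    by_cases h0 : s i = 0
    · rw [(PosSemidef.apply_eq_zero hP (h i h0).le j).1, mul_zero]
    · rw [mul_inv_cancel₀ h0, Complex.ofReal_one, one_mul]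
  have := congrArg (fun M => U * M * star U) e
  simp only [← Matrix.mul_assoc, hU', Matrix.one_mul] at this
  simpa only [Matrix.mul_assoc, hU', Matrix.mul_one] using this

theorem msupp_le_udiag_iff {U ρ : Matrix ι ι ℂ} {s : ι → ℝ} (hU : star U * U = 1)
    (hρ : ρ.PosSemidef) :
    msupp ρ ≤ msupp (udiag U s) ↔ ∀ i, s i = 0 → wgt U ρ i = 0 := by
  rw [msupp_le_iff_exists]
  constructor
  · rintro ⟨M, rfl⟩ i hi
    rw [wgt, star_mul_udiag_mul hU, Matrix.mul_assoc, Matrix.diagonal_mul, hi]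
    simp
  · intro h
    refine ⟨udiag U (fun i => (s i)⁻¹) * ρ, ?_⟩
    rw [← Matrix.mul_assoc, udiag_mul hU, udiag_ind_mul hU hρ h]

theorem PosSemidef.le_rtr_smul_one {A : Matrix ι ι ℂ} (hA : A.PosSemidef) :
    (rtr A • (1 : Matrix ι ι ℂ) - A).PosSemidef := by
  obtain ⟨U, a, hU, rfl, ha⟩ := exists_udiag_posSemidef hA
  have h1 : rtr (udiag U a) = ∑ i, a i := by
    rw [rtr, udiag, Matrix.trace_mul_comm, ← Matrix.mul_assoc, hU, Matrix.one_mul,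
      Matrix.trace_diagonal]
    simp
  have : rtr (udiag U a) • (1 : Matrix ι ι ℂ) - udiag U a =
      udiag U fun i => rtr (udiag U a) - a i := by
    rw [sub_eq_iff_eq_add, udiag_add, ← udiag_const hU]
    simp
  rw [this]
  refine posSemidef_udiag U fun i => ?_
  rw [h1, sub_nonneg]
  exact Finset.single_le_sum (fun i _ => ha i) (Finset.mem_univ i)

/-- An operator is dominated by a multiple of any positive operator with larger support. -/
theorem exists_smul_sub_posSemidef {ρ τ : Matrix ι ι ℂ} (hρ : IsState ρ) (hτ : τ.PosSemidef)
    (h : msupp ρ ≤ msupp τ) : ∃ c : ℝ, 0 < c ∧ (c • τ - ρ).PosSemidef := by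
  obtain ⟨U, s, hU, rfl, hs⟩ := exists_udiag_posSemidef hτ
  have h' := (msupp_le_udiag_iff hU hρ.1).1 h
  set Q := udiag U (fun i => s i * (s i)⁻¹) with hQ
  have hQh : Q.conjTranspose = Q := isHermitian_udiag U _
  have e1 : Q * ρ = ρ := udiag_ind_mul hU hρ.1 h'
  have e2 : ρ * Q = ρ := by
    have := congrArg Matrix.conjTranspose e1
    rwa [Matrix.conjTranspose_mul, hQh, hρ.1.1] at this
  have e3 : Q * Q = Q := by
    rw [hQ, udiag_mul hU]
    congr 1
    ext i
    by_cases h0 : s i = 0 <;> simp [h0]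
  have h1 : (Q - ρ).PosSemidef := by
    have := (PosSemidef.le_rtr_smul_one hρ.1).mul_mul_conjTranspose_same Q
    rwa [hρ.rtr_eq_one, one_smul, hQh, Matrix.mul_sub, Matrix.mul_one, e1, Matrix.sub_mul, e2,
      e3] at this
  refine ⟨∑ i, (s i)⁻¹ + 1, ?_, ?_⟩
  · have := Finset.sum_nonneg fun (i : ι) (_ : i ∈ Finset.univ) => inv_nonneg.2 (hs i)
    linarith
  · have h2 : ((∑ i, (s i)⁻¹ + 1) • udiag U s - Q).PosSemidef := by
      have : (∑ i, (s i)⁻¹ + 1) • udiag U s - Q =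
          udiag U fun i => (∑ i, (s i)⁻¹ + 1) * s i - s i * (s i)⁻¹ := by
        rw [sub_eq_iff_eq_add, hQ, udiag_add, smul_udiag]
        simp
      rw [this]
      refine posSemidef_udiag U fun i => ?_
      have := Finset.single_le_sum (f := fun i => (s i)⁻¹) (fun i _ => inv_nonneg.2 (hs i))
        (Finset.mem_univ i)
      rw [mul_comm, ← mul_sub]
      exact mul_nonneg (hs i) (by linarith)
    simpa using h2.add h1

theorem udiag_add_smul_one {U : Matrix ι ι ℂ} (hU : star U * U = 1) (s : ι → ℝ) (δ : ℝ) :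
    udiag U s + δ • 1 = udiag U fun i => s i + δ := by
  rw [← udiag_const hU, udiag_add]

theorem rtr_mlog_udiag {U : Matrix ι ι ℂ} (hU : star U * U = 1) (ρ : Matrix ι ι ℂ) (s : ι → ℝ) :
    rtr (ρ * mlog (udiag U s)) = ∑ i, wgt U ρ i * Real.log (s i) := by
  rw [mlog_udiag hU, rtr_mul_udiag]

open Topology in
/-- The relative entropy is the limit of its regularizations. -/
theorem tendsto_relEnt {ρ σ : Matrix ι ι ℂ} (hρ : IsState ρ) (hσ : σ.PosSemidef) :
    Tendsto (fun δ : ℝ => ((rtr (ρ * mlog ρ) - rtr (ρ * mlog (σ + δ • 1)) : ℝ) : EReal))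
      (𝓝[>] 0) (𝓝 (relEnt ρ σ)) := by
  obtain ⟨U, s, hU, rfl, hs⟩ := exists_udiag_posSemidef hσ
  simp only [udiag_add_smul_one hU, rtr_mlog_udiag hU]
  have hadd : ∀ i, Tendsto (fun δ : ℝ => s i + δ) (𝓝[>] 0) (𝓝 (s i)) := fun i => by
    have : Tendsto (fun δ : ℝ => s i + δ) (𝓝 0) (𝓝 (s i + 0)) := tendsto_const_nhds.add tendsto_id
    rw [add_zero] at this
    exact this.mono_left nhdsWithin_le_nhds
  rw [relEnt]
  split_ifs with h
  · rw [msupp_le_udiag_iff hU hρ.1] at h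
    rw [Matrix.mul_sub, rtr_sub, rtr_mlog_udiag hU]
    refine (continuous_coe_real_ereal.tendsto _).comp
      (tendsto_const_nhds.sub (tendsto_finsetSum _ fun i _ => ?_))
    by_cases h0 : s i = 0
    · simp only [h i h0, zero_mul]
      exact tendsto_const_nhds
    · exact ((hadd i).log h0).const_mul _
  · rw [msupp_le_udiag_iff hU hρ.1] at h
    push Not at h
    obtain ⟨i, hi, hw⟩ := h
    have hw' : 0 < wgt U ρ i := lt_of_le_of_ne (wgt_nonneg hρ.1 i) (Ne.symm hw)
    rw [EReal.tendsto_coe_nhds_top_iff]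
    have h1 : Tendsto (fun δ : ℝ => rtr (ρ * mlog ρ) -
        (wgt U ρ i * Real.log δ + ∑ j ∈ Finset.univ.erase i, wgt U ρ j * Real.log (s j + 1)))
        (𝓝[>] 0) atTop := by
      have := (Real.tendsto_log_nhdsGT_zero).const_mul_atBot hw'
      have h2 := tendsto_neg_atBot_atTop.comp (tendsto_atBot_add_const_right _
        (∑ j ∈ Finset.univ.erase i, wgt U ρ j * Real.log (s j + 1)) this)
      simpa [sub_eq_add_neg] using tendsto_atTop_add_const_left _ (rtr (ρ * mlog ρ)) h2
    refine tendsto_atTop_mono' _ ?_ h1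
    filter_upwards [Ioo_mem_nhdsGT (zero_lt_one' ℝ)] with δ hδ
    rw [← Finset.add_sum_erase _ _ (Finset.mem_univ i), hi, zero_add]
    refine sub_le_sub_left (add_le_add_right (Finset.sum_le_sum fun j _ => ?_) _) _
    refine mul_le_mul_of_nonneg_left (Real.log_le_log ?_ ?_) (wgt_nonneg hρ.1 j)
    · linarith [hs j, hδ.1]
    · linarith [hδ.2]

/-- A lower bound on the relative entropy from a positive definite matrix with few eigenvalues. -/
theorem le_relEnt_of_rtr_mul_le {ρ σ U : Matrix ι ι ℂ} {y : ι → ℝ} (hρ : IsState ρ)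
    (hσ : σ.PosSemidef) (hU : star U * U = 1) (hy : ∀ i, 0 < y i)
    (h : rtr (σ * udiag U y) ≤ 1) :
    ((rtr (ρ * mlog (udiag U y)) - Real.log (Finset.univ.image y).card : ℝ) : EReal) ≤
      relEnt ρ σ := by
  have h1 : Tendsto (fun δ : ℝ => ((rtr (ρ * mlog (udiag U y)) -
      Real.log (Finset.univ.image y).card - δ * rtr (udiag U y) : ℝ) : EReal))
      (nhdsWithin 0 (Set.Ioi 0))
      (nhds ((rtr (ρ * mlog (udiag U y)) - Real.log (Finset.univ.image y).card : ℝ) : EReal)) := by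
    refine (continuous_coe_real_ereal.tendsto _).comp ?_
    have : Continuous fun δ : ℝ => rtr (ρ * mlog (udiag U y)) -
      Real.log (Finset.univ.image y).card - δ * rtr (udiag U y) := by fun_prop
    have := this.tendsto 0
    rw [zero_mul, sub_zero] at this
    exact this.mono_left nhdsWithin_le_nhds
  refine le_of_tendsto_of_tendsto h1 (tendsto_relEnt hρ hσ) ?_
  filter_upwards [self_mem_nhdsWithin] with δ hδ
  have := rtr_mlog_le_of_posDef (η := δ * rtr (udiag U y)) hρ
    (PosSemidef.add_smul_one hσ hδ) hU hy (by
      rw [Matrix.add_mul, rtr_add, Matrix.smul_mul, rtr_smul, Matrix.one_mul]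
      linarith)
  rw [EReal.coe_le_coe_iff]
  linarith

variable {a b : ℕ}

theorem isState_dtens {ρ₁ : Matrix (Fin a) (Fin a) ℂ} {ρ₂ : Matrix (Fin b) (Fin b) ℂ}
    (h₁ : IsState ρ₁) (h₂ : IsState ρ₂) : IsState (dtens ρ₁ ρ₂) :=
  ⟨posSemidef_dtens h₁.1 h₂.1, by rw [trace_dtens, h₁.2, h₂.2, one_mul]⟩

theorem msupp_dtens_le {ρ₁ σ₁ : Matrix (Fin a) (Fin a) ℂ} {ρ₂ σ₂ : Matrix (Fin b) (Fin b) ℂ}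
    (h₁ : msupp ρ₁ ≤ msupp σ₁) (h₂ : msupp ρ₂ ≤ msupp σ₂) :
    msupp (dtens ρ₁ ρ₂) ≤ msupp (dtens σ₁ σ₂) := by
  rw [msupp_le_iff_exists] at *
  obtain ⟨M, rfl⟩ := h₁
  obtain ⟨N, rfl⟩ := h₂
  exact ⟨dtens M N, (dtens_mul _ _ _ _).symm⟩

theorem star_dtens (A : Matrix (Fin a) (Fin a) ℂ) (B : Matrix (Fin b) (Fin b) ℂ) :
    star (dtens A B) = dtens (star A) (star B) := by
  ext i j
  simp [dtens, Matrix.star_apply]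

theorem dtens_one : dtens (1 : Matrix (Fin a) (Fin a) ℂ) (1 : Matrix (Fin b) (Fin b) ℂ) = 1 := by
  rw [dtens_eq]
  have := Matrix.one_kronecker_one (α := ℂ) (m := Fin a) (n := Fin b)
  rw [show Matrix.kronecker (1 : Matrix (Fin a) (Fin a) ℂ) (1 : Matrix (Fin b) (Fin b) ℂ) = 1
    from this, Matrix.submatrix_one_equiv]

theorem dtens_udiag (U : Matrix (Fin a) (Fin a) ℂ) (V : Matrix (Fin b) (Fin b) ℂ)
    (s : Fin a → ℝ) (t : Fin b → ℝ) : dtens (udiag U s) (udiag V t) =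
      udiag (dtens U V) fun x => s (finProdFinEquiv.symm x).1 * t (finProdFinEquiv.symm x).2 := by
  rw [udiag, udiag, udiag, ← dtens_mul, ← dtens_mul, star_dtens]
  congr 2
  ext i j
  by_cases h : i = j
  · subst h; simp [dtens]
  · have : ¬ ((finProdFinEquiv.symm i).1 = (finProdFinEquiv.symm j).1 ∧
        (finProdFinEquiv.symm i).2 = (finProdFinEquiv.symm j).2) := fun h' =>
      h (finProdFinEquiv.symm.injective (Prod.ext h'.1 h'.2))
    rw [Matrix.diagonal_apply_ne _ h]
    simp only [dtens, Matrix.of_apply, Matrix.diagonal_apply]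
    split_ifs <;> simp_all

theorem star_dtens_mul_dtens {U : Matrix (Fin a) (Fin a) ℂ} {V : Matrix (Fin b) (Fin b) ℂ}
    (hU : star U * U = 1) (hV : star V * V = 1) : star (dtens U V) * dtens U V = 1 := by
  rw [star_dtens, dtens_mul, hU, hV, dtens_one]

theorem wgt_dtens (U : Matrix (Fin a) (Fin a) ℂ) (V : Matrix (Fin b) (Fin b) ℂ)
    {A : Matrix (Fin a) (Fin a) ℂ} (hA : A.PosSemidef) (B : Matrix (Fin b) (Fin b) ℂ) (x) :
    wgt (dtens U V) (dtens A B) x =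
      wgt U A (finProdFinEquiv.symm x).1 * wgt V B (finProdFinEquiv.symm x).2 := by
  have hP : ∀ i, ((star U * A * U) i i).im = 0 := fun i =>
    (Complex.nonneg_iff.1 (hA.conjTranspose_mul_mul_same U).diag_nonneg).2.symm
  rw [wgt, star_dtens, dtens_mul, dtens_mul, wgt, wgt]
  simp only [dtens, Matrix.of_apply, Complex.mul_re, hP]
  ring

theorem rtr_dtens_mul_mlog_dtens {ρ₁ σ₁ : Matrix (Fin a) (Fin a) ℂ}
    {ρ₂ σ₂ : Matrix (Fin b) (Fin b) ℂ} (hρ₁ : IsState ρ₁) (hρ₂ : IsState ρ₂)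
    (hσ₁ : σ₁.PosSemidef) (hσ₂ : σ₂.PosSemidef) (h₁ : msupp ρ₁ ≤ msupp σ₁)
    (h₂ : msupp ρ₂ ≤ msupp σ₂) :
    rtr (dtens ρ₁ ρ₂ * mlog (dtens σ₁ σ₂)) = rtr (ρ₁ * mlog σ₁) + rtr (ρ₂ * mlog σ₂) := by
  obtain ⟨U, s, hU, rfl, hs⟩ := exists_udiag_posSemidef hσ₁
  obtain ⟨V, t, hV, rfl, ht⟩ := exists_udiag_posSemidef hσ₂
  rw [msupp_le_udiag_iff hU hρ₁.1] at h₁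
  rw [msupp_le_udiag_iff hV hρ₂.1] at h₂
  rw [dtens_udiag, rtr_mlog_udiag (star_dtens_mul_dtens hU hV), rtr_mlog_udiag hU,
    rtr_mlog_udiag hV]
  simp only [wgt_dtens U V hρ₁.1]
  rw [finProdFinEquiv.symm.sum_comp fun p : Fin a × Fin b =>
    wgt U ρ₁ p.1 * wgt V ρ₂ p.2 * Real.log (s p.1 * t p.2), Fintype.sum_prod_type]
  have e : ∀ i j, wgt U ρ₁ i * wgt V ρ₂ j * Real.log (s i * t j) =
      wgt U ρ₁ i * Real.log (s i) * wgt V ρ₂ j + wgt U ρ₁ i * (wgt V ρ₂ j * Real.log (t j)) := by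
    intro i j
    by_cases hi : s i = 0
    · simp [h₁ i hi]
    by_cases hj : t j = 0
    · simp [h₂ j hj]
    rw [Real.log_mul hi hj]
    ring
  simp only [e, Finset.sum_add_distrib, ← Finset.mul_sum, ← Finset.sum_mul, sum_wgt hU, sum_wgt hV,
    hρ₁.rtr_eq_one, hρ₂.rtr_eq_one, mul_one, one_mul]

theorem relEnt_ne_bot {ρ σ : Matrix ι ι ℂ} : relEnt ρ σ ≠ ⊥ := by
  rw [relEnt]
  split_ifs
  · exact EReal.coe_ne_bot _
  · exact top_ne_bot

theorem relEnt_dtens_le {ρ₁ σ₁ : Matrix (Fin a) (Fin a) ℂ}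
    {ρ₂ σ₂ : Matrix (Fin b) (Fin b) ℂ} (hρ₁ : IsState ρ₁) (hρ₂ : IsState ρ₂)
    (hσ₁ : σ₁.PosSemidef) (hσ₂ : σ₂.PosSemidef) :
    relEnt (dtens ρ₁ ρ₂) (dtens σ₁ σ₂) ≤ relEnt ρ₁ σ₁ + relEnt ρ₂ σ₂ := by
  by_cases h₁ : msupp ρ₁ ≤ msupp σ₁
  · by_cases h₂ : msupp ρ₂ ≤ msupp σ₂
    · rw [relEnt, relEnt, relEnt, if_pos h₁, if_pos h₂, if_pos (msupp_dtens_le h₁ h₂),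
        ← EReal.coe_add, EReal.coe_le_coe_iff, Matrix.mul_sub, Matrix.mul_sub, Matrix.mul_sub,
        rtr_sub, rtr_sub, rtr_sub, rtr_dtens_mul_mlog_dtens hρ₁ hρ₂ hσ₁ hσ₂ h₁ h₂,
        rtr_dtens_mul_mlog_dtens hρ₁ hρ₂ hρ₁.1 hρ₂.1 le_rfl le_rfl]
      linarith
    · rw [show relEnt ρ₂ σ₂ = ⊤ from if_neg h₂, EReal.add_top_of_ne_bot relEnt_ne_bot]
      exact le_top
  · rw [show relEnt ρ₁ σ₁ = ⊤ from if_neg h₁, EReal.top_add_of_ne_bot relEnt_ne_bot]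
    exact le_top

theorem msupp_eq_top {A : Matrix ι ι ℂ} (hA : A.PosDef) : msupp A = ⊤ := by
  obtain ⟨U, s, hU, rfl, hs⟩ := exists_udiag_posDef hA
  have : msupp (1 : Matrix ι ι ℂ) = ⊤ := by
    rw [msupp, Matrix.mulVecLin_one, LinearMap.range_id]
  rw [eq_top_iff, ← this]
  exact (msupp_le_udiag_iff hU Matrix.PosSemidef.one).2 fun i hi => absurd hi (hs i).ne'

theorem rtr_dtens_mul_mlog_dtens_of_posDef {ρ₁ σ₁ : Matrix (Fin a) (Fin a) ℂ}
    {ρ₂ σ₂ : Matrix (Fin b) (Fin b) ℂ} (hρ₁ : IsState ρ₁) (hρ₂ : IsState ρ₂)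
    (hσ₁ : σ₁.PosDef) (hσ₂ : σ₂.PosDef) :
    rtr (dtens ρ₁ ρ₂ * mlog (dtens σ₁ σ₂)) = rtr (ρ₁ * mlog σ₁) + rtr (ρ₂ * mlog σ₂) :=
  rtr_dtens_mul_mlog_dtens hρ₁ hρ₂ hσ₁.posSemidef hσ₂.posSemidef
    (by rw [msupp_eq_top hσ₁]; exact le_top) (by rw [msupp_eq_top hσ₂]; exact le_top)

theorem posDef_dtens {A : Matrix (Fin a) (Fin a) ℂ} {B : Matrix (Fin b) (Fin b) ℂ}
    (hA : A.PosDef) (hB : B.PosDef) : (dtens A B).PosDef := by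
  obtain ⟨U, s, hU, rfl, hs⟩ := exists_udiag_posDef hA
  obtain ⟨V, t, hV, rfl, ht⟩ := exists_udiag_posDef hB
  rw [dtens_udiag]
  exact posDef_udiag (star_dtens_mul_dtens hU hV) fun x => mul_pos (hs _) (ht _)

end QHT

namespace QHT

variable {ι : Type*} [Fintype ι] [DecidableEq ι]

theorem rtr_mlog_self_le {ρ : Matrix ι ι ℂ} (hρ : ρ.PosSemidef) {δ : ℝ} (hδ : 0 ≤ δ) :
    rtr (ρ * mlog ρ) ≤ rtr (ρ * mlog (ρ + δ • 1)) := by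
  obtain ⟨U, r, hU, hr, h0⟩ := exists_udiag_posSemidef hρ
  have hw := (msupp_le_udiag_iff (s := r) hU hρ).1 (by rw [hr])
  have e1 : rtr (ρ * mlog ρ) = ∑ i, wgt U ρ i * Real.log (r i) := by
    rw [← rtr_mlog_udiag hU, ← hr]
  have e2 : rtr (ρ * mlog (ρ + δ • 1)) = ∑ i, wgt U ρ i * Real.log (r i + δ) := by
    rw [← rtr_mlog_udiag hU, ← udiag_add_smul_one hU, ← hr]
  rw [e1, e2]
  refine Finset.sum_le_sum fun i _ => ?_
  rcases (h0 i).eq_or_lt with h | h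
  · simp [hw i h.symm]
  · exact mul_le_mul_of_nonneg_left (Real.log_le_log h (by linarith)) (wgt_nonneg hρ i)

/-- A near-optimal test operator for the variational formula of the relative entropy. -/
theorem exists_posDef_lt {ρ U : Matrix ι ι ℂ} {s : ι → ℝ} (hρ : IsState ρ) (hU : star U * U = 1)
    (hs : ∀ i, 0 ≤ s i) {v : ℕ} (hv : (Finset.univ.image s).card ≤ v) {c : ℝ}
    (hc : ((c + Real.log v : ℝ) : EReal) < relEnt ρ (udiag U s)) :
    ∃ Y : Matrix ι ι ℂ, Y.PosDef ∧ c < rtr (ρ * mlog Y) + 1 - rtr (udiag U s * Y) := by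
  have := hρ.nonempty
  obtain ⟨δ, h1, hδ⟩ := (((tendsto_relEnt hρ (posSemidef_udiag U hs)).eventually_const_lt hc).and
    self_mem_nhdsWithin).exists
  rw [EReal.coe_lt_coe_iff, udiag_add_smul_one hU] at h1
  have hδ : 0 < δ := hδ
  have hsδ : ∀ i, 0 < s i + δ := fun i => add_pos_of_nonneg_of_pos (hs i) hδ
  obtain ⟨ρ', k1, k2, k3, k4⟩ := exists_pinching hU s hρ.1
  set k : ℝ := ((Finset.univ.image s).card : ℝ) with hk
  have hk0 : 0 < k := Nat.cast_pos.2 (card_image_pos s)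
  have hkv : Real.log k ≤ Real.log v := Real.log_le_log hk0 (Nat.cast_le.2 hv)
  obtain ⟨ε, hε, hεD⟩ : ∃ ε : ℝ, 0 < ε ∧ c + Real.log v + ε * rtr (1 : Matrix ι ι ℂ) <
      rtr (ρ * mlog ρ) - rtr (ρ * mlog (udiag U fun i => s i + δ)) := by
    have hcont : Continuous fun ε : ℝ => c + Real.log v + ε * rtr (1 : Matrix ι ι ℂ) := by fun_prop
    have := hcont.tendsto 0
    rw [zero_mul, add_zero] at this
    obtain ⟨ε, h, h'⟩ := (((this.mono_left (nhdsWithin_le_nhds (s := Set.Ioi 0))).eventually_lt_const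
      h1).and self_mem_nhdsWithin).exists
    exact ⟨ε, h', h⟩
  set R := ρ' + ε • (1 : Matrix ι ι ℂ) with hR
  have hRp : R.PosDef := PosSemidef.add_smul_one k1 hε
  have hRc : ∀ f : ℝ → ℝ, Commute R (udiag U fun i => f (s i)) := fun f =>
    (k3 f).add_left ((Commute.one_left _).smul_left ε)
  set B := udiag U fun i => (s i + δ)⁻¹ with hB
  have hBp : B.PosDef := posDef_udiag hU fun i => inv_pos.2 (hsδ i)
  have hBc : Commute R B := hRc fun x => (x + δ)⁻¹
  refine ⟨R * B, posDef_mul_of_commute hRp hBp hBc, ?_⟩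
  have e1 : rtr (ρ * mlog B) = - rtr (ρ * mlog (udiag U fun i => s i + δ)) := by
    rw [rtr_mlog_udiag hU, rtr_mlog_udiag hU, ← Finset.sum_neg_distrib]
    exact Finset.sum_congr rfl fun i _ => by rw [Real.log_inv]; ring
  have e2 : rtr (udiag U s * (R * B)) ≤ 1 + ε * rtr (1 : Matrix ι ι ℂ) := by
    have hρ' : rtr ρ' = 1 := by
      rw [← sum_wgt hU, ← hρ.rtr_eq_one, ← sum_wgt hU]
      simp only [k4]
    rw [rtr_mul_comm, Matrix.mul_assoc, hB, udiag_mul hU, rtr_mul_udiag]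
    have : rtr R = 1 + ε * rtr (1 : Matrix ι ι ℂ) := by rw [hR, rtr_add, rtr_smul, hρ']
    rw [← this, ← sum_wgt hU]
    refine Finset.sum_le_sum fun i _ => mul_le_of_le_one_right (wgt_nonneg hRp.posSemidef i) ?_
    rw [inv_mul_le_one₀ (hsδ i)]
    linarith
  have e3 : rtr (ρ * mlog ρ) ≤ Real.log k + rtr (ρ * mlog R) := by
    rw [← rtr_mlog_smul hρ hRp hk0]
    refine (rtr_mlog_self_le hρ.1 (mul_pos hk0 hε).le).trans
      (rtr_mlog_mono hρ.1 (PosSemidef.add_smul_one hρ.1 (mul_pos hk0 hε)) ?_)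
    rw [hR, smul_add, smul_smul, add_sub_add_right_eq_sub]
    exact k2
  rw [mlog_mul_of_commute hRp hBp hBc, Matrix.mul_add, rtr_add, e1]
  linarith

theorem concaveOn_rtr_mlog {ρ : Matrix ι ι ℂ} (hρ : ρ.PosSemidef) :
    ConcaveOn ℝ {Y : Matrix ι ι ℂ | Y.PosDef} fun Y => rtr (ρ * mlog Y) := by
  have hconv : Convex ℝ {Y : Matrix ι ι ℂ | Y.PosDef} := by
    intro A hA B hB s t hs ht hst
    have hA : A.PosDef := hA
    have hB : B.PosDef := hB
    rcases hs.eq_or_lt with h | h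
    · have : t = 1 := by linarith
      simpa [← h, this] using hB
    · exact (posDef_smul h hA).add_posSemidef (posSemidef_smul ht hB.posSemidef)
  refine ⟨hconv, fun A hA B hB s t hs ht hst => ?_⟩
  have := rtr_mul_le_of_posSemidef_sub hρ (posSemidef_mlog_concave hA hB hs ht hst)
  rwa [Matrix.mul_add, rtr_add, Matrix.mul_smul, Matrix.mul_smul, rtr_smul, rtr_smul] at this

/-- A finite-dimensional minimax argument exchanging the choices of `σ` and of `Y`. -/
theorem exists_posDef_forall_lt {ρ : Matrix ι ι ℂ} (hρ : ρ.PosSemidef) {T : Set (Matrix ι ι ℂ)}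
    (hT : IsCompact T) (hconv : Convex ℝ T) (hne : T.Nonempty) {c : ℝ}
    (h : ∀ σ ∈ T, ∃ Y : Matrix ι ι ℂ, Y.PosDef ∧ c < rtr (ρ * mlog Y) + 1 - rtr (σ * Y)) :
    ∃ Y : Matrix ι ι ℂ, Y.PosDef ∧ ∀ σ ∈ T, c < rtr (ρ * mlog Y) + 1 - rtr (σ * Y) := by
  have h' : ∀ σ : T, ∃ Y : Matrix ι ι ℂ, Y.PosDef ∧
      c < rtr (ρ * mlog Y) + 1 - rtr ((σ : Matrix ι ι ℂ) * Y) := fun σ => h σ σ.2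
  choose Y hY hc using h'
  have hcont : ∀ Z : Matrix ι ι ℂ, Continuous fun σ : Matrix ι ι ℂ =>
      rtr (ρ * mlog Z) + 1 - rtr (σ * Z) := fun Z =>
    continuous_const.sub (continuous_rtr.comp (continuous_id.mul continuous_const))
  obtain ⟨t, ht⟩ := hT.elim_finite_subcover
    (fun σ : T => {σ' : Matrix ι ι ℂ | c < rtr (ρ * mlog (Y σ)) + 1 - rtr (σ' * Y σ)})
    (fun σ => isOpen_lt continuous_const (hcont _))
    (fun σ hσ => Set.mem_iUnion.2 ⟨⟨σ, hσ⟩, hc ⟨σ, hσ⟩⟩)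
  have key := Sion.exists_lt_iInf_of_lt_iInf_of_finite (X := T) (Y := stdSimplex ℝ t)
    (f := fun σ p => ∑ j : t, p j * (rtr (ρ * mlog (Y j)) + 1 - rtr (σ * Y j)))
    hne hT
    (fun p _ => (continuous_finsetSum _ fun j _ =>
      continuous_const.mul (hcont _)).lowerSemicontinuous.lowerSemicontinuousOn _)
    (fun p _ => by
      refine ConvexOn.quasiconvexOn ⟨hconv, fun A _ B _ x y _ _ hxy => le_of_eq ?_⟩
      simp only [smul_eq_mul, Finset.mul_sum, ← Finset.sum_add_distrib]
      refine Finset.sum_congr rfl fun j _ => ?_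
      rw [Matrix.add_mul, rtr_add, Matrix.smul_mul, Matrix.smul_mul, rtr_smul, rtr_smul]
      linear_combination (-(p j * (rtr (ρ * mlog (Y j)) + 1))) * hxy)
    (convex_stdSimplex ℝ t)
    (fun σ _ => (Continuous.upperSemicontinuous (by fun_prop)).upperSemicontinuousOn _)
    (fun σ _ => by
      refine ConcaveOn.quasiconcaveOn ⟨convex_stdSimplex ℝ t, fun p _ q _ x y _ _ _ => le_of_eq ?_⟩
      simp only [smul_eq_mul, Finset.mul_sum, ← Finset.sum_add_distrib]
      refine Finset.sum_congr rfl fun j _ => ?_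
      simp only [Pi.add_apply, Pi.smul_apply, smul_eq_mul]
      ring)
    hconv (s := Set.range fun j : t => Pi.single j 1) (Set.finite_range _)
    (by
      rintro _ ⟨j, rfl⟩
      exact single_mem_stdSimplex ℝ j)
    (t := c) (fun σ hσ => by
      obtain ⟨j, hj, hj'⟩ := Set.mem_iUnion₂.1 (ht hσ)
      refine ⟨_, ⟨⟨j, hj⟩, rfl⟩, ?_⟩
      simpa [Pi.single_apply] using hj')
  obtain ⟨p, ⟨hp0, hp1⟩, hp⟩ := key
  have hmem := (concaveOn_rtr_mlog hρ).1.sum_mem (t := Finset.univ) (w := p)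
    (z := fun j : t => Y j) (fun j _ => hp0 j) hp1 (fun j _ => hY j)
  have hJ := (concaveOn_rtr_mlog hρ).le_map_sum (t := Finset.univ) (w := p)
    (p := fun j : t => Y j) (fun j _ => hp0 j) hp1 (fun j _ => hY j)
  refine ⟨_, hmem, fun σ hσ => (hp σ hσ).trans_le ?_⟩
  have e : rtr (σ * ∑ j : t, p j • Y j) = ∑ j : t, p j * rtr (σ * Y j) := by
    rw [Finset.mul_sum, rtr, Matrix.trace_sum, Complex.re_sum]
    refine Finset.sum_congr rfl fun j _ => ?_
    rw [Matrix.mul_smul]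
    exact rtr_smul _ _
  simp only [smul_eq_mul] at hJ
  rw [e]
  simp only [mul_sub, mul_add, Finset.sum_sub_distrib, Finset.sum_add_distrib, mul_one, hp1]
  linarith

end QHT

namespace QHT

variable {ι : Type*} [Fintype ι] [DecidableEq ι]

section twirl

variable {κ : Type*} [Fintype κ] [DecidableEq κ]

theorem rtr_submatrix (f : κ ≃ ι) (A : Matrix ι ι ℂ) : rtr (A.submatrix f f) = rtr A := by
  rw [rtr, rtr]
  exact congrArg Complex.re (f.sum_comp fun i => A i i)

theorem rtr_submatrix_mul (f : κ ≃ ι) (A B : Matrix ι ι ℂ) :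
    rtr (A.submatrix f f * B.submatrix f f) = rtr (A * B) := by
  rw [Matrix.submatrix_mul_equiv, rtr_submatrix]

theorem submatrix_udiag (f : κ ≃ ι) (U : Matrix ι ι ℂ) (b : ι → ℝ) :
    (udiag U b).submatrix f f = udiag (U.submatrix f f) fun k => b (f k) := by
  rw [udiag, udiag, ← Matrix.submatrix_mul_equiv _ _ f f f, ← Matrix.submatrix_mul_equiv _ _ f f f,
    Matrix.submatrix_diagonal_equiv]
  rfl

theorem star_submatrix_mul {U : Matrix ι ι ℂ} (hU : star U * U = 1) (f : κ ≃ ι) :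
    star (U.submatrix f f) * U.submatrix f f = 1 := by
  have : star (U.submatrix f f) = (star U).submatrix f f := rfl
  rw [this, Matrix.submatrix_mul_equiv, hU, Matrix.submatrix_one_equiv]

theorem mlog_submatrix {A : Matrix ι ι ℂ} (hA : A.IsHermitian) (f : κ ≃ ι) :
    mlog (A.submatrix f f) = (mlog A).submatrix f f := by
  obtain ⟨U, hU, h1, h2⟩ := exists_eq_udiag hA
  rw [h2, submatrix_udiag]
  conv_lhs => rw [h1]
  rw [submatrix_udiag, mlog_udiag (star_submatrix_mul hU f)]

theorem posDef_submatrix {A : Matrix ι ι ℂ} (hA : A.PosDef) (f : κ ≃ ι) :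
    (A.submatrix f f).PosDef := by
  obtain ⟨U, a, hU, rfl, ha⟩ := exists_udiag_posDef hA
  rw [submatrix_udiag]
  exact posDef_udiag (star_submatrix_mul hU f) fun k => ha _

theorem rtr_mul_mlog_submatrix (f : κ ≃ ι) (ρ : Matrix ι ι ℂ) {Y : Matrix ι ι ℂ}
    (hY : Y.IsHermitian) :
    rtr (ρ.submatrix f f * mlog (Y.submatrix f f)) = rtr (ρ * mlog Y) := by
  rw [mlog_submatrix hY, rtr_submatrix_mul]

variable {G : Type*} [Group G] [Fintype G] (e : G → Equiv.Perm ι)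

/-- Invariance of a matrix under simultaneous permutations of rows and columns. -/
def IsInv (A : Matrix ι ι ℂ) : Prop := ∀ g, A.submatrix (e g) (e g) = A

/-- Group average of a matrix. -/
def twirl (A : Matrix ι ι ℂ) : Matrix ι ι ℂ :=
  ∑ g, (Fintype.card G : ℝ)⁻¹ • A.submatrix (e g) (e g)

theorem sum_inv_card : ∑ _g : G, (Fintype.card G : ℝ)⁻¹ = 1 := by
  have : (Fintype.card G : ℝ) ≠ 0 := Nat.cast_ne_zero.2 Fintype.card_ne_zero
  simp [this]

theorem isInv_twirl (he : ∀ g h, e (g * h) = (e g).trans (e h)) (A : Matrix ι ι ℂ) :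
    IsInv e (twirl e A) := by
  intro h
  have : (twirl e A).submatrix (e h) (e h) =
      ∑ g, (Fintype.card G : ℝ)⁻¹ • A.submatrix (e (h * g)) (e (h * g)) := by
    ext i j
    simp only [twirl, Matrix.submatrix_apply, Matrix.sum_apply, Matrix.smul_apply, he,
      Equiv.trans_apply]
  rw [this, twirl]
  exact Equiv.sum_comp (Equiv.mulLeft h) fun g => (Fintype.card G : ℝ)⁻¹ • A.submatrix (e g) (e g)

theorem twirl_mem {T : Set (Matrix ι ι ℂ)} (hT : Convex ℝ T)
    (h : ∀ g, ∀ A ∈ T, A.submatrix (e g) (e g) ∈ T) {A : Matrix ι ι ℂ} (hA : A ∈ T) :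
    twirl e A ∈ T :=
  hT.sum_mem (fun _ _ => by positivity) sum_inv_card fun g _ => h g A hA

theorem rtr_sum {α : Type*} (s : Finset α) (f : α → Matrix ι ι ℂ) :
    rtr (∑ i ∈ s, f i) = ∑ i ∈ s, rtr (f i) := by
  rw [rtr, Matrix.trace_sum, Complex.re_sum]
  rfl

theorem rtr_mul_twirl {A : Matrix ι ι ℂ} (hA : IsInv e A) (B : Matrix ι ι ℂ) :
    rtr (A * twirl e B) = rtr (A * B) := by
  rw [twirl, Finset.mul_sum, rtr_sum]
  have : ∀ g, rtr (A * (Fintype.card G : ℝ)⁻¹ • B.submatrix (e g) (e g)) =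
      (Fintype.card G : ℝ)⁻¹ * rtr (A * B) := fun g => by
    rw [Matrix.mul_smul, rtr_smul, ← rtr_submatrix_mul (e g) A B, hA g]
  simp only [this, ← Finset.sum_mul, sum_inv_card, one_mul]

theorem posDef_twirl {Y : Matrix ι ι ℂ} (hY : Y.PosDef) : (twirl e Y).PosDef :=
  (concaveOn_rtr_mlog (Matrix.PosSemidef.zero (R := ℂ) (n := ι))).1.sum_mem
    (fun _ _ => by positivity) sum_inv_card fun g _ => posDef_submatrix hY (e g)

theorem rtr_mlog_le_twirl {ρ Y : Matrix ι ι ℂ} (hρ : ρ.PosSemidef) (hi : IsInv e ρ)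
    (hY : Y.PosDef) : rtr (ρ * mlog Y) ≤ rtr (ρ * mlog (twirl e Y)) := by
  have := (concaveOn_rtr_mlog hρ).le_map_sum (t := Finset.univ)
    (w := fun _ : G => (Fintype.card G : ℝ)⁻¹) (p := fun g => Y.submatrix (e g) (e g))
    (fun _ _ => by positivity) sum_inv_card fun g _ => posDef_submatrix hY (e g)
  have h : ∀ g, rtr (ρ * mlog (Y.submatrix (e g) (e g))) = rtr (ρ * mlog Y) := fun g => by
    rw [← rtr_mul_mlog_submatrix (e g) ρ hY.1, hi g]
  simp only [h, smul_eq_mul, ← Finset.sum_mul, sum_inv_card, one_mul] at this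
  exact this

variable {e} (he : ∀ g h, e (g * h) = (e g).trans (e h)) {T : Set (Matrix ι ι ℂ)}
  (hT : Convex ℝ T) (hinv : ∀ g, ∀ A ∈ T, A.submatrix (e g) (e g) ∈ T)
include he hT hinv

theorem rtr_twirl_mul_le {M : ℝ} {Y : Matrix ι ι ℂ}
    (h : ∀ σ ∈ T, IsInv e σ → rtr (σ * Y) ≤ M) {σ : Matrix ι ι ℂ} (hσ : σ ∈ T) :
    rtr (twirl e Y * σ) ≤ M := by
  rw [← rtr_mul_twirl e (isInv_twirl e he Y), rtr_mul_comm, rtr_mul_twirl e (isInv_twirl e he σ)]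
  exact h _ (twirl_mem e hT hinv hσ) (isInv_twirl e he σ)

theorem twirl_mem_polar {Y : Matrix ι ι ℂ} (hY : Y.PosDef) (hp : Y ∈ polar T) :
    twirl e Y ∈ polar T :=
  ⟨(posDef_twirl e hY).posSemidef, fun _ hσ => rtr_twirl_mul_le he hT hinv
    (fun σ hσ _ => by rw [rtr_mul_comm]; exact hp.2 σ hσ) hσ⟩

variable {v : ℕ} (hv : ∀ (U : Matrix ι ι ℂ) (b : ι → ℝ), star U * U = 1 → IsInv e (udiag U b) →
    (Finset.univ.image b).card ≤ v) (hpsd : ∀ σ ∈ T, σ.PosSemidef)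
include hv hpsd

theorem le_relEnt_of_mem_polar {ρ Y σ : Matrix ι ι ℂ} (hρ : IsState ρ) (hi : IsInv e ρ)
    (hY : Y.PosDef) (hp : Y ∈ polar T) (hσ : σ ∈ T) :
    ((rtr (ρ * mlog Y) - Real.log v : ℝ) : EReal) ≤ relEnt ρ σ := by
  have := hρ.nonempty
  obtain ⟨U, y, hU, hy, h0⟩ := exists_udiag_posDef (posDef_twirl e hY)
  have h1 := (twirl_mem_polar he hT hinv hY hp).2 σ hσ
  rw [rtr_mul_comm, hy] at h1
  refine le_trans ?_ (le_relEnt_of_rtr_mul_le hρ (hpsd σ hσ) hU h0 h1)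
  rw [← hy, EReal.coe_le_coe_iff]
  exact sub_le_sub (rtr_mlog_le_twirl e hρ.1 hi hY) (Real.log_le_log
    (Nat.cast_pos.2 (card_image_pos y))
    (Nat.cast_le.2 (hv U y hU (hy ▸ isInv_twirl e he Y))))

theorem exists_mem_polar_le {ρ : Matrix ι ι ℂ} (hρ : IsState ρ) (hi : IsInv e ρ)
    (hc : IsCompact T) (hne : T.Nonempty) {c : ℝ}
    (h : ∀ σ ∈ T, ((c + Real.log v : ℝ) : EReal) < relEnt ρ σ) :
    ∃ Y ∈ polar T, Y.PosDef ∧ IsInv e Y ∧ c ≤ rtr (ρ * mlog Y) := by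
  have hclosed : IsClosed {σ : Matrix ι ι ℂ | IsInv e σ} := by
    have : {σ : Matrix ι ι ℂ | IsInv e σ} =
        ⋂ g, {σ : Matrix ι ι ℂ | σ.submatrix (e g) (e g) = σ} := by
      ext σ; simp [IsInv]
    rw [this]
    exact isClosed_iInter fun g =>
      isClosed_eq (continuous_id.matrix_submatrix _ _) continuous_id
  obtain ⟨Y, hY, h1⟩ := exists_posDef_forall_lt (c := c) hρ.1 (hc.inter_right hclosed) (by
      refine hT.inter fun A hA B hB s t _ _ _ g => ?_
      exact congrArg₂ (fun A B => s • A + t • B) (hA g) (hB g))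
    (by
      obtain ⟨σ, hσ⟩ := hne
      exact ⟨_, twirl_mem e hT hinv hσ, isInv_twirl e he σ⟩) fun σ hσ => by
    obtain ⟨U, s, hU, hs, h0⟩ := exists_udiag_posSemidef (hpsd σ hσ.1)
    rw [hs]
    refine exists_posDef_lt hρ hU h0 (hv U s hU (hs ▸ hσ.2)) ?_
    rw [← hs]
    exact h σ hσ.1
  set M := rtr (ρ * mlog Y) + 1 - c with hM
  have hK := Real.exp_pos (M - 1)
  have hpos := posDef_twirl e hY
  have h2 : ∀ σ ∈ T, rtr (twirl e Y * σ) ≤ M := fun σ hσ =>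
    rtr_twirl_mul_le he hT hinv (fun σ hσ hi => by linarith [h1 σ ⟨hσ, hi⟩]) hσ
  refine ⟨(Real.exp (M - 1))⁻¹ • twirl e Y,
    ⟨(posDef_smul (inv_pos.2 hK) hpos).posSemidef, fun σ hσ => ?_⟩,
    posDef_smul (inv_pos.2 hK) hpos, fun g => ?_, ?_⟩
  · rw [Matrix.smul_mul, rtr_smul, inv_mul_le_one₀ hK]
    linarith [h2 σ hσ, Real.add_one_le_exp (M - 1)]
  · exact congrArg (fun A => (Real.exp (M - 1))⁻¹ • A) (isInv_twirl e he Y g)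
  · rw [rtr_mlog_smul hρ hpos (inv_pos.2 hK), Real.log_inv, Real.log_exp]
    linarith [rtr_mlog_le_twirl e hρ.1 hi hY]

end twirl

end QHT

namespace QHT

variable {ι : Type*} [Fintype ι] [DecidableEq ι]

/-- The permutation of the basis of `(ℂ^d)^{⊗n}` induced by a permutation of the factors. -/
def permEquiv (d n : ℕ) (π : Equiv.Perm (Fin n)) : Equiv.Perm (Fin (d ^ n)) :=
  (finFunctionFinEquiv.symm.trans (Equiv.arrowCongr π.symm (Equiv.refl (Fin d)))).trans
    finFunctionFinEquiv

theorem permEquiv_apply (d n : ℕ) (π : Equiv.Perm (Fin n)) (x : Fin (d ^ n)) :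
    permEquiv d n π x = finFunctionFinEquiv (finFunctionFinEquiv.symm x ∘ π) := rfl

theorem permEquiv_mul (d n : ℕ) (g h : Equiv.Perm (Fin n)) :
    permEquiv d n (g * h) = (permEquiv d n g).trans (permEquiv d n h) := by
  ext x
  simp [permEquiv_apply, Function.comp_assoc]

theorem isInv_dpow {d : ℕ} (ρ : Matrix (Fin d) (Fin d) ℂ) (n : ℕ) :
    IsInv (permEquiv d n) (dpow ρ n) := by
  intro π
  ext x y
  simp only [Matrix.submatrix_apply, dpow, Matrix.of_apply, permEquiv_apply,
    Equiv.symm_apply_apply, Function.comp_apply]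
  exact Fintype.prod_equiv π _ _ fun i => rfl

theorem exists_comp_perm_eq {α : Type*} {n : ℕ} (f g : Fin n → α)
    (h : ∀ a, (Finset.univ.filter fun i => f i = a).card =
      (Finset.univ.filter fun i => g i = a).card) : ∃ π : Equiv.Perm (Fin n), f ∘ π = g := by
  have hf : ∀ a, Nonempty ({i // g i = a} ≃ {i // f i = a}) := fun a => by
    rw [← Fintype.card_eq, Fintype.card_subtype, Fintype.card_subtype, h]
  let F : ∀ a, {i // g i = a} ≃ {i // f i = a} := fun a => (hf a).some
  exact ⟨Equiv.ofFiberEquiv F, funext fun i => Equiv.ofFiberEquiv_map F i⟩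

/-- The number of positions at which a pair of words displays a given pair of letters. -/
def pairCount (d n : ℕ) (z : Fin (d ^ n) × Fin (d ^ n)) : Fin d × Fin d → Fin (n + 1) :=
  fun a => ⟨(Finset.univ.filter fun i =>
    (finFunctionFinEquiv.symm z.1 i, finFunctionFinEquiv.symm z.2 i) = a).card,
    Nat.lt_succ_of_le ((Finset.card_le_univ _).trans_eq (Fintype.card_fin n))⟩

theorem IsInv.apply_eq {d n : ℕ} {A : Matrix (Fin (d ^ n)) (Fin (d ^ n)) ℂ}
    (hA : IsInv (permEquiv d n) A) {z w : Fin (d ^ n) × Fin (d ^ n)}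
    (h : pairCount d n z = pairCount d n w) : A z.1 z.2 = A w.1 w.2 := by
  obtain ⟨π, hπ⟩ := exists_comp_perm_eq
    (fun i => (finFunctionFinEquiv.symm z.1 i, finFunctionFinEquiv.symm z.2 i))
    (fun i => (finFunctionFinEquiv.symm w.1 i, finFunctionFinEquiv.symm w.2 i))
    fun a => by
      convert! congrArg Fin.val (congrFun h a) <;> · simp only [pairCount]; congr!
  have h1 : permEquiv d n π z.1 = w.1 := by
    rw [permEquiv_apply, ← Equiv.eq_symm_apply]
    exact funext fun i => congrArg Prod.fst (congrFun hπ i)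
  have h2 : permEquiv d n π z.2 = w.2 := by
    rw [permEquiv_apply, ← Equiv.eq_symm_apply]
    exact funext fun i => congrArg Prod.snd (congrFun hπ i)
  rw [← h1, ← h2]
  exact (congrFun (congrFun (hA π) z.1) z.2).symm

theorem udiag_injective {U : Matrix ι ι ℂ} (hU : star U * U = 1) {a : ι → ℝ}
    (h : udiag U a = 0) (i : ι) : a i = 0 := by
  have h1 : wgt U (udiag U a) i = a i := by
    rw [wgt_udiag, hU, Finset.sum_eq_single i] <;> simp +contextual [eq_comm]
  rw [← h1, h]
  simp [wgt]

/-- A permutation-invariant Hermitian matrix has polynomially many eigenvalues. -/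
theorem card_image_le_of_isInv {d n : ℕ} {U : Matrix (Fin (d ^ n)) (Fin (d ^ n)) ℂ}
    {b : Fin (d ^ n) → ℝ} (hU : star U * U = 1) (hb : IsInv (permEquiv d n) (udiag U b)) :
    (Finset.univ.image b).card ≤ 2 * (n + 1) ^ (d * d) := by
  set K := Finset.univ.image b with hK
  have hbK : ∀ i, b i ∈ K := fun i => by simp [hK]
  have hinv : ∀ f : K → ℝ, IsInv (permEquiv d n) (udiag U fun i => f ⟨b i, hbK i⟩) := by
    intro f π
    let φ : ℝ → ℝ := fun r => if h : r ∈ K then f ⟨r, h⟩ else 0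
    have hφ : (fun i => f ⟨b i, hbK i⟩) = fun i => φ (b i) := by
      ext i
      simp only [φ, dif_pos (hbK i)]
    have h := hb π
    rw [submatrix_udiag] at h
    rw [hφ, submatrix_udiag]
    exact udiag_comp_eq (star_submatrix_mul hU _) hU h φ
  let L : (K → ℝ) →ₗ[ℝ] ((Set.range (pairCount d n)) → ℂ) :=
    { toFun := fun f t => udiag U (fun i => f ⟨b i, hbK i⟩) t.2.choose.1 t.2.choose.2
      map_add' := fun f g => by
        ext t
        have := udiag_add (U := U) (fun i => f ⟨b i, hbK i⟩) fun i => g ⟨b i, hbK i⟩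
        exact (congrFun (congrFun this _) _).symm
      map_smul' := fun c f => by
        ext t
        have := smul_udiag (U := U) c fun i => f ⟨b i, hbK i⟩
        exact (congrFun (congrFun this _) _).symm }
  have hL : Function.Injective L := by
    rw [injective_iff_map_eq_zero]
    intro f hf
    have h0 : udiag U (fun i => f ⟨b i, hbK i⟩) = 0 := by
      ext x y
      have h1 := congrFun hf ⟨_, Set.mem_range_self (x, y)⟩
      have h2 := (Set.mem_range_self (f := pairCount d n) (x, y)).choose_spec
      exact ((hinv f).apply_eq h2).symm.trans h1
    ext ⟨r, hr⟩
    obtain ⟨i, -, rfl⟩ := Finset.mem_image.1 hr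
    exact udiag_injective hU h0 i
  have h1 := LinearMap.finrank_le_finrank_of_injective hL
  rw [Module.finrank_fintype_fun_eq_card, Fintype.card_coe, Module.finrank_pi_fintype,
    Finset.sum_const, Complex.finrank_real_complex, Finset.card_univ, smul_eq_mul] at h1
  have h2 : Fintype.card (Set.range (pairCount d n)) ≤ (n + 1) ^ (d * d) := by
    refine (Fintype.card_le_of_injective _ Subtype.val_injective).trans_eq ?_
    simp
  linarith

end QHT

namespace QHT

variable {ι : Type*} [Fintype ι] [DecidableEq ι]

theorem finFunctionFinEquiv_symm_val {d n : ℕ} (z : Fin (d ^ n)) (i : Fin n) :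
    (finFunctionFinEquiv.symm z i : ℕ) = z / d ^ (i : ℕ) % d := rfl

theorem dpow_add {d : ℕ} (ρ : Matrix (Fin d) (Fin d) ℂ) (m n : ℕ)
    (h : d ^ (n + m) = d ^ m * d ^ n) :
    dpow ρ (n + m) = (dtens (dpow ρ m) (dpow ρ n)).submatrix (finCongr h) (finCongr h) := by
  have h1 : ∀ (z : Fin (d ^ (n + m))) (i : Fin n),
      finFunctionFinEquiv.symm (finProdFinEquiv.symm (finCongr h z)).2 i =
        finFunctionFinEquiv.symm z (Fin.castAdd m i) := by
    intro z i
    ext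
    rw [finFunctionFinEquiv_symm_val, finFunctionFinEquiv_symm_val]
    change (z : ℕ) % d ^ n / d ^ (i : ℕ) % d = z / d ^ (i : ℕ) % d
    obtain ⟨k, hk⟩ := Nat.exists_eq_add_of_lt i.2
    generalize (z : ℕ) = w
    generalize (i : ℕ) = j at hk
    rw [hk, add_assoc, pow_add, Nat.mod_mul_right_div_self,
      Nat.mod_mod_of_dvd _ (dvd_pow_self d (Nat.succ_ne_zero k))]
  have h2 : ∀ (z : Fin (d ^ (n + m))) (i : Fin m),
      finFunctionFinEquiv.symm (finProdFinEquiv.symm (finCongr h z)).1 i =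
        finFunctionFinEquiv.symm z (Fin.natAdd n i) := by
    intro z i
    ext
    rw [finFunctionFinEquiv_symm_val, finFunctionFinEquiv_symm_val]
    change (z : ℕ) / d ^ n / d ^ (i : ℕ) % d = z / d ^ (n + (i : ℕ)) % d
    generalize (z : ℕ) = w
    rw [Nat.div_div_eq_div_mul, pow_add]
  ext x y
  simp only [Matrix.submatrix_apply, dtens, dpow, Matrix.of_apply, h1, h2, Fin.prod_univ_add]
  exact mul_comm _ _

theorem dpow_one {d : ℕ} (ρ : Matrix (Fin d) (Fin d) ℂ) (h : d ^ 1 = d) :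
    dpow ρ 1 = ρ.submatrix (finCongr h) (finCongr h) := by
  have h1 : ∀ z : Fin (d ^ 1), finFunctionFinEquiv.symm z 0 = finCongr h z := by
    intro z
    ext
    rw [finFunctionFinEquiv_symm_val]
    have := z.2
    simp only [pow_one] at this
    simpa using Nat.mod_eq_of_lt this
  ext x y
  simp only [Matrix.submatrix_apply, dpow, Matrix.of_apply, Fin.prod_univ_one, h1]

theorem mem_of_finCongr {S : (d : ℕ) → Set (Matrix (Fin d) (Fin d) ℂ)} {m k : ℕ} (h : m = k)
    {A : Matrix (Fin k) (Fin k) ℂ} (hA : A ∈ S k) :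
    A.submatrix (finCongr h) (finCongr h) ∈ S m := by
  subst h
  exact hA

theorem isState_submatrix {κ : Type*} [Fintype κ] [DecidableEq κ] {ρ : Matrix ι ι ℂ}
    (hρ : IsState ρ) (f : κ ≃ ι) : IsState (ρ.submatrix f f) :=
  ⟨hρ.1.submatrix f, (Equiv.sum_comp f fun i => ρ i i).trans hρ.2⟩

theorem isState_dpow {d : ℕ} {ρ : Matrix (Fin d) (Fin d) ℂ} (hρ : IsState ρ) {n : ℕ}
    (hn : 1 ≤ n) : IsState (dpow ρ n) := by
  induction n, hn using Nat.le_induction with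
  | base => exact dpow_one ρ (pow_one d) ▸ isState_submatrix hρ _
  | succ n _ ih =>
    rw [dpow_add ρ 1 n (by ring)]
    refine isState_submatrix (isState_dtens ?_ ih) _
    exact dpow_one ρ (pow_one d) ▸ isState_submatrix hρ _

theorem dpow_mem {S : (d : ℕ) → Set (Matrix (Fin d) (Fin d) ℂ)} (hS : Assumption1' S) {d : ℕ}
    (hd : 1 ≤ d) {τ : Matrix (Fin d) (Fin d) ℂ} (hτ : τ ∈ S d) {n : ℕ} (hn : 1 ≤ n) :
    dpow τ n ∈ S (d ^ n) := by
  have h1 : dpow τ 1 ∈ S (d ^ 1) := dpow_one τ (pow_one d) ▸ mem_of_finCongr _ hτ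
  induction n, hn using Nat.le_induction with
  | base => exact h1
  | succ n _ ih =>
    rw [dpow_add τ 1 n (by ring)]
    exact mem_of_finCongr _ (hS.tens _ _ (Nat.one_le_pow _ _ hd) (Nat.one_le_pow _ _ hd) _ h1 _ ih)

theorem posSemidef_smul_dpow_sub {d : ℕ} {ρ τ : Matrix (Fin d) (Fin d) ℂ} (hρ : IsState ρ)
    (hτ : IsState τ) {c : ℝ} (hc : 0 < c) (h : (c • τ - ρ).PosSemidef)
    {n : ℕ} (hn : 1 ≤ n) : (c ^ n • dpow τ n - dpow ρ n).PosSemidef := by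
  have h1 : (c • dpow τ 1 - dpow ρ 1).PosSemidef := by
    rw [dpow_one τ (pow_one d), dpow_one ρ (pow_one d)]
    exact h.submatrix (finCongr (pow_one d))
  induction n, hn using Nat.le_induction with
  | base => simpa using h1
  | succ n hn ih =>
    rw [dpow_add τ 1 n (by ring), dpow_add ρ 1 n (by ring)]
    have h2 : c ^ (n + 1) • dtens (dpow τ 1) (dpow τ n) - dtens (dpow ρ 1) (dpow ρ n) =
        dtens (c • dpow τ 1 - dpow ρ 1) (c ^ n • dpow τ n) +
          dtens (dpow ρ 1) (c ^ n • dpow τ n - dpow ρ n) := by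
      ext x y
      simp only [dtens, Matrix.sub_apply, Matrix.smul_apply, Matrix.of_apply, Matrix.add_apply,
        Complex.real_smul, Complex.ofReal_pow]
      ring
    have h3 := (posSemidef_dtens h1 (posSemidef_smul (pow_nonneg hc.le n)
      (isState_dpow hτ hn).1)).add (posSemidef_dtens (isState_dpow hρ le_rfl).1 ih)
    rw [← h2] at h3
    exact h3.submatrix _

end QHT

namespace QHT

variable {ι : Type*} [Fintype ι] [DecidableEq ι]

theorem rtr_mul_mlog_le_sub_one {ρ Z : Matrix ι ι ℂ} (hρ : IsState ρ) (hZ : Z.PosDef) :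
    rtr (ρ * mlog Z) ≤ rtr (ρ * Z) - 1 := by
  obtain ⟨U, a, hU, rfl, ha⟩ := exists_udiag_posDef hZ
  rw [mlog_udiag hU, rtr_mul_udiag, rtr_mul_udiag, ← IsState.rtr_eq_one hρ, ← sum_wgt hU ρ,
    ← Finset.sum_sub_distrib]
  refine Finset.sum_le_sum fun i _ => ?_
  have := mul_le_mul_of_nonneg_left (Real.log_le_sub_one_of_pos (ha i)) (wgt_nonneg (U := U) hρ.1 i)
  linarith

theorem mem_polar_of_finCongr {S : (d : ℕ) → Set (Matrix (Fin d) (Fin d) ℂ)} {m k : ℕ}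
    (h : m = k) {A : Matrix (Fin k) (Fin k) ℂ} (hA : A ∈ polar (S k)) :
    A.submatrix (finCongr h) (finCongr h) ∈ polar (S m) := by
  subst h
  exact hA

section family

variable {S : (d : ℕ) → Set (Matrix (Fin d) (Fin d) ℂ)} {d : ℕ}

/-- The number of eigenvalues that a permutation-invariant operator on `(ℂ^d)^{⊗n}` may have. -/
def eigBound (d n : ℕ) : ℕ := 2 * (n + 1) ^ (d * d)

/-- The values of the variational expression for the minimized relative entropy of `ρ^{⊗n}`. -/
def dualSet (S : (d : ℕ) → Set (Matrix (Fin d) (Fin d) ℂ)) (ρ : Matrix (Fin d) (Fin d) ℂ)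
    (n : ℕ) : Set ℝ :=
  {x | ∃ Y ∈ polar (S (d ^ n)), Y.PosDef ∧ rtr (dpow ρ n * mlog Y) = x}

/-- The variational lower bound on the minimized relative entropy of `ρ^{⊗n}`. -/
def dualVal (S : (d : ℕ) → Set (Matrix (Fin d) (Fin d) ℂ)) (ρ : Matrix (Fin d) (Fin d) ℂ)
    (n : ℕ) : ℝ := sSup (dualSet S ρ n)

/-- A state of the family whose support contains that of the given state. -/
def HasFullSupport (S : (d : ℕ) → Set (Matrix (Fin d) (Fin d) ℂ))
    (ρ : Matrix (Fin d) (Fin d) ℂ) : Prop :=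
  ∃ τ ∈ S d, IsState τ ∧ msupp ρ ≤ msupp τ

variable {ρ : Matrix (Fin d) (Fin d) ℂ}

theorem exists_forall_dualSet_le (hS : Assumption1' S) (hd : 1 ≤ d) (hρ : IsState ρ)
    (hτ : HasFullSupport S ρ) : ∃ K : ℝ, ∀ n, 1 ≤ n → ∀ x ∈ dualSet S ρ n, x ≤ n * K := by
  obtain ⟨τ, hτS, hτ, hsupp⟩ := hτ
  obtain ⟨c, hc, h⟩ := exists_smul_sub_posSemidef hρ hτ.1 hsupp
  refine ⟨Real.log c, ?_⟩
  rintro n hn _ ⟨Y, hY, hpd, rfl⟩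
  have hcn : 0 < (c ^ n)⁻¹ := by positivity
  have h1 := rtr_mul_mlog_le_sub_one (isState_dpow hρ hn) (posDef_smul hcn hpd)
  rw [rtr_mlog_smul (isState_dpow hρ hn) hpd hcn, Real.log_inv, Real.log_pow,
    Matrix.mul_smul, rtr_smul, rtr_mul_comm _ Y] at h1
  have h2 := rtr_mul_le_of_posSemidef_sub hY.1 (posSemidef_smul_dpow_sub hρ hτ hc h hn)
  have h3 := hY.2 _ (dpow_mem hS hd hτS hn)
  rw [Matrix.mul_smul, rtr_smul] at h2
  have h4 : (c ^ n)⁻¹ * rtr (Y * dpow ρ n) ≤ 1 := by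
    rw [inv_mul_le_iff₀ (by positivity)]
    have := mul_le_mul_of_nonneg_left h3 (by positivity : 0 ≤ c ^ n)
    linarith
  linarith

theorem dualSet_nonempty (hS : Assumption1' S) (hd : 1 ≤ d) (n : ℕ) :
    (dualSet S ρ n).Nonempty := by
  have h0 : 0 < max (supp (S (d ^ n)) 1) 1 := lt_max_of_lt_right one_pos
  exact ⟨_, _, smul_mem_polar (hS.compact _ (Nat.one_le_pow _ _ hd)) Matrix.PosSemidef.one
    (le_max_left _ _) h0, posDef_smul (inv_pos.2 h0) Matrix.PosDef.one, rfl⟩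

theorem le_dualVal (hS : Assumption1' S) (hd : 1 ≤ d) (hρ : IsState ρ)
    (hτ : HasFullSupport S ρ) {n : ℕ} (hn : 1 ≤ n) {Y : Matrix (Fin (d ^ n)) (Fin (d ^ n)) ℂ}
    (hY : Y ∈ polar (S (d ^ n))) (hpd : Y.PosDef) :
    rtr (dpow ρ n * mlog Y) ≤ dualVal S ρ n := by
  obtain ⟨K, hK⟩ := exists_forall_dualSet_le hS hd hρ hτ
  exact le_csSup ⟨_, fun x hx => hK n hn x hx⟩ ⟨Y, hY, hpd, rfl⟩

theorem dualVal_le (hS : Assumption1' S) (hd : 1 ≤ d) {n : ℕ} {x : ℝ}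
    (h : ∀ Y ∈ polar (S (d ^ n)), Y.PosDef → rtr (dpow ρ n * mlog Y) ≤ x) :
    dualVal S ρ n ≤ x := by
  refine csSup_le (dualSet_nonempty hS hd n) ?_
  rintro _ ⟨Y, hY, hpd, rfl⟩
  exact h Y hY hpd

theorem dualVal_add_le (hS : Assumption1' S) (hd : 1 ≤ d) (hρ : IsState ρ)
    (hτ : HasFullSupport S ρ) {m n : ℕ} (hm : 1 ≤ m) (hn : 1 ≤ n) :
    dualVal S ρ m + dualVal S ρ n ≤ dualVal S ρ (n + m) := by
  have h : d ^ (n + m) = d ^ m * d ^ n := by ring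
  rw [← le_sub_iff_add_le]
  refine dualVal_le hS hd fun X hX hXpd => ?_
  rw [le_sub_comm]
  refine dualVal_le hS hd fun Y hY hYpd => ?_
  have h1 := le_dualVal hS hd hρ hτ (le_add_right hn) (mem_polar_of_finCongr h
    (hS.polarTens _ _ (Nat.one_le_pow _ _ hd) (Nat.one_le_pow _ _ hd) _ hX _ hY))
    (posDef_submatrix (posDef_dtens hXpd hYpd) (finCongr h))
  rw [dpow_add ρ m n h, rtr_mul_mlog_submatrix _ _ (posDef_dtens hXpd hYpd).1,
    rtr_dtens_mul_mlog_dtens_of_posDef (isState_dpow hρ hm) (isState_dpow hρ hn) hXpd hYpd] at h1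
  linarith

theorem exists_tendsto_dualVal_div (hS : Assumption1' S) (hd : 1 ≤ d) (hρ : IsState ρ)
    (hτ : HasFullSupport S ρ) :
    ∃ r : ℝ, Tendsto (fun n : ℕ => dualVal S ρ n / n) atTop (nhds r) := by
  obtain ⟨K, hK⟩ := exists_forall_dualSet_le hS hd hρ hτ
  let u : ℕ → ℝ := fun n => if n = 0 then 0 else -dualVal S ρ n
  have hu : Subadditive u := by
    intro m n
    rcases Nat.eq_zero_or_pos m with rfl | hm
    · simp [u]
    rcases Nat.eq_zero_or_pos n with rfl | hn
    · simp [u]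
    have := dualVal_add_le hS hd hρ hτ hn hm
    simp only [u, hm.ne', hn.ne', Nat.add_eq_zero_iff, and_self, if_false]
    linarith
  have hb : BddBelow (Set.range fun n => u n / (n : ℝ)) := by
    refine ⟨min (-K) 0, ?_⟩
    rintro _ ⟨n, rfl⟩
    rcases Nat.eq_zero_or_pos n with rfl | hn
    · simp
    refine (min_le_left _ _).trans ?_
    have h0 : (0 : ℝ) < n := by exact_mod_cast hn
    have h1 : dualVal S ρ n ≤ n * K :=
      csSup_le (dualSet_nonempty hS hd n) fun x hx => hK n hn x hx
    simp only [u, hn.ne', if_false]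
    rw [le_div_iff₀ h0]
    linarith
  refine ⟨-hu.lim, (hu.tendsto_lim hb).neg.congr' ?_⟩
  filter_upwards [eventually_ge_atTop 1] with n hn
  have hn0 : n ≠ 0 := Nat.one_le_iff_ne_zero.1 hn
  simp only [u, hn0, if_false, neg_div, neg_neg]

theorem tendsto_log_eigBound_div (d : ℕ) :
    Tendsto (fun n : ℕ => Real.log (eigBound d n) / n) atTop (nhds 0) := by
  have h1 : Tendsto (fun n : ℕ => Real.log ((n : ℝ) + 1) / n) atTop (nhds 0) := by
    have h := (Real.tendsto_pow_log_div_mul_add_atTop 1 (-1) 1 one_ne_zero).comp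
      (tendsto_natCast_atTop_atTop.atTop_add (tendsto_const_nhds (x := (1 : ℝ))))
    refine h.congr fun n => ?_
    simp
  have h2 : Tendsto (fun n : ℕ => Real.log 2 / n + (d * d : ℕ) * (Real.log ((n : ℝ) + 1) / n))
      atTop (nhds 0) := by
    simpa using (tendsto_const_div_atTop_nhds_zero_nat (Real.log 2)).add
      (h1.const_mul ((d * d : ℕ) : ℝ))
  refine h2.congr fun n => ?_
  have : Real.log (eigBound d n) = Real.log 2 + (d * d : ℕ) * Real.log ((n : ℝ) + 1) := by
    rw [eigBound, ← Real.log_pow, ← Real.log_mul two_ne_zero (by positivity)]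
    push_cast
    rfl
  rw [this]
  ring

/-- Invariance of the family under permutations of tensor factors. -/
def PermInvariant (S : (d : ℕ) → Set (Matrix (Fin d) (Fin d) ℂ)) : Prop :=
  ∀ d k : ℕ, ∀ π : Equiv.Perm (Fin k), ∀ A ∈ S (d ^ k), permMat d k π A ∈ S (d ^ k)

theorem dualVal_sub_le_relEnt (hS : Assumption1' S) (hperm : PermInvariant S) (hd : 1 ≤ d)
    (hρ : IsState ρ) {n : ℕ} (hn : 1 ≤ n) {σ : Matrix (Fin (d ^ n)) (Fin (d ^ n)) ℂ}
    (hσ : σ ∈ S (d ^ n)) :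
    ((dualVal S ρ n - Real.log (eigBound d n) : ℝ) : EReal) ≤ relEnt (dpow ρ n) σ := by
  have hD := Nat.one_le_pow n d hd
  have h : ∀ Y ∈ polar (S (d ^ n)), Y.PosDef →
      ((rtr (dpow ρ n * mlog Y) - Real.log (eigBound d n) : ℝ) : EReal) ≤ relEnt (dpow ρ n) σ :=
    fun Y hY hpd => le_relEnt_of_mem_polar (permEquiv_mul d n) (hS.convex _ hD) (hperm d n)
      (fun U b hU hb => card_image_le_of_isInv hU hb) (hS.psd _ hD) (isState_dpow hρ hn)
      (isInv_dpow ρ n) hpd hY hσ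
  generalize relEnt (dpow ρ n) σ = D at h
  induction D with
  | top => exact le_top
  | bot =>
    obtain ⟨_, Y, hY, hpd, -⟩ := dualSet_nonempty (ρ := ρ) hS hd n
    exact absurd (le_bot_iff.1 (h Y hY hpd)) (EReal.coe_ne_bot _)
  | coe x =>
    rw [EReal.coe_le_coe_iff, sub_le_iff_le_add]
    refine dualVal_le hS hd fun Y hY hpd => ?_
    have := h Y hY hpd
    rwa [EReal.coe_le_coe_iff, sub_le_iff_le_add] at this

theorem exists_relEnt_le (hS : Assumption1' S) (hperm : PermInvariant S) (hd : 1 ≤ d)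
    (hρ : IsState ρ) (hτ : HasFullSupport S ρ) {n : ℕ} (hn : 1 ≤ n) {x : ℝ}
    (hx : dualVal S ρ n + Real.log (eigBound d n) < x) :
    ∃ σ ∈ S (d ^ n), relEnt (dpow ρ n) σ ≤ x := by
  by_contra! h
  have hD := Nat.one_le_pow n d hd
  obtain ⟨Y, hY, hpd, -, hle⟩ := exists_mem_polar_le (permEquiv_mul d n) (hS.convex _ hD)
    (hperm d n) (v := eigBound d n) (fun U b hU hb => card_image_le_of_isInv hU hb) (hS.psd _ hD)
    (isState_dpow hρ hn) (isInv_dpow ρ n) (hS.compact _ hD)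
    ⟨_, dpow_mem hS hd hτ.choose_spec.1 hn⟩ (c := x - Real.log (eigBound d n))
    (by simpa using h)
  have := le_dualVal hS hd hρ hτ hn hY hpd
  linarith

theorem tendsto_iInf_relEnt (hS : Assumption1' S) (hperm : PermInvariant S) (hd : 1 ≤ d)
    (hρ : IsState ρ) (hτ : HasFullSupport S ρ) {r : ℝ}
    (hr : Tendsto (fun n : ℕ => dualVal S ρ n / n) atTop (nhds r)) :
    Tendsto (fun n : ℕ => (((n : ℝ)⁻¹ : ℝ) : EReal) * ⨅ σ ∈ S (d ^ n), relEnt (dpow ρ n) σ)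
      atTop (nhds (r : EReal)) := by
  have h1 : Tendsto (fun n : ℕ => (((n : ℝ)⁻¹ * (dualVal S ρ n - Real.log (eigBound d n)) : ℝ) :
      EReal)) atTop (nhds (r : EReal)) := by
    refine continuous_coe_real_ereal.continuousAt.tendsto.comp ?_
    have := hr.sub (tendsto_log_eigBound_div d)
    rw [sub_zero] at this
    exact this.congr fun n => by ring
  have h2 : Tendsto (fun n : ℕ => (((n : ℝ)⁻¹ * (dualVal S ρ n + Real.log (eigBound d n)) : ℝ) :
      EReal)) atTop (nhds (r : EReal)) := by
    refine continuous_coe_real_ereal.continuousAt.tendsto.comp ?_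
    have := hr.add (tendsto_log_eigBound_div d)
    rw [add_zero] at this
    exact this.congr fun n => by ring
  have h0 : ∀ n : ℕ, (0 : EReal) ≤ (((n : ℝ)⁻¹ : ℝ) : EReal) := fun n => by
    exact_mod_cast (by positivity : (0 : ℝ) ≤ (n : ℝ)⁻¹)
  refine tendsto_of_tendsto_of_tendsto_of_le_of_le' h1 h2 ?_ ?_
  · filter_upwards [eventually_ge_atTop 1] with n hn
    rw [EReal.coe_mul]
    exact mul_le_mul_of_nonneg_left
      (le_iInf₂ fun σ hσ => dualVal_sub_le_relEnt hS hperm hd hρ hn hσ) (h0 n)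
  · filter_upwards [eventually_ge_atTop 1] with n hn
    rw [EReal.coe_mul]
    refine mul_le_mul_of_nonneg_left (EReal.le_of_forall_lt_iff_le.1 fun x hx => ?_) (h0 n)
    obtain ⟨σ, hσ, h⟩ := exists_relEnt_le hS hperm hd hρ hτ hn (EReal.coe_lt_coe_iff.1 hx)
    exact iInf₂_le_of_le σ hσ h

end family

end QHT

namespace QHT

section product

variable {S : (d : ℕ) → Set (Matrix (Fin d) (Fin d) ℂ)} {d₁ d₂ : ℕ}
  {ρ₁ : Matrix (Fin d₁) (Fin d₁) ℂ} {ρ₂ : Matrix (Fin d₂) (Fin d₂) ℂ}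

theorem dpow_dtens (ρ₁ : Matrix (Fin d₁) (Fin d₁) ℂ) (ρ₂ : Matrix (Fin d₂) (Fin d₂) ℂ) (n : ℕ) :
    dpow (dtens ρ₁ ρ₂) n =
      (dtens (dpow ρ₁ n) (dpow ρ₂ n)).submatrix (reord d₁ d₂ n) (reord d₁ d₂ n) := by
  ext x y
  simp only [Matrix.submatrix_apply, dtens, dpow, Matrix.of_apply, reord_apply,
    Equiv.symm_apply_apply, Finset.prod_mul_distrib, fstDigit, sndDigit]

theorem HasFullSupport.dtens (hS : Assumption1' S) (hd₁ : 1 ≤ d₁) (hd₂ : 1 ≤ d₂)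
    (h₁ : HasFullSupport S ρ₁) (h₂ : HasFullSupport S ρ₂) :
    HasFullSupport S (dtens ρ₁ ρ₂) := by
  obtain ⟨τ₁, hτ₁, hs₁, hm₁⟩ := h₁
  obtain ⟨τ₂, hτ₂, hs₂, hm₂⟩ := h₂
  exact ⟨_, hS.tens _ _ hd₁ hd₂ _ hτ₁ _ hτ₂, isState_dtens hs₁ hs₂, msupp_dtens_le hm₁ hm₂⟩

theorem HasFullSupport.wset_nonempty {d : ℕ} {ρ : Matrix (Fin d) (Fin d) ℂ}
    (hS : Assumption1' S) (hd : 1 ≤ d) (h : HasFullSupport S ρ) : (wset (wt S) d).Nonempty := by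
  obtain ⟨τ, hτ, hs, -⟩ := h
  by_contra! hne
  have h1 : rtr τ ≤ 0 := by
    rw [rtr, Matrix.trace, Complex.re_sum]
    refine Finset.sum_nonpos fun i _ => (diag_le_wt hS hd hτ i).trans ?_
    by_contra! hi
    exact (hne ▸ (⟨i.2, hi⟩ : (i : ℕ) ∈ wset (wt S) d) : (i : ℕ) ∈ (∅ : Set ℕ))
  rw [IsState.rtr_eq_one hs] at h1
  linarith

theorem dualVal_add_le_dualVal_dtens (hS : Assumption1' S) (hperm : PermInvariant S)
    (hd₁ : 1 ≤ d₁) (hd₂ : 1 ≤ d₂) (hρ₁ : IsState ρ₁) (hρ₂ : IsState ρ₂)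
    (h₁ : HasFullSupport S ρ₁) (h₂ : HasFullSupport S ρ₂) {n : ℕ} (hn : 1 ≤ n) :
    dualVal S ρ₁ n + dualVal S ρ₂ n ≤ dualVal S (dtens ρ₁ ρ₂) n := by
  have hD₁ := Nat.one_le_pow n d₁ hd₁
  have hD₂ := Nat.one_le_pow n d₂ hd₂
  have hd := Nat.mul_le_mul hd₁ hd₂
  rw [← le_sub_iff_add_le]
  refine dualVal_le hS hd₁ fun X hX hXpd => ?_
  rw [le_sub_comm]
  refine dualVal_le hS hd₂ fun Y hY hYpd => ?_
  have hpd := posDef_dtens hXpd hYpd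
  have hpd' := posDef_submatrix hpd (reord d₁ d₂ n)
  have h := (mem_polar_iff_supp (hS.compact _ (Nat.mul_le_mul hD₁ hD₂))).1
    (hS.polarTens _ _ hD₁ hD₂ _ hX _ hY)
  have hmem : (dtens X Y).submatrix (reord d₁ d₂ n) (reord d₁ d₂ n) ∈
      polar (S ((d₁ * d₂) ^ n)) := by
    rw [mem_polar_iff_supp (hS.compact _ (Nat.one_le_pow n _ hd))]
    refine ⟨hpd'.posSemidef, ?_⟩
    rw [← supp_reord hS hperm hd₁ hd₂ hn (h₁.wset_nonempty hS hd₁) (h₂.wset_nonempty hS hd₂)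
      hpd'.posSemidef, Matrix.submatrix_submatrix, Equiv.self_comp_symm, Matrix.submatrix_id_id]
    exact h.2
  have := le_dualVal hS hd (isState_dtens hρ₁ hρ₂) (h₁.dtens hS hd₁ hd₂ h₂) hn hmem hpd'
  rw [dpow_dtens, rtr_mul_mlog_submatrix _ _ hpd.1,
    rtr_dtens_mul_mlog_dtens_of_posDef (isState_dpow hρ₁ hn) (isState_dpow hρ₂ hn) hXpd hYpd]
    at this
  linarith

theorem dualVal_dtens_le (hS : Assumption1' S) (hperm : PermInvariant S)
    (hd₁ : 1 ≤ d₁) (hd₂ : 1 ≤ d₂) (hρ₁ : IsState ρ₁) (hρ₂ : IsState ρ₂)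
    (h₁ : HasFullSupport S ρ₁) (h₂ : HasFullSupport S ρ₂) {n : ℕ} (hn : 1 ≤ n) :
    dualVal S (dtens ρ₁ ρ₂) n ≤ dualVal S ρ₁ n + dualVal S ρ₂ n + (Real.log (eigBound d₁ n) +
      Real.log (eigBound d₂ n) + Real.log (eigBound (d₁ * d₂) n)) := by
  have hD₁ := Nat.one_le_pow n d₁ hd₁
  have hD₂ := Nat.one_le_pow n d₂ hd₂
  have hd := Nat.mul_le_mul hd₁ hd₂
  have hD := Nat.one_le_pow n _ hd
  have hst := isState_dpow (isState_dtens hρ₁ hρ₂) hn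
  refine le_of_forall_pos_le_add fun ε hε => dualVal_le hS hd fun Y₀ hY₀ hpd₀ => ?_
  obtain ⟨σ₁, hσ₁, hle₁⟩ := exists_relEnt_le hS hperm hd₁ hρ₁ h₁ hn
    (x := dualVal S ρ₁ n + Real.log (eigBound d₁ n) + ε / 2) (by linarith)
  obtain ⟨σ₂, hσ₂, hle₂⟩ := exists_relEnt_le hS hperm hd₂ hρ₂ h₂ hn
    (x := dualVal S ρ₂ n + Real.log (eigBound d₂ n) + ε / 2) (by linarith)
  have hle := rtr_mlog_le_twirl (permEquiv (d₁ * d₂) n) hst.1 (isInv_dpow (dtens ρ₁ ρ₂) n) hpd₀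
  have hY := twirl_mem_polar (permEquiv_mul (d₁ * d₂) n) (hS.convex _ hD) (hperm _ n)
    hpd₀ hY₀
  have hpd := posDef_twirl (permEquiv (d₁ * d₂) n) hpd₀
  have hinv := isInv_twirl _ (permEquiv_mul (d₁ * d₂) n) Y₀
  generalize twirl (permEquiv (d₁ * d₂) n) Y₀ = Y at hle hY hpd hinv
  obtain ⟨U, y, hU, rfl, hy⟩ := exists_udiag_posDef hpd
  have hps₁ := hS.psd _ hD₁ _ hσ₁
  have hps₂ := hS.psd _ hD₂ _ hσ₂
  have hsupp := ((mem_polar_iff_supp (hS.compact _ hD)).1 hY).2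
  rw [← supp_reord hS hperm hd₁ hd₂ hn (h₁.wset_nonempty hS hd₁) (h₂.wset_nonempty hS hd₂)
    hpd.posSemidef, submatrix_udiag] at hsupp
  have hσ := (rtr_le_supp (hS.compact _ (Nat.mul_le_mul hD₁ hD₂)) _
    (hS.tens _ _ hD₁ hD₂ _ hσ₁ _ hσ₂)).trans hsupp
  rw [rtr_mul_comm] at hσ
  have hmain := (le_relEnt_of_rtr_mul_le
    (isState_dtens (isState_dpow hρ₁ hn) (isState_dpow hρ₂ hn)) (posSemidef_dtens hps₁ hps₂)
    (star_submatrix_mul hU _) (fun i => hy _) hσ).trans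
    ((relEnt_dtens_le (isState_dpow hρ₁ hn) (isState_dpow hρ₂ hn) hps₁ hps₂).trans
      (add_le_add hle₁ hle₂))
  rw [← EReal.coe_add, EReal.coe_le_coe_iff, ← submatrix_udiag] at hmain
  have hrtr := rtr_mul_mlog_submatrix (reord d₁ d₂ n).symm (dpow (dtens ρ₁ ρ₂) n) hpd.1
  rw [dpow_dtens, Matrix.submatrix_submatrix, Equiv.self_comp_symm, Matrix.submatrix_id_id,
    ← dpow_dtens] at hrtr
  have hcard : (Finset.univ.image fun i => y ((reord d₁ d₂ n).symm i)).card ≤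
      eigBound (d₁ * d₂) n := by
    refine (Finset.card_le_card ?_).trans (card_image_le_of_isInv hU hinv)
    intro r hr
    obtain ⟨i, -, rfl⟩ := Finset.mem_image.1 hr
    exact Finset.mem_image_of_mem _ (Finset.mem_univ _)
  have hlog : Real.log (Finset.univ.image fun i => y ((reord d₁ d₂ n).symm i)).card ≤
      Real.log (eigBound (d₁ * d₂) n) := by
    have := (IsState.nonempty (isState_dtens (isState_dpow hρ₁ hn) (isState_dpow hρ₂ hn)))
    refine Real.log_le_log ?_ (by exact_mod_cast hcard)
    exact_mod_cast (Finset.univ_nonempty.image _).card_pos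
  linarith

end product

end QHT

namespace QHT

/-- Proposition 8 of the paper: the regularized minimized Umegaki
relative entropy is strongly additive.  The regularizations are expressed as limits,
which are asserted to exist. -/
theorem regularized_umegaki_strongly_additive {d₁ d₂ : ℕ} (hd₁ : 1 ≤ d₁) (hd₂ : 1 ≤ d₂)
    (ρ₁ : Matrix (Fin d₁) (Fin d₁) ℂ) (ρ₂ : Matrix (Fin d₂) (Fin d₂) ℂ)
    (hρ₁ : IsState ρ₁) (hρ₂ : IsState ρ₂)
    (S : (d : ℕ) → Set (Matrix (Fin d) (Fin d) ℂ)) (hS : Assumption1' S)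
    (hsupp₁ : ∃ τ ∈ S d₁, IsState τ ∧ msupp ρ₁ ≤ msupp τ)
    (hsupp₂ : ∃ τ ∈ S d₂, IsState τ ∧ msupp ρ₂ ≤ msupp τ)
    (hperm : ∀ d k : ℕ, ∀ π : Equiv.Perm (Fin k),
      ∀ A ∈ S (d ^ k), permMat d k π A ∈ S (d ^ k)) :
    ∃ r₁ r₂ r₁₂ : EReal,
      Filter.Tendsto
        (fun n : ℕ => (((n : ℝ)⁻¹ : ℝ) : EReal) * ⨅ σ ∈ S (d₁ ^ n), relEnt (dpow ρ₁ n) σ)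
        Filter.atTop (nhds r₁) ∧
      Filter.Tendsto
        (fun n : ℕ => (((n : ℝ)⁻¹ : ℝ) : EReal) * ⨅ σ ∈ S (d₂ ^ n), relEnt (dpow ρ₂ n) σ)
        Filter.atTop (nhds r₂) ∧
      Filter.Tendsto
        (fun n : ℕ => (((n : ℝ)⁻¹ : ℝ) : EReal) *
          ⨅ σ ∈ S ((d₁ * d₂) ^ n), relEnt (dpow (dtens ρ₁ ρ₂) n) σ)
        Filter.atTop (nhds r₁₂) ∧
      r₁₂ = r₁ + r₂ := by
  have hd := Nat.mul_le_mul hd₁ hd₂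
  have hρ := isState_dtens hρ₁ hρ₂
  have hsupp : HasFullSupport S (dtens ρ₁ ρ₂) := HasFullSupport.dtens hS hd₁ hd₂ hsupp₁ hsupp₂
  obtain ⟨r₁, h₁⟩ := exists_tendsto_dualVal_div hS hd₁ hρ₁ hsupp₁
  obtain ⟨r₂, h₂⟩ := exists_tendsto_dualVal_div hS hd₂ hρ₂ hsupp₂
  obtain ⟨r, h⟩ := exists_tendsto_dualVal_div hS hd hρ hsupp
  refine ⟨r₁, r₂, r, tendsto_iInf_relEnt hS hperm hd₁ hρ₁ hsupp₁ h₁,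
    tendsto_iInf_relEnt hS hperm hd₂ hρ₂ hsupp₂ h₂, tendsto_iInf_relEnt hS hperm hd hρ hsupp h, ?_⟩
  rw [← EReal.coe_add, EReal.coe_eq_coe_iff]
  have hlog := ((tendsto_log_eigBound_div d₁).add (tendsto_log_eigBound_div d₂)).add
    (tendsto_log_eigBound_div (d₁ * d₂))
  simp only [add_zero] at hlog
  refine le_antisymm ?_ ?_
  · rw [← add_zero (r₁ + r₂)]
    refine le_of_tendsto_of_tendsto h ((h₁.add h₂).add hlog) ?_
    filter_upwards [eventually_ge_atTop 1] with n hn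
    rw [← add_div, ← add_div, ← add_div, ← add_div]
    exact div_le_div_of_nonneg_right
      (dualVal_dtens_le hS hperm hd₁ hd₂ hρ₁ hρ₂ hsupp₁ hsupp₂ hn) n.cast_nonneg
  · refine le_of_tendsto_of_tendsto (h₁.add h₂) h ?_
    filter_upwards [eventually_ge_atTop 1] with n hn
    rw [← add_div]
    exact div_le_div_of_nonneg_right
      (dualVal_add_le_dualVal_dtens hS hperm hd₁ hd₂ hρ₁ hρ₂ hsupp₁ hsupp₂ hn) n.cast_nonneg

end QHT
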